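/- arXiv:1207.0715 — 3 statements merged into one kernel-verified Lean document; each statement's English description precedes it below -/
import Mathlib

section
/- Let n ≥ 5, let α ∈ [2, n−3], and let E ⊂ ℝⁿ be a set of finite perimeter with |E| = |B_1|. Set f_E = χ_{B_1} − χ_E, φ_β(r) = (1/H^{n−1}(∂B_r)) ∫_{∂B_r} I_β f_E dH^{n−1}, and Φ_α(r) = (1/|B_r|) ∫_{B_r} I_α f_E dx. If φ_α is nonincreasing on (0,∞), then for every r ∈ (0,1): φ_{α+2}(r) ≥ Φ_α(1)·(1 − r²)/(2n). -/
open MeasureTheory Metric Set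

noncomputable section

/-- The divergence of a vector field on `ℝⁿ`. -/
def vdiv {n : ℕ} (φ : EuclideanSpace ℝ (Fin n) → EuclideanSpace ℝ (Fin n))
    (x : EuclideanSpace ℝ (Fin n)) : ℝ :=
  ∑ i, fderiv ℝ φ x (EuclideanSpace.single i 1) i

/-- The set of admissible values `∫_F div φ` in the variational definition of the
perimeter: `φ` ranges over compactly supported `C¹` vector fields with `‖φ‖ ≤ 1`. -/
def perimVals {n : ℕ} (F : Set (EuclideanSpace ℝ (Fin n))) : Set ℝ :=
  { r | ∃ φ : EuclideanSpace ℝ (Fin n) → EuclideanSpace ℝ (Fin n),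
      ContDiff ℝ 1 φ ∧ HasCompactSupport φ ∧ (∀ x, ‖φ x‖ ≤ 1) ∧
      r = ∫ x in F, vdiv φ x }

/-- The (distributional) perimeter `P(F)`. -/
def perimeter {n : ℕ} (F : Set (EuclideanSpace ℝ (Fin n))) : ℝ := sSup (perimVals F)

/-- `F` is a set of finite perimeter: it is measurable and the variational
definition of the perimeter is finite. -/
def HasFinitePerimeter {n : ℕ} (F : Set (EuclideanSpace ℝ (Fin n))) : Prop :=
  MeasurableSet F ∧ BddAbove (perimVals F)

/-- The Newtonian interaction energy `NL(F) = ∫∫ χ_F(x)χ_F(y)|x-y|^{2-n}`. -/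
def NL {n : ℕ} (F : Set (EuclideanSpace ℝ (Fin n))) : ℝ :=
  ∫ x in F, ∫ y in F, ‖x - y‖ ^ (2 - (n : ℝ))

/-- The function `f_E = χ_{B_1} - χ_E`. -/
def fE {n : ℕ} (E : Set (EuclideanSpace ℝ (Fin n))) (x : EuclideanSpace ℝ (Fin n)) : ℝ :=
  (ball (0 : EuclideanSpace ℝ (Fin n)) 1).indicator 1 x - E.indicator 1 x

/-- The Newtonian potential `v(y) = ∫ (χ_{B_1} - χ_E)(x) |x-y|^{2-n} dx`. -/
def newtPot {n : ℕ} (E : Set (EuclideanSpace ℝ (Fin n))) (y : EuclideanSpace ℝ (Fin n)) : ℝ :=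
  ∫ x, fE E x * ‖x - y‖ ^ (2 - (n : ℝ))

/-- The normalization constant `σ_{n,α}` of the Riesz potential. -/
def rieszConst (n : ℕ) (α : ℝ) : ℝ :=
  (Real.pi ^ ((n : ℝ) / 2) * 2 ^ α * Real.Gamma (α / 2) / Real.Gamma (((n : ℝ) - α) / 2))⁻¹

/-- The Riesz potential `I_α f(x) = σ_{n,α} ∫ f(ξ)|x-ξ|^{α-n} dξ`. -/
def rieszPot {n : ℕ} (α : ℝ) (f : EuclideanSpace ℝ (Fin n) → ℝ)
    (x : EuclideanSpace ℝ (Fin n)) : ℝ :=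
  rieszConst n α * ∫ ξ, f ξ * ‖x - ξ‖ ^ (α - (n : ℝ))

/-- The average of `g` over the sphere `∂B_r` with respect to the
`(n-1)`-dimensional Hausdorff measure. -/
def sphAvg {n : ℕ} (g : EuclideanSpace ℝ (Fin n) → ℝ) (r : ℝ) : ℝ :=
  (μH[(n : ℝ) - 1] (sphere (0 : EuclideanSpace ℝ (Fin n)) r)).toReal⁻¹ *
    ∫ y in sphere (0 : EuclideanSpace ℝ (Fin n)) r, g y ∂μH[(n : ℝ) - 1]

/-- The average of `g` over the ball `B_r` with respect to the Lebesgue measure. -/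
def ballAvg {n : ℕ} (g : EuclideanSpace ℝ (Fin n) → ℝ) (r : ℝ) : ℝ :=
  (volume (ball (0 : EuclideanSpace ℝ (Fin n)) r)).toReal⁻¹ *
    ∫ x in ball (0 : EuclideanSpace ℝ (Fin n)) r, g x

end


lemma aux_sphere_half_lt_top {n : ℕ} (hn : 5 ≤ n) (v : EuclideanSpace ℝ (Fin n)) (hv : ‖v‖ = 1) :
    μH[(n : ℝ) - 1] {x ∈ sphere (0 : EuclideanSpace ℝ (Fin n)) 1 | inner ℝ v x ≤ 0} < ⊤ := by
  have hfr : Module.finrank ℝ (ℝ ∙ v)ᗮ = n - 1 := by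
    have : Fact (Module.finrank ℝ (EuclideanSpace ℝ (Fin n)) = (n - 1) + 1) :=
      ⟨by simp; omega⟩
    exact Submodule.finrank_orthogonal_span_singleton (by rintro rfl; simp at hv)
  have hd : ((Module.finrank ℝ (ℝ ∙ v)ᗮ : ℕ) : ℝ) = (n : ℝ) - 1 := by
    rw [hfr]; push_cast [show 1 ≤ n by omega]; ring
  let f : (ℝ ∙ v)ᗮ → EuclideanSpace ℝ (Fin n) := fun w => stereoInvFunAux v (w : EuclideanSpace ℝ (Fin n))
  have hf : ContDiff ℝ 1 f := contDiff_stereoInvFunAux.comp (Submodule.subtypeL (ℝ ∙ v)ᗮ).contDiff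
  have hll : LocallyLipschitz f := hf.locallyLipschitz
  obtain ⟨K, hK⟩ := LocallyLipschitzOn.exists_lipschitzOnWith_of_compact
    (isCompact_closedBall (0 : (ℝ ∙ v)ᗮ) 2) (hll.locallyLipschitzOn (s := closedBall 0 2))
  have hsub : {x ∈ sphere (0 : EuclideanSpace ℝ (Fin n)) 1 | inner ℝ v x ≤ 0} ⊆ f '' closedBall 0 2 := by
    rintro x ⟨hx, hx2⟩
    have hne : x ≠ v := by
      rintro rfl
      rw [real_inner_self_eq_norm_sq, hv] at hx2; norm_num at hx2
    have := stereo_left_inv hv (x := ⟨x, hx⟩) hne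
    refine ⟨stereoToFun v x, ?_, ?_⟩
    · rw [mem_closedBall_zero_iff, stereoToFun_apply, norm_smul, innerSL_apply_apply]
      have h1 : ‖(ℝ ∙ v)ᗮ.orthogonalProjectionOnto x‖ ≤ 1 := by
        have := (ℝ ∙ v)ᗮ.norm_orthogonalProjectionOnto_apply_le x
        rw [mem_sphere_zero_iff_norm] at hx
        linarith
      have h2 : ‖2 / (1 - inner ℝ v x)‖ ≤ 2 := by
        rw [Real.norm_of_nonneg (by apply div_nonneg <;> linarith), div_le_iff₀ (by linarith)]
        linarith
      nlinarith [norm_nonneg ((ℝ ∙ v)ᗮ.orthogonalProjectionOnto x), norm_nonneg (2 / (1 - inner ℝ v x))]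
    · exact congrArg Subtype.val this
  have hd0 : (0 : ℝ) ≤ (n : ℝ) - 1 := by rw [← hd]; positivity
  refine lt_of_le_of_lt (measure_mono hsub) (lt_of_le_of_lt (hK.hausdorffMeasure_image_le hd0) ?_)
  refine ENNReal.mul_lt_top (ENNReal.rpow_lt_top_of_nonneg hd0 ENNReal.coe_ne_top) ?_
  rw [← hd]
  exact (isCompact_closedBall _ _).measure_lt_top

lemma aux_sphere_lt_top {n : ℕ} (hn : 5 ≤ n) :
    μH[(n : ℝ) - 1] (sphere (0 : EuclideanSpace ℝ (Fin n)) 1) < ⊤ := by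
  let v : EuclideanSpace ℝ (Fin n) := EuclideanSpace.single ⟨0, by omega⟩ 1
  have hv : ‖v‖ = 1 := by simp [v]
  refine lt_of_le_of_lt (measure_mono (t := {x ∈ sphere (0 : EuclideanSpace ℝ (Fin n)) 1 | inner ℝ v x ≤ 0}
    ∪ {x ∈ sphere (0 : EuclideanSpace ℝ (Fin n)) 1 | inner ℝ (-v) x ≤ 0}) ?_) ?_
  · intro x hx
    rcases le_total (inner ℝ v x) 0 with h | h
    · exact Or.inl ⟨hx, h⟩
    · exact Or.inr ⟨hx, by rw [inner_neg_left]; linarith⟩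
  · exact measure_union_lt_top (aux_sphere_half_lt_top hn v hv)
      (aux_sphere_half_lt_top hn (-v) (by rwa [norm_neg]))

lemma aux_sphere_pos {n : ℕ} (hn : 5 ≤ n) :
    0 < μH[(n : ℝ) - 1] (sphere (0 : EuclideanSpace ℝ (Fin n)) 1) := by
  let v : EuclideanSpace ℝ (Fin n) := EuclideanSpace.single ⟨0, by omega⟩ 1
  have hv : ‖v‖ = 1 := by simp [v]
  have hfr : Module.finrank ℝ (ℝ ∙ v)ᗮ = n - 1 := by
    have : Fact (Module.finrank ℝ (EuclideanSpace ℝ (Fin n)) = (n - 1) + 1) :=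
      ⟨by simp; omega⟩
    exact Submodule.finrank_orthogonal_span_singleton (by intro h; rw [h] at hv; simp at hv)
  have hd : ((Module.finrank ℝ (ℝ ∙ v)ᗮ : ℕ) : ℝ) = (n : ℝ) - 1 := by
    rw [hfr]; push_cast [show 1 ≤ n by omega]; ring
  have hd0 : (0 : ℝ) ≤ (n : ℝ) - 1 := by rw [← hd]; positivity
  have hL : LipschitzWith 1 (ℝ ∙ v)ᗮ.orthogonalProjectionOnto := by
    have h := (ℝ ∙ v)ᗮ.orthogonalProjectionOnto.lipschitz
    refine h.weaken ?_
    exact (ℝ ∙ v)ᗮ.orthogonalProjectionOnto_norm_le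
  have h1 := hL.hausdorffMeasure_image_le hd0 (sphere 0 1)
  rw [ENNReal.coe_one, ENNReal.one_rpow, one_mul] at h1
  refine lt_of_lt_of_le ?_ h1
  have hsub : ball (0 : (ℝ ∙ v)ᗮ) 1 ⊆ (ℝ ∙ v)ᗮ.orthogonalProjectionOnto '' sphere 0 1 := by
    intro w hw
    rw [mem_ball_zero_iff] at hw
    have hw2 : ‖w‖ ^ 2 ≤ 1 := by nlinarith [norm_nonneg w]
    have hwv : inner ℝ (w : EuclideanSpace ℝ (Fin n)) v = 0 :=
      Submodule.mem_orthogonal_singleton_iff_inner_left.1 w.2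
    refine ⟨w + √(1 - ‖w‖ ^ 2) • v, ?_, ?_⟩
    · rw [mem_sphere_zero_iff_norm, ← sq_eq_sq₀ (norm_nonneg _) zero_le_one, norm_add_sq_real,
        inner_smul_right, hwv, norm_smul, hv, Real.norm_of_nonneg (Real.sqrt_nonneg _)]
      rw [mul_one, Real.sq_sqrt (by linarith), Submodule.coe_norm]; ring
    · rw [map_add, map_smul, Submodule.orthogonalProjectionOnto_mem_subspace_eq_self,
        Submodule.orthogonalProjectionOnto_orthogonal_apply_eq_zero, smul_zero, add_zero]
      exact Submodule.mem_span_singleton_self v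
  refine lt_of_lt_of_le ?_ (measure_mono hsub)
  rw [← hd]
  exact measure_ball_pos _ _ one_pos

/-- Normalized invariant measure on unit sphere -/
structure SphProb {n : ℕ} (ν : Measure (EuclideanSpace ℝ (Fin n))) : Prop where
  prob : IsProbabilityMeasure ν
  inv : ∀ g : EuclideanSpace ℝ (Fin n) ≃ₗᵢ[ℝ] EuclideanSpace ℝ (Fin n), ν.map g = ν
  ae_norm : ∀ᵐ ω ∂ν, ‖ω‖ = 1
  atoms : ∀ x, ν {x} = 0

open scoped Pointwise in
theorem exists_sphProb {n : ℕ} (hn : 5 ≤ n) : ∃ ν : Measure (EuclideanSpace ℝ (Fin n)),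
    SphProb ν ∧ ∀ (g : EuclideanSpace ℝ (Fin n) → ℝ) (r : ℝ), 0 < r →
      sphAvg g r = ∫ ω, g (r • ω) ∂ν := by
  set S := sphere (0 : EuclideanSpace ℝ (Fin n)) 1 with hS
  set c := μH[(n : ℝ) - 1] S with hc
  have hc0 : c ≠ 0 := (aux_sphere_pos hn).ne'
  have hct : c ≠ ⊤ := (aux_sphere_lt_top hn).ne
  have hd0 : (0 : ℝ) < (n : ℝ) - 1 := by
    have : (5 : ℝ) ≤ n := by exact_mod_cast hn
    linarith
  have hSm : MeasurableSet S := isClosed_sphere.measurableSet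
  refine ⟨c⁻¹ • (μH[(n : ℝ) - 1]).restrict S, ⟨⟨?_⟩, ?_, ?_, ?_⟩, ?_⟩
  · simp [← hc, ENNReal.inv_mul_cancel hc0 hct]
  · intro g
    rw [Measure.map_smul]
    congr 1
    have hmp : MeasurePreserving g (μH[(n : ℝ) - 1]) μH[(n : ℝ) - 1] := by
      refine ⟨g.continuous.measurable, ?_⟩
      exact g.toIsometryEquiv.map_hausdorffMeasure _
    have h2 := hmp.restrict_preimage hSm
    have h3 : g ⁻¹' S = S := by
      ext x; simp [hS]
    rw [h3] at h2
    exact h2.map_eq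
  · refine Measure.ae_smul_measure ?_ _
    filter_upwards [ae_restrict_mem hSm] with ω hω
    simpa [hS] using hω
  · intro x
    have := MeasureTheory.Measure.nullSingletonClass_hausdorff (EuclideanSpace ℝ (Fin n)) hd0
    simp
  · intro g r hr
    have hsph : sphere (0 : EuclideanSpace ℝ (Fin n)) r = r • S := by
      rw [hS, smul_sphere' hr.ne']; simp [abs_of_pos hr]
    rw [sphAvg, integral_smul_measure, hsph, MeasureTheory.Measure.hausdorffMeasure_smul₀ hd0.le hr.ne', ← hc]
    have hmap : (μH[(n : ℝ) - 1] : Measure (EuclideanSpace ℝ (Fin n))).restrict (r • S)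
        = (‖r‖₊ ^ ((n : ℝ) - 1)) • ((μH[(n : ℝ) - 1]).restrict S).map (fun x => r • x) := by
      ext A hA
      have hm : Measurable (fun x : EuclideanSpace ℝ (Fin n) => r • x) := measurable_const_smul r
      rw [Measure.restrict_apply hA, Measure.smul_apply, Measure.map_apply hm hA,
        Measure.restrict_apply (hm hA), ← MeasureTheory.Measure.hausdorffMeasure_smul₀ hd0.le hr.ne']
      congr 1
      rw [Set.smul_set_inter₀ hr.ne']
      congr 1
      ext x
      rw [Set.mem_smul_set_iff_inv_smul_mem₀ hr.ne']
      simp [smul_smul, hr.ne']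
    rw [hmap, integral_smul_nnreal_measure]
    have hemb : MeasurableEmbedding (fun x : EuclideanSpace ℝ (Fin n) => r • x) :=
      (MeasurableEquiv.smul₀ r hr.ne').measurableEmbedding
    rw [hemb.integral_map (g := g)]
    have hk : (0 : ℝ) < r ^ ((n : ℝ) - 1) := Real.rpow_pos_of_pos hr _
    simp only [NNReal.smul_def, smul_eq_mul, ENNReal.toReal_inv, ENNReal.smul_def, ENNReal.toReal_mul]
    simp [abs_of_pos hr, mul_inv]
    field_simp


lemma SphProb.restrict_eq {n : ℕ} {ν : Measure (EuclideanSpace ℝ (Fin n))} (hν : SphProb ν) :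
    ν.restrict (sphere 0 1) = ν := by
  refine Measure.restrict_eq_self_of_ae_mem ?_
  filter_upwards [hν.ae_norm] with ω h
  simpa using h

lemma SphProb.integrable {n : ℕ} {ν : Measure (EuclideanSpace ℝ (Fin n))} (hν : SphProb ν)
    {f : EuclideanSpace ℝ (Fin n) → ℝ} (hf : Continuous f) : Integrable f ν := by
  have := hν.prob
  rw [← hν.restrict_eq]
  exact hf.continuousOn.integrableOn_compact (isCompact_sphere 0 1)

lemma SphProb.cont {n : ℕ} {ν : Measure (EuclideanSpace ℝ (Fin n))} (hν : SphProb ν)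
    {F : ℝ → EuclideanSpace ℝ (Fin n) → ℝ} (hF : Continuous (Function.uncurry F)) :
    Continuous (fun r => ∫ ω, F r ω ∂ν) := by
  have := hν.prob
  have h := continuous_parametric_integral_of_continuous (μ := ν) hF (isCompact_sphere 0 1)
  rwa [hν.restrict_eq] at h

lemma SphProb.hasDerivAt {n : ℕ} {ν : Measure (EuclideanSpace ℝ (Fin n))} (hν : SphProb ν)
    {F F' : ℝ → EuclideanSpace ℝ (Fin n) → ℝ} (hF : Continuous (Function.uncurry F))
    (hF' : Continuous (Function.uncurry F')) (hd : ∀ r ω, HasDerivAt (fun r => F r ω) (F' r ω) r)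
    (r₀ : ℝ) : HasDerivAt (fun r => ∫ ω, F r ω ∂ν) (∫ ω, F' r₀ ω ∂ν) r₀ := by
  have := hν.prob
  obtain ⟨M, hM⟩ := ((isCompact_closedBall r₀ 1).prod
    (isCompact_sphere (0 : EuclideanSpace ℝ (Fin n)) 1)).bddAbove_image hF'.norm.continuousOn
  have hc : ∀ r, Continuous (F r) := fun r => hF.comp (by fun_prop : Continuous fun ω => (r, ω))
  have hc' : ∀ r, Continuous (F' r) := fun r => hF'.comp (by fun_prop : Continuous fun ω => (r, ω))
  refine (hasDerivAt_integral_of_dominated_loc_of_deriv_le (closedBall_mem_nhds r₀ one_pos)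
    (F := F) (F' := F') (bound := fun _ => M) (Filter.Eventually.of_forall fun r => (hc r).aestronglyMeasurable)
    (hν.integrable (hc r₀)) (hc' r₀).aestronglyMeasurable ?_ (integrable_const M) ?_).2
  · filter_upwards [hν.ae_norm] with ω h r hr
    exact hM (mem_image_of_mem _ (mk_mem_prod hr (by simpa using h)))
  · exact Filter.Eventually.of_forall fun ω r _ => hd r ω

lemma exists_refl {n : ℕ} (w : EuclideanSpace ℝ (Fin n)) (hw : ‖w‖ = 1) :
    ∃ g : EuclideanSpace ℝ (Fin n) ≃ₗᵢ[ℝ] EuclideanSpace ℝ (Fin n),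
      ∀ x, g x = x - (2 * inner ℝ w x) • w := by
  refine ⟨(ℝ ∙ w)ᗮ.reflection, fun x => ?_⟩
  rw [Submodule.reflection_orthogonal_apply, Submodule.reflection_singleton_apply, hw]
  simp [two_smul, two_mul, add_smul]

lemma SphProb.integral_comp {n : ℕ} {ν : Measure (EuclideanSpace ℝ (Fin n))} (hν : SphProb ν)
    (g : EuclideanSpace ℝ (Fin n) ≃ₗᵢ[ℝ] EuclideanSpace ℝ (Fin n))
    (f : EuclideanSpace ℝ (Fin n) → ℝ) : ∫ ω, f (g ω) ∂ν = ∫ ω, f ω ∂ν := by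
  conv_rhs => rw [← hν.inv g]
  exact (g.toHomeomorph.measurableEmbedding.integral_map f).symm

lemma ibp_pair {n : ℕ} {ν : Measure (EuclideanSpace ℝ (Fin n))} (hν : SphProb ν)
    (e e' : EuclideanSpace ℝ (Fin n)) (he : ‖e‖ = 1) (he' : ‖e'‖ = 1) (hee : inner ℝ e e' = 0)
    (r t s ε : ℝ) (hε : 0 < ε) :
    ∫ ω, (inner ℝ ω e * (‖r • ω - t • e‖ ^ 2 + ε) ^ s
      + 2 * s * r * t * (inner ℝ ω e') ^ 2 * (‖r • ω - t • e‖ ^ 2 + ε) ^ (s - 1)) ∂ν = 0 := by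
  have hee' : inner ℝ e' e = 0 := by rw [real_inner_comm]; exact hee
  let b : ℝ → EuclideanSpace ℝ (Fin n) → ℝ := fun θ ω => ‖r • ω - t • (Real.cos θ • e + Real.sin θ • e')‖ ^ 2 + ε
  let F : ℝ → EuclideanSpace ℝ (Fin n) → ℝ := fun θ ω =>
    (Real.sin θ * inner ℝ ω e - Real.cos θ * inner ℝ ω e') * (b θ ω) ^ s
  let F' : ℝ → EuclideanSpace ℝ (Fin n) → ℝ := fun θ ω =>
    (Real.cos θ * inner ℝ ω e + Real.sin θ * inner ℝ ω e') * (b θ ω) ^ s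
    + (Real.sin θ * inner ℝ ω e - Real.cos θ * inner ℝ ω e') *
      ((-(2 * r * t * (-Real.sin θ * inner ℝ ω e + Real.cos θ * inner ℝ ω e'))) * s * (b θ ω) ^ (s - 1))
  have hb : ∀ θ ω, 0 < b θ ω := fun θ ω => by positivity
  have hbe : ∀ θ ω, b θ ω = r ^ 2 * ‖ω‖ ^ 2 + t ^ 2 + ε
      - 2 * r * t * (Real.cos θ * inner ℝ ω e + Real.sin θ * inner ℝ ω e') := by
    intro θ ω
    have h1 : ‖Real.cos θ • e + Real.sin θ • e'‖ ^ 2 = 1 := by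
      rw [norm_add_sq_real, norm_smul, norm_smul, inner_smul_left, inner_smul_right, hee, he, he']
      simp
    simp only [b]
    rw [norm_sub_sq_real, norm_smul, norm_smul, mul_pow, mul_pow, h1, inner_smul_left, inner_smul_right,
      inner_add_right, inner_smul_right, inner_smul_right]
    simp
    ring
  have hbc : Continuous (Function.uncurry b) := by
    simp only [b, Function.uncurry_def]; fun_prop
  have hbs : ∀ s : ℝ, Continuous (fun x : ℝ × EuclideanSpace ℝ (Fin n) => b x.1 x.2 ^ s) := fun s =>
    hbc.rpow_const fun x => Or.inl (hb x.1 x.2).ne'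
  have hFc : Continuous (Function.uncurry F) := by
    simp only [F, Function.uncurry_def]
    have := hbs s
    fun_prop
  have hFc' : Continuous (Function.uncurry F') := by
    simp only [F', Function.uncurry_def]
    have := hbs s
    have := hbs (s - 1)
    fun_prop
  have hd : ∀ θ ω, HasDerivAt (fun θ => F θ ω) (F' θ ω) θ := by
    intro θ ω
    have h1 : HasDerivAt (fun θ => b θ ω)
        (-(2 * r * t * (-Real.sin θ * inner ℝ ω e + Real.cos θ * inner ℝ ω e'))) θ := by
      have : (fun θ => b θ ω) = fun θ => r ^ 2 * ‖ω‖ ^ 2 + t ^ 2 + ε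
        - 2 * r * t * (Real.cos θ * inner ℝ ω e + Real.sin θ * inner ℝ ω e') := funext fun θ => hbe θ ω
      rw [this]
      have := ((((Real.hasDerivAt_cos θ).mul_const (inner ℝ ω e)).add
        ((Real.hasDerivAt_sin θ).mul_const (inner ℝ ω e'))).const_mul (2 * r * t)).const_sub
          (r ^ 2 * ‖ω‖ ^ 2 + t ^ 2 + ε)
      exact this
    have h2 := h1.rpow_const (p := s) (Or.inl (hb θ ω).ne')
    have h3 := ((Real.hasDerivAt_sin θ).mul_const (inner ℝ ω e)).sub
        ((Real.hasDerivAt_cos θ).mul_const (inner ℝ ω e'))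
    refine (show HasDerivAt (fun θ => F θ ω) _ θ from h3.mul h2).congr_deriv ?_
    simp only [F']
    simp
  have hconst : ∀ θ, ∫ ω, F θ ω ∂ν = -(∫ ω, F 0 ω ∂ν) := by
    intro θ
    let w := Real.sin (θ / 2) • e - Real.cos (θ / 2) • e'
    have hw : ‖w‖ = 1 := by
      rw [← sq_eq_sq₀ (norm_nonneg _) zero_le_one]
      simp only [w]
      rw [norm_sub_sq_real, norm_smul, norm_smul, inner_smul_left, inner_smul_right, hee, he, he']
      simp
    obtain ⟨g, hg⟩ := exists_refl w hw
    have hs : Real.sin θ = 2 * Real.sin (θ / 2) * Real.cos (θ / 2) := by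
      rw [← Real.sin_two_mul]; ring_nf
    have hcc : Real.cos θ = 2 * Real.cos (θ / 2) ^ 2 - 1 := by
      rw [← Real.cos_two_mul]; ring_nf
    have hsc := Real.sin_sq_add_cos_sq (θ / 2)
    have hge : ∀ ω, inner ℝ (g ω) e = Real.cos θ * inner ℝ ω e + Real.sin θ * inner ℝ ω e' := by
      intro ω
      rw [hg, inner_sub_left, inner_smul_left]
      simp only [w, inner_sub_left, inner_smul_left, hee', real_inner_self_eq_norm_sq, he]
      simp only [conj_trivial, real_inner_comm ω]
      rw [hs, hcc]
      linear_combination (-2 * inner ℝ ω e) * hsc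
    have hge' : ∀ ω, inner ℝ (g ω) e' = Real.sin θ * inner ℝ ω e - Real.cos θ * inner ℝ ω e' := by
      intro ω
      rw [hg, inner_sub_left, inner_smul_left]
      simp only [w, inner_sub_left, inner_smul_left, hee, real_inner_self_eq_norm_sq, he']
      simp only [conj_trivial, real_inner_comm ω]
      rw [hs, hcc]
      ring
    have : ∀ ω, F θ ω = - F 0 (g ω) := by
      intro ω
      simp only [F]
      rw [hbe, hbe, hge, hge', g.norm_map]
      simp
      ring
    simp_rw [this]
    rw [integral_neg, hν.integral_comp g (F 0)]
  have h1 := hν.hasDerivAt hFc hFc' hd 0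
  have h2 : (fun θ => ∫ ω, F θ ω ∂ν) = fun _ => -(∫ ω, F 0 ω ∂ν) := funext hconst
  rw [h2] at h1
  have h3 := h1.unique (hasDerivAt_const 0 _)
  rw [← h3]
  refine integral_congr_ae (Filter.Eventually.of_forall fun ω => ?_)
  simp only [F', b]
  simp
  ring

lemma ibp {n : ℕ} (hn : 5 ≤ n) {ν : Measure (EuclideanSpace ℝ (Fin n))} (hν : SphProb ν)
    (ξ : EuclideanSpace ℝ (Fin n)) (r s ε : ℝ) (hε : 0 < ε) :
    ∫ ω, (((n : ℝ) - 1) * inner ℝ ω ξ * (‖r • ω - ξ‖ ^ 2 + ε) ^ s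
      + 2 * s * r * (‖ξ‖ ^ 2 - (inner ℝ ω ξ) ^ 2) * (‖r • ω - ξ‖ ^ 2 + ε) ^ (s - 1)) ∂ν = 0 := by
  by_cases hξ : ξ = 0
  · subst hξ; simp
  set t := ‖ξ‖ with ht
  have ht0 : t ≠ 0 := norm_ne_zero_iff.2 hξ
  set e := t⁻¹ • ξ with hedef
  have he : ‖e‖ = 1 := by rw [hedef, norm_smul, norm_inv, ht, norm_norm, inv_mul_cancel₀ ht0]
  have hξe : ξ = t • e := by rw [hedef, smul_smul, mul_inv_cancel₀ ht0, one_smul]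
  let i0 : Fin n := ⟨0, by omega⟩
  have hn0 : ‖(EuclideanSpace.single i0 1 : EuclideanSpace ℝ (Fin n))‖ = ‖e‖ := by simp [he]
  obtain ⟨b, hb⟩ : ∃ b : OrthonormalBasis (Fin n) ℝ (EuclideanSpace ℝ (Fin n)), b i0 = e := by
    refine ⟨(EuclideanSpace.basisFun (Fin n) ℝ).map
      ((ℝ ∙ ((EuclideanSpace.single i0 1 : EuclideanSpace ℝ (Fin n)) - e))ᗮ.reflection), ?_⟩
    rw [OrthonormalBasis.map_apply, EuclideanSpace.basisFun_apply]
    exact Submodule.reflection_sub hn0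
  have hq : ∀ s : ℝ, Continuous (fun ω : EuclideanSpace ℝ (Fin n) => (‖r • ω - ξ‖ ^ 2 + ε) ^ s) := fun s =>
    Continuous.rpow_const (by fun_prop) fun x => Or.inl (by positivity)
  have hpair : ∀ i ∈ Finset.univ.erase i0, ∫ ω, (inner ℝ ω e * (‖r • ω - ξ‖ ^ 2 + ε) ^ s
      + 2 * s * r * t * (inner ℝ ω (b i)) ^ 2 * (‖r • ω - ξ‖ ^ 2 + ε) ^ (s - 1)) ∂ν = 0 := by
    intro i hi
    have hi' : i0 ≠ i := (Finset.ne_of_mem_erase hi).symm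
    have := ibp_pair hν e (b i) he (b.norm_eq_one i) (by rw [← hb]; exact b.inner_eq_zero hi') r t s ε hε
    rwa [← hξe] at this
  have hsum := Finset.sum_eq_zero hpair
  rw [← integral_finsetSum] at hsum
  · have h2 : ∫ ω, t * (∑ i ∈ Finset.univ.erase i0, (inner ℝ ω e * (‖r • ω - ξ‖ ^ 2 + ε) ^ s
      + 2 * s * r * t * (inner ℝ ω (b i)) ^ 2 * (‖r • ω - ξ‖ ^ 2 + ε) ^ (s - 1))) ∂ν = 0 := by
      rw [integral_const_mul, hsum, mul_zero]
    rw [← h2]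
    refine integral_congr_ae ?_
    filter_upwards [hν.ae_norm] with ω hω
    rw [Finset.sum_add_distrib, Finset.sum_const, Finset.card_erase_of_mem (Finset.mem_univ _),
      ← Finset.sum_mul, ← Finset.mul_sum]
    have h3 : ∑ i ∈ Finset.univ.erase i0, (inner ℝ ω (b i)) ^ 2 = 1 - (inner ℝ ω e) ^ 2 := by
      have := b.sum_sq_inner_left ω
      rw [← Finset.add_sum_erase _ _ (Finset.mem_univ i0), hb, hω] at this
      linarith
    rw [h3]
    have h4 : inner ℝ ω ξ = t * inner ℝ ω e := by
      conv_lhs => rw [hξe]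
      rw [inner_smul_right]
    rw [h4, Finset.card_univ, Fintype.card_fin, nsmul_eq_mul, Nat.cast_sub (by omega)]
    push_cast
    ring
  · intro i _
    have h1 := hq s
    have h2 := hq (s - 1)
    exact hν.integrable (by fun_prop)

/-- Laplacian of the regularized kernel. -/
noncomputable def lapK {n : ℕ} (p ε : ℝ) (x : EuclideanSpace ℝ (Fin n)) : ℝ :=
  2 * p * n * (‖x‖ ^ 2 + ε) ^ (p - 1) + 4 * p * (p - 1) * ‖x‖ ^ 2 * (‖x‖ ^ 2 + ε) ^ (p - 1 - 1)

lemma reg_identity {n : ℕ} (hn : 5 ≤ n) {ν : Measure (EuclideanSpace ℝ (Fin n))} (hν : SphProb ν)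
    (ξ : EuclideanSpace ℝ (Fin n)) (p ε : ℝ) (hε : 0 < ε) (r R : ℝ) (hr : 0 < r) (hR : r ≤ R) :
    (∫ ω, (‖r • ω - ξ‖ ^ 2 + ε) ^ p ∂ν) = (∫ ω, (‖R • ω - ξ‖ ^ 2 + ε) ^ p ∂ν)
      + ∫ s in r..R, (s ^ (n - 1))⁻¹ * ∫ τ in 0..s, τ ^ (n - 1) * ∫ ω, -lapK p ε (τ • ω - ξ) ∂ν := by
  obtain ⟨k, rfl⟩ : ∃ k, n = k + 2 := ⟨n - 2, by omega⟩
  let q : ℝ → EuclideanSpace ℝ (Fin (k + 2)) → ℝ := fun r ω => ‖r • ω - ξ‖ ^ 2 + ε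
  let y : ℝ → EuclideanSpace ℝ (Fin (k + 2)) → ℝ := fun r ω => 2 * (r * ‖ω‖ ^ 2 - inner ℝ ω ξ)
  have hq0 : ∀ r ω, 0 < q r ω := fun r ω => by positivity
  have hqe : ∀ r ω, q r ω = r ^ 2 * ‖ω‖ ^ 2 - 2 * r * inner ℝ ω ξ + ‖ξ‖ ^ 2 + ε := by
    intro r ω
    simp only [q]
    rw [norm_sub_sq_real, norm_smul, mul_pow, inner_smul_left]
    simp
    ring
  have hqd : ∀ r ω, HasDerivAt (fun r => q r ω) (y r ω) r := by
    intro r ω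
    have : (fun r => q r ω) = fun r => r ^ 2 * ‖ω‖ ^ 2 - 2 * r * inner ℝ ω ξ + ‖ξ‖ ^ 2 + ε :=
      funext fun r => hqe r ω
    rw [this]
    have h := (((((hasDerivAt_id r).pow 2).mul_const (‖ω‖ ^ 2)).sub
      (((hasDerivAt_id r).const_mul 2).mul_const (inner ℝ ω ξ))).add_const (‖ξ‖ ^ 2)).add_const ε
    refine (show HasDerivAt (fun r => r ^ 2 * ‖ω‖ ^ 2 - 2 * r * inner ℝ ω ξ + ‖ξ‖ ^ 2 + ε) _ r from h).congr_deriv ?_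
    simp [y]; ring
  have hyd : ∀ r ω, HasDerivAt (fun r => y r ω) (2 * ‖ω‖ ^ 2) r := by
    intro r ω
    have h := (((hasDerivAt_id r).mul_const (‖ω‖ ^ 2)).sub_const (inner ℝ ω ξ)).const_mul 2
    refine (show HasDerivAt (fun r => y r ω) _ r from h).congr_deriv ?_
    simp
  have hqs : ∀ s : ℝ, Continuous (fun x : ℝ × EuclideanSpace ℝ (Fin (k + 2)) => q x.1 x.2 ^ s) := fun s =>
    Continuous.rpow_const (by fun_prop) fun x => Or.inl (hq0 x.1 x.2).ne'
  let H : ℝ → EuclideanSpace ℝ (Fin (k + 2)) → ℝ := fun r ω => q r ω ^ p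
  let H1 : ℝ → EuclideanSpace ℝ (Fin (k + 2)) → ℝ := fun r ω => y r ω * p * q r ω ^ (p - 1)
  let H2 : ℝ → EuclideanSpace ℝ (Fin (k + 2)) → ℝ := fun r ω => 2 * ‖ω‖ ^ 2 * p * q r ω ^ (p - 1)
    + y r ω * p * (y r ω * (p - 1) * q r ω ^ (p - 1 - 1))
  let L : ℝ → EuclideanSpace ℝ (Fin (k + 2)) → ℝ := fun r ω => lapK p ε (r • ω - ξ)
  have hH : Continuous (Function.uncurry H) := hqs p
  have hH1 : Continuous (Function.uncurry H1) := by
    have := hqs (p - 1)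
    simp only [H1, y, Function.uncurry_def]
    fun_prop
  have hH2 : Continuous (Function.uncurry H2) := by
    have := hqs (p - 1)
    have := hqs (p - 1 - 1)
    simp only [H2, y, Function.uncurry_def]
    fun_prop
  have hL : Continuous (Function.uncurry L) := by
    have h1 := hqs (p - 1)
    have h2 := hqs (p - 1 - 1)
    simp only [q] at h1 h2
    simp only [L, lapK, Function.uncurry_def]
    fun_prop
  have hHd : ∀ r ω, HasDerivAt (fun r => H r ω) (H1 r ω) r := fun r ω =>
    (hqd r ω).rpow_const (Or.inl (hq0 r ω).ne')
  have hHd1 : ∀ r ω, HasDerivAt (fun r => H1 r ω) (H2 r ω) r := fun r ω =>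
    ((hyd r ω).mul_const p).mul ((hqd r ω).rpow_const (Or.inl (hq0 r ω).ne'))
  have hm := hν.hasDerivAt hH hH1 hHd
  have hm1 := hν.hasDerivAt hH1 hH2 hHd1
  have hcont : ∀ {G : ℝ → EuclideanSpace ℝ (Fin (k + 2)) → ℝ}, Continuous (Function.uncurry G) → ∀ r, Integrable (G r) ν :=
    fun hG r => hν.integrable (hG.comp (by fun_prop : Continuous fun ω => (r, ω)))
  have hlap : ∀ r, r * ∫ ω, L r ω ∂ν = (k + 1) * ∫ ω, H1 r ω ∂ν + r * ∫ ω, H2 r ω ∂ν := by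
    intro r
    have h := ibp hn hν ξ r (p - 1) ε hε
    have h' : ∫ ω, (r * L r ω - ((k + 1) * H1 r ω + r * H2 r ω)) ∂ν = 0 := by
      have h0 : (2 * p) * ∫ ω, ((((k + 2 : ℕ) : ℝ) - 1) * inner ℝ ω ξ * (‖r • ω - ξ‖ ^ 2 + ε) ^ (p - 1)
        + 2 * (p - 1) * r * (‖ξ‖ ^ 2 - (inner ℝ ω ξ) ^ 2) * (‖r • ω - ξ‖ ^ 2 + ε) ^ (p - 1 - 1)) ∂ν = 0 := by
        rw [h, mul_zero]
      rw [← integral_const_mul] at h0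
      rw [← h0]
      refine integral_congr_ae ?_
      filter_upwards [hν.ae_norm] with ω hω
      have hx : ‖r • ω - ξ‖ ^ 2 = r ^ 2 - 2 * r * inner ℝ ω ξ + ‖ξ‖ ^ 2 := by
        have := hqe r ω
        simp only [q, hω] at this
        linarith
      simp only [L, lapK, H1, H2, y, q, hω]
      set A := (‖r • ω - ξ‖ ^ 2 + ε) ^ (p - 1)
      set B := (‖r • ω - ξ‖ ^ 2 + ε) ^ (p - 1 - 1)
      rw [hx]
      push_cast
      ring
    have hi1 : Integrable (fun ω => (k + 1 : ℝ) * H1 r ω + r * H2 r ω) ν :=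
      ((hcont hH1 r).const_mul _).add ((hcont hH2 r).const_mul r)
    rw [integral_sub ((hcont hL r).const_mul r) hi1, integral_add
      ((hcont hH1 r).const_mul _) ((hcont hH2 r).const_mul r), integral_const_mul, integral_const_mul,
      integral_const_mul] at h'
    linarith
  have hP : ∀ r, HasDerivAt (fun r => r ^ (k + 1) * ∫ ω, H1 r ω ∂ν) (r ^ (k + 1) * ∫ ω, L r ω ∂ν) r := by
    intro r
    have h := (hasDerivAt_pow (k + 1) r).mul (hm1 r)
    refine (show HasDerivAt (fun r => r ^ (k + 1) * ∫ ω, H1 r ω ∂ν) _ r from h).congr_deriv ?_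
    have := hlap r
    push_cast
    rw [pow_succ]
    linear_combination (-(r ^ k)) * this
  have hcL := hν.cont hL
  have hcH1 := hν.cont hH1
  have hPs : ∀ s, ∫ τ in 0..s, τ ^ (k + 1) * ∫ ω, -L τ ω ∂ν = -(s ^ (k + 1) * ∫ ω, H1 s ω ∂ν) := by
    intro s
    have := intervalIntegral.integral_eq_sub_of_hasDerivAt (a := 0) (b := s) (fun x _ => hP x)
      (Continuous.intervalIntegrable (by fun_prop) _ _)
    simp_rw [integral_neg, mul_neg]
    rw [intervalIntegral.integral_neg, this]
    simp
  have hfin := intervalIntegral.integral_eq_sub_of_hasDerivAt (a := r) (b := R) (fun x _ => hm x)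
      (hcH1.intervalIntegrable _ _)
  have hcong : ∫ s in r..R, (s ^ (k + 2 - 1))⁻¹ * ∫ τ in 0..s, τ ^ (k + 2 - 1) * ∫ ω, -lapK p ε (τ • ω - ξ) ∂ν
      = ∫ s in r..R, -∫ ω, H1 s ω ∂ν := by
    refine intervalIntegral.integral_congr fun s hs => ?_
    rw [uIcc_of_le hR] at hs
    have hs0 : s ≠ 0 := (lt_of_lt_of_le hr hs.1).ne'
    have := hPs s
    simp only [L] at this
    simp only [show k + 2 - 1 = k + 1 by omega]
    rw [this]
    field_simp
  rw [hcong, intervalIntegral.integral_neg, hfin]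
  simp only [H, q]
  ring


/-- the Riesz kernel as an extended nonnegative function -/
noncomputable def kap {n : ℕ} (β : ℝ) (x : EuclideanSpace ℝ (Fin n)) : ENNReal :=
  ENNReal.ofReal (‖x‖ ^ (β - (n : ℝ)))

lemma measurable_kap {n : ℕ} (β : ℝ) : Measurable (kap (n := n) β) := by
  unfold kap
  fun_prop

lemma lap_anti (X N p : ℝ) (hX : 0 < X) (hp : p < 0) (h2 : 4 ≤ N + 2 * p) :
    AntitoneOn (fun ε : ℝ => N * (X + ε) ^ (p - 1) + 2 * (p - 1) * X * (X + ε) ^ (p - 1 - 1)) (Ici 0) := by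
  have hd : ∀ ε : ℝ, 0 ≤ ε → HasDerivAt (fun ε : ℝ => N * (X + ε) ^ (p - 1) + 2 * (p - 1) * X * (X + ε) ^ (p - 1 - 1))
      (N * (1 * (p - 1) * (X + ε) ^ (p - 1 - 1)) +
        2 * (p - 1) * X * (1 * (p - 1 - 1) * (X + ε) ^ (p - 1 - 1 - 1))) ε := by
    intro ε hε
    have h0 : HasDerivAt (fun ε : ℝ => X + ε) 1 ε := (hasDerivAt_id ε).const_add X
    have hne : X + ε ≠ 0 := by positivity
    exact ((h0.rpow_const (p := p - 1) (Or.inl hne)).const_mul N).add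
      ((h0.rpow_const (p := p - 1 - 1) (Or.inl hne)).const_mul (2 * (p - 1) * X))
  refine antitoneOn_of_deriv_nonpos (convex_Ici 0)
    (fun ε hε => (hd ε hε).continuousAt.continuousWithinAt) (fun ε hε => ?_) (fun ε hε => ?_)
  · rw [interior_Ici] at hε
    exact (hd ε (le_of_lt hε)).differentiableAt.differentiableWithinAt
  · rw [interior_Ici] at hε
    have hε' : 0 < ε := hε
    rw [(hd ε hε'.le).deriv]
    have hq : 0 < X + ε := by positivity
    have hq3 : 0 < (X + ε) ^ (p - 1 - 1 - 1) := Real.rpow_pos_of_pos hq _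
    have e1 : (X + ε) ^ (p - 1 - 1) = (X + ε) ^ (p - 1 - 1 - 1) * (X + ε) := by
      rw [← Real.rpow_add_one hq.ne']; ring_nf
    rw [e1]
    have : N * (1 * (p - 1) * ((X + ε) ^ (p - 1 - 1 - 1) * (X + ε))) +
        2 * (p - 1) * X * (1 * (p - 1 - 1) * (X + ε) ^ (p - 1 - 1 - 1))
        = (X + ε) ^ (p - 1 - 1 - 1) * ((p - 1) * (N * ε + X * (N + 2 * p - 4))) := by ring
    rw [this]
    have hN : 0 ≤ N := by linarith
    have : 0 ≤ N * ε + X * (N + 2 * p - 4) := by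
      have := mul_nonneg hX.le (by linarith : 0 ≤ N + 2 * p - 4)
      positivity
    exact mul_nonpos_of_nonneg_of_nonpos hq3.le (mul_nonpos_of_nonpos_of_nonneg (by linarith) this)

lemma lapK_nonpos {n : ℕ} {p ε : ℝ} (hε : 0 < ε) (hp : p < 0) (h2 : 4 ≤ (n : ℝ) + 2 * p)
    (x : EuclideanSpace ℝ (Fin n)) : 0 ≤ -lapK p ε x := by
  unfold lapK
  set X := ‖x‖ ^ 2
  have hX : 0 ≤ X := by positivity
  have hq : 0 < X + ε := by positivity
  have hq3 : 0 < (X + ε) ^ (p - 1 - 1) := Real.rpow_pos_of_pos hq _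
  have e1 : (X + ε) ^ (p - 1) = (X + ε) ^ (p - 1 - 1) * (X + ε) := by
    rw [← Real.rpow_add_one hq.ne']; ring_nf
  rw [e1]
  have : -(2 * p * n * ((X + ε) ^ (p - 1 - 1) * (X + ε)) + 4 * p * (p - 1) * X * (X + ε) ^ (p - 1 - 1))
    = (-(2 * p)) * (X + ε) ^ (p - 1 - 1) * ((n + 2 * p - 2) * X + n * ε) := by ring
  rw [this]
  have h3 : 0 ≤ (n + 2 * p - 2) * X := mul_nonneg (by linarith) hX
  have h4 : 0 ≤ -(2 * p) := by linarith
  positivity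

lemma reg_identity_enn {n : ℕ} (hn : 5 ≤ n) {ν : Measure (EuclideanSpace ℝ (Fin n))} (hν : SphProb ν)
    (ξ : EuclideanSpace ℝ (Fin n)) (p ε : ℝ) (hε : 0 < ε) (hp : p < 0) (h2 : 4 ≤ (n : ℝ) + 2 * p)
    (r R : ℝ) (hr : 0 < r) (hR : r ≤ R) :
    (∫⁻ ω, ENNReal.ofReal ((‖r • ω - ξ‖ ^ 2 + ε) ^ p) ∂ν)
      = (∫⁻ ω, ENNReal.ofReal ((‖R • ω - ξ‖ ^ 2 + ε) ^ p) ∂ν)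
      + ∫⁻ s in Ioc r R, ENNReal.ofReal ((s ^ (n - 1))⁻¹) * ∫⁻ τ in Ioc 0 s, ENNReal.ofReal (τ ^ (n - 1)) *
        ∫⁻ ω, ENNReal.ofReal (-lapK p ε (τ • ω - ξ)) ∂ν := by
  have key := reg_identity hn hν ξ p ε hε r R hr hR
  have hqs : ∀ s : ℝ, Continuous (fun x : EuclideanSpace ℝ (Fin n) => (‖x‖ ^ 2 + ε) ^ s) := fun s =>
    Continuous.rpow_const (by fun_prop) fun x => Or.inl (by positivity)
  have hlc : Continuous (fun x : EuclideanSpace ℝ (Fin n) => -lapK p ε x) := by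
    have h1 := hqs (p - 1)
    have h2 := hqs (p - 1 - 1)
    unfold lapK
    fun_prop
  have hL : Continuous (Function.uncurry fun (τ : ℝ) (ω : EuclideanSpace ℝ (Fin n)) => -lapK p ε (τ • ω - ξ)) := by
    simp only [Function.uncurry_def]
    exact hlc.comp (g := fun x : EuclideanSpace ℝ (Fin n) => -lapK p ε x)
      (f := fun x : ℝ × EuclideanSpace ℝ (Fin n) => x.1 • x.2 - ξ) (by fun_prop)
  have hJ := hν.cont hL
  have hJ0 : ∀ τ : ℝ, 0 ≤ ∫ ω, -lapK p ε (τ • ω - ξ) ∂ν := fun τ =>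
    integral_nonneg fun ω => lapK_nonpos hε hp h2 _
  have hi : ∀ r : ℝ, ENNReal.ofReal (∫ ω, (‖r • ω - ξ‖ ^ 2 + ε) ^ p ∂ν) =
      ∫⁻ ω, ENNReal.ofReal ((‖r • ω - ξ‖ ^ 2 + ε) ^ p) ∂ν := by
    intro r
    refine ofReal_integral_eq_lintegral_ofReal (hν.integrable ?_) (Filter.Eventually.of_forall fun ω => ?_)
    · exact Continuous.rpow_const (by fun_prop) fun ω => Or.inl (by positivity)
    · simp only [Pi.zero_apply]; positivity
  have hiL : ∀ τ : ℝ, ∫⁻ ω, ENNReal.ofReal (-lapK p ε (τ • ω - ξ)) ∂ν =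
      ENNReal.ofReal (∫ ω, -lapK p ε (τ • ω - ξ) ∂ν) := by
    intro τ
    refine (ofReal_integral_eq_lintegral_ofReal (hν.integrable ?_)
      (Filter.Eventually.of_forall fun ω => ?_)).symm
    · exact hlc.comp (g := fun x : EuclideanSpace ℝ (Fin n) => -lapK p ε x)
        (f := fun x : EuclideanSpace ℝ (Fin n) => τ • x - ξ) (by fun_prop)
    · exact lapK_nonpos hε hp h2 _
  have hg : Continuous fun τ : ℝ => τ ^ (n - 1) * ∫ ω, -lapK p ε (τ • ω - ξ) ∂ν := by fun_prop
  have hI : ∀ s : ℝ, 0 < s → ∫⁻ τ in Ioc 0 s, ENNReal.ofReal (τ ^ (n - 1)) *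
        ∫⁻ ω, ENNReal.ofReal (-lapK p ε (τ • ω - ξ)) ∂ν = ENNReal.ofReal
        (∫ τ in 0..s, τ ^ (n - 1) * ∫ ω, -lapK p ε (τ • ω - ξ) ∂ν) := by
    intro s hs
    rw [intervalIntegral.integral_of_le hs.le, ofReal_integral_eq_lintegral_ofReal]
    · refine setLIntegral_congr_fun measurableSet_Ioc fun τ hτ => ?_
      rw [hiL, ENNReal.ofReal_mul (pow_nonneg hτ.1.le _)]
    · exact (hg.intervalIntegrable 0 s).1
    · filter_upwards [ae_restrict_mem measurableSet_Ioc] with τ hτ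
      exact mul_nonneg (pow_nonneg hτ.1.le _) (hJ0 τ)
  have hI0 : ∀ s : ℝ, 0 < s → 0 ≤ ∫ τ in 0..s, τ ^ (n - 1) * ∫ ω, -lapK p ε (τ • ω - ξ) ∂ν := by
    intro s hs
    exact intervalIntegral.integral_nonneg hs.le fun τ hτ => mul_nonneg (pow_nonneg hτ.1 _) (hJ0 τ)
  have hO0 : ∀ s ∈ Ioc r R, 0 ≤ (s ^ (n - 1))⁻¹ * ∫ τ in 0..s, τ ^ (n - 1) * ∫ ω, -lapK p ε (τ • ω - ξ) ∂ν := by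
    intro s hs
    have hs0 := hr.trans hs.1
    have := hI0 s hs0
    positivity
  have hO : ∫⁻ s in Ioc r R, ENNReal.ofReal ((s ^ (n - 1))⁻¹) * ∫⁻ τ in Ioc 0 s, ENNReal.ofReal (τ ^ (n - 1)) *
        ∫⁻ ω, ENNReal.ofReal (-lapK p ε (τ • ω - ξ)) ∂ν = ENNReal.ofReal
        (∫ s in r..R, (s ^ (n - 1))⁻¹ * ∫ τ in 0..s, τ ^ (n - 1) * ∫ ω, -lapK p ε (τ • ω - ξ) ∂ν) := by
    rw [intervalIntegral.integral_of_le hR, ofReal_integral_eq_lintegral_ofReal]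
    · refine setLIntegral_congr_fun measurableSet_Ioc fun s hs => ?_
      have hs0 := hr.trans hs.1
      rw [hI s hs0, ENNReal.ofReal_mul (by positivity)]
    · refine (ContinuousOn.integrableOn_Icc ?_).mono_set Ioc_subset_Icc_self
      refine ContinuousOn.mul ?_ (Continuous.continuousOn ?_)
      · refine ContinuousOn.inv₀ (by fun_prop) fun s hs => ?_
        have := lt_of_lt_of_le hr hs.1
        positivity
      · exact intervalIntegral.continuous_primitive (fun a b => hg.intervalIntegrable a b) 0
    · filter_upwards [ae_restrict_mem measurableSet_Ioc] with s hs
      exact hO0 s hs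
  rw [hO, ← hi, ← hi, key, ENNReal.ofReal_add]
  · exact integral_nonneg fun ω => by positivity
  · rw [intervalIntegral.integral_of_le hR]
    exact setIntegral_nonneg measurableSet_Ioc hO0

lemma SphProb.ae_ne {n : ℕ} {ν : Measure (EuclideanSpace ℝ (Fin n))} (hν : SphProb ν)
    (ξ : EuclideanSpace ℝ (Fin n)) {r : ℝ} (hr : 0 < r) : ∀ᵐ ω ∂ν, 0 < ‖r • ω - ξ‖ := by
  have h : ∀ᵐ ω ∂ν, ω ≠ r⁻¹ • ξ := by
    rw [ae_iff]; simp [hν.atoms]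
  filter_upwards [h] with ω hω
  rw [norm_pos_iff, sub_ne_zero]
  rintro rfl
  exact hω (by rw [smul_smul, inv_mul_cancel₀ hr.ne', one_smul])

open Filter Topology in
theorem kernel_identity {n : ℕ} (hn : 5 ≤ n) {ν : Measure (EuclideanSpace ℝ (Fin n))} (hν : SphProb ν)
    (ξ : EuclideanSpace ℝ (Fin n)) (α : ℝ) (hα : α ∈ Set.Icc 2 ((n : ℝ) - 3))
    (r R : ℝ) (hr : 0 < r) (hR : r ≤ R) :
    (∫⁻ ω, kap (α + 2) (r • ω - ξ) ∂ν) = (∫⁻ ω, kap (α + 2) (R • ω - ξ) ∂ν)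
      + ∫⁻ s in Ioc r R, ENNReal.ofReal ((s ^ (n - 1))⁻¹) * ∫⁻ τ in Ioc 0 s, ENNReal.ofReal (τ ^ (n - 1)) *
        (ENNReal.ofReal (α * (n - α - 2)) * ∫⁻ ω, kap α (τ • ω - ξ) ∂ν) := by
  have := hν.prob
  obtain ⟨hα1, hα2⟩ := hα
  set p : ℝ := (α + 2 - n) / 2 with hpdef
  have hp : p < 0 := by rw [hpdef]; linarith
  have h2 : 4 ≤ (n : ℝ) + 2 * p := by rw [hpdef]; linarith
  let e : ℕ → ℝ := fun j => 1 / ((j : ℝ) + 1)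
  have he0 : ∀ j, 0 < e j := fun j => by positivity
  have hea : Antitone e := fun i j hij => one_div_le_one_div_of_le (by positivity) (by simpa using hij)
  have het : Tendsto e atTop (𝓝 0) := tendsto_one_div_add_atTop_nhds_zero_nat
  have hid := fun j => reg_identity_enn hn hν ξ p (e j) (he0 j) hp h2 r R hr hR
  -- convergence of the potentials
  have hX : ∀ x : EuclideanSpace ℝ (Fin n), 0 < ‖x‖ → ∀ s : ℝ, Tendsto (fun j => (‖x‖ ^ 2 + e j) ^ s) atTop
      (𝓝 (‖x‖ ^ (2 * s))) := by
    intro x hx s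
    have : ‖x‖ ^ (2 * s) = (‖x‖ ^ 2 + 0) ^ s := by
      rw [add_zero, Real.rpow_mul hx.le]; norm_num
    rw [this]
    exact (tendsto_const_nhds.add het).rpow_const (Or.inl (by positivity))
  have hlim1 : ∀ r : ℝ, 0 < r → Tendsto (fun j => ∫⁻ ω, ENNReal.ofReal ((‖r • ω - ξ‖ ^ 2 + e j) ^ p) ∂ν) atTop
      (𝓝 (∫⁻ ω, kap (α + 2) (r • ω - ξ) ∂ν)) := by
    intro r hr
    refine lintegral_tendsto_of_tendsto_of_monotone (fun j => by fun_prop) ?_ ?_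
    · filter_upwards [hν.ae_ne ξ hr] with ω hω i j hij
      refine ENNReal.ofReal_le_ofReal (Real.rpow_le_rpow_of_nonpos ?_ ?_ hp.le)
      · have := he0 j; positivity
      · have := hea hij; linarith
    · filter_upwards [hν.ae_ne ξ hr] with ω hω
      have := ENNReal.tendsto_ofReal (hX _ hω p)
      rw [kap]
      convert this using 4
      rw [hpdef]; ring
  have hanti : ∀ x : EuclideanSpace ℝ (Fin n), 0 < ‖x‖ → Monotone fun j => ENNReal.ofReal (-lapK p (e j) x) := by
    intro x hx i j hij
    refine ENNReal.ofReal_le_ofReal ?_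
    have := lap_anti (‖x‖ ^ 2) n p (by positivity) hp h2 (he0 j).le (he0 i).le (hea hij)
    simp only at this
    unfold lapK
    nlinarith [mul_le_mul_of_nonneg_left this (by linarith : 0 ≤ -(2 * p))]
  have hlapt : ∀ x : EuclideanSpace ℝ (Fin n), 0 < ‖x‖ → Tendsto (fun j => ENNReal.ofReal (-lapK p (e j) x)) atTop
      (𝓝 (ENNReal.ofReal (α * (n - α - 2)) * kap α x)) := by
    intro x hx
    have hA : 0 ≤ α * (n - α - 2) := mul_nonneg (by linarith) (by linarith)
    rw [kap, ← ENNReal.ofReal_mul hA]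
    refine ENNReal.tendsto_ofReal ?_
    have h := (((hX x hx (p - 1)).const_mul (2 * p * n)).add
      ((hX x hx (p - 1 - 1)).const_mul (4 * p * (p - 1) * ‖x‖ ^ 2))).neg
    unfold lapK
    convert h using 2
    have e1 : ‖x‖ ^ (α - (n : ℝ)) = ‖x‖ ^ (2 * (p - 1)) := by rw [hpdef]; ring_nf
    have e2 : ‖x‖ ^ (2 * (p - 1)) = ‖x‖ ^ (2 * (p - 1 - 1)) * ‖x‖ ^ 2 := by
      rw [← Real.rpow_natCast ‖x‖ 2, ← Real.rpow_add hx]; push_cast; ring_nf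
    rw [e1, e2, hpdef]
    ring
  have hlm : ∀ ε : ℝ, Measurable (fun x : EuclideanSpace ℝ (Fin n) => ENNReal.ofReal (-lapK p ε x)) := by
    intro ε; unfold lapK; fun_prop
  have hlim2 : ∀ τ : ℝ, 0 < τ → Tendsto (fun j => ∫⁻ ω, ENNReal.ofReal (-lapK p (e j) (τ • ω - ξ)) ∂ν) atTop
      (𝓝 (ENNReal.ofReal (α * (n - α - 2)) * ∫⁻ ω, kap α (τ • ω - ξ) ∂ν)) := by
    intro τ hτ
    have hkm : Measurable fun ω : EuclideanSpace ℝ (Fin n) => kap α (τ • ω - ξ) :=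
      (measurable_kap α).comp (by fun_prop)
    rw [← lintegral_const_mul _ hkm]
    refine lintegral_tendsto_of_tendsto_of_monotone (fun j => ((hlm (e j)).comp (by fun_prop)).aemeasurable) ?_ ?_
    · filter_upwards [hν.ae_ne ξ hτ] with ω hω using hanti _ hω
    · filter_upwards [hν.ae_ne ξ hτ] with ω hω using hlapt _ hω
  have hmono2 : ∀ τ : ℝ, 0 < τ → Monotone (fun j => ∫⁻ ω, ENNReal.ofReal (-lapK p (e j) (τ • ω - ξ)) ∂ν) := by
    intro τ hτ i j hij
    refine lintegral_mono_ae ?_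
    filter_upwards [hν.ae_ne ξ hτ] with ω hω using hanti _ hω hij
  have hmeas2 : ∀ j, Measurable fun τ : ℝ => ∫⁻ ω, ENNReal.ofReal (-lapK p (e j) (τ • ω - ξ)) ∂ν := by
    intro j
    refine Measurable.lintegral_prod_right' (f := fun x : ℝ × EuclideanSpace ℝ (Fin n) =>
      ENNReal.ofReal (-lapK p (e j) (x.1 • x.2 - ξ))) ?_
    exact (hlm (e j)).comp (by fun_prop)
  have hpw : Measurable fun τ : ℝ => ENNReal.ofReal (τ ^ (n - 1)) := by fun_prop
  have hlim3 : ∀ s : ℝ, Tendsto (fun j => ∫⁻ τ in Ioc 0 s, ENNReal.ofReal (τ ^ (n - 1)) *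
        ∫⁻ ω, ENNReal.ofReal (-lapK p (e j) (τ • ω - ξ)) ∂ν) atTop
      (𝓝 (∫⁻ τ in Ioc 0 s, ENNReal.ofReal (τ ^ (n - 1)) *
        (ENNReal.ofReal (α * (n - α - 2)) * ∫⁻ ω, kap α (τ • ω - ξ) ∂ν))) := by
    intro s
    refine lintegral_tendsto_of_tendsto_of_monotone (fun j => (hpw.mul (hmeas2 j)).aemeasurable) ?_ ?_
    · filter_upwards [ae_restrict_mem measurableSet_Ioc] with τ hτ i j hij
      exact mul_le_mul_right (hmono2 τ hτ.1 hij) _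
    · filter_upwards [ae_restrict_mem measurableSet_Ioc] with τ hτ
      exact ENNReal.Tendsto.const_mul (hlim2 τ hτ.1) (Or.inr ENNReal.ofReal_ne_top)
  have hmono3 : ∀ s : ℝ, Monotone (fun j => ∫⁻ τ in Ioc 0 s, ENNReal.ofReal (τ ^ (n - 1)) *
        ∫⁻ ω, ENNReal.ofReal (-lapK p (e j) (τ • ω - ξ)) ∂ν) := by
    intro s i j hij
    refine lintegral_mono_ae ?_
    filter_upwards [ae_restrict_mem measurableSet_Ioc] with τ hτ
    exact mul_le_mul_right (hmono2 τ hτ.1 hij) _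
  have hmeas3 : ∀ j, Measurable fun s : ℝ => ∫⁻ τ in Ioc 0 s, ENNReal.ofReal (τ ^ (n - 1)) *
        ∫⁻ ω, ENNReal.ofReal (-lapK p (e j) (τ • ω - ξ)) ∂ν := by
    intro j
    refine Monotone.measurable fun a b hab => lintegral_mono_set (Ioc_subset_Ioc_right hab)
  have hlim4 : Tendsto (fun j => ∫⁻ s in Ioc r R, ENNReal.ofReal ((s ^ (n - 1))⁻¹) *
        ∫⁻ τ in Ioc 0 s, ENNReal.ofReal (τ ^ (n - 1)) *
        ∫⁻ ω, ENNReal.ofReal (-lapK p (e j) (τ • ω - ξ)) ∂ν) atTop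
      (𝓝 (∫⁻ s in Ioc r R, ENNReal.ofReal ((s ^ (n - 1))⁻¹) * ∫⁻ τ in Ioc 0 s, ENNReal.ofReal (τ ^ (n - 1)) *
        (ENNReal.ofReal (α * (n - α - 2)) * ∫⁻ ω, kap α (τ • ω - ξ) ∂ν))) := by
    refine lintegral_tendsto_of_tendsto_of_monotone (fun j => ?_) ?_ ?_
    · exact (Measurable.mul (by fun_prop) (hmeas3 j)).aemeasurable
    · exact Eventually.of_forall fun s i j hij => mul_le_mul_right (hmono3 s hij) _
    · exact Eventually.of_forall fun s =>
        ENNReal.Tendsto.const_mul (hlim3 s) (Or.inr ENNReal.ofReal_ne_top)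
  refine tendsto_nhds_unique (hlim1 r hr) ?_
  have := (hlim1 R (hr.trans_le hR)).add hlim4
  refine this.congr fun j => (hid j).symm


/-- potential of a set -/
noncomputable def Vp {n : ℕ} (β : ℝ) (F : Set (EuclideanSpace ℝ (Fin n))) (x : EuclideanSpace ℝ (Fin n)) : ENNReal :=
  ∫⁻ ξ in F, kap β (x - ξ)

lemma kap_ball_ne_top {n : ℕ} (hn : 5 ≤ n) {β : ℝ} (hβ : 0 < β) (δ : ℝ) (hδ : 0 < δ) :
    ∫⁻ y in ball (0 : EuclideanSpace ℝ (Fin n)) δ, kap β y ≠ ⊤ := by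
  have : Nonempty (Fin n) := ⟨⟨0, by omega⟩⟩
  have h : IntegrableOn (fun y : EuclideanSpace ℝ (Fin n) => ‖y‖ ^ (β - (n : ℝ))) (ball 0 δ) := by
    have := (integrableOn_fun_norm_addHaar (E := EuclideanSpace ℝ (Fin n)) volume
      (f := fun y : ℝ => y ^ (β - (n : ℝ))) (r := δ))
    rw [this]
    have h2 := (intervalIntegral.integrableOn_Ioo_rpow_iff (s := β - 1) hδ).2 (by linarith)
    refine h2.congr_fun (fun y hy => ?_) measurableSet_Ioo
    simp only [finrank_euclideanSpace, Fintype.card_fin, smul_eq_mul]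
    rw [← Real.rpow_natCast, ← Real.rpow_add hy.1, Nat.cast_sub (by omega)]
    congr 1
    push_cast
    ring
  exact (lintegral_ofReal_ne_top_iff_integrable h.aestronglyMeasurable
    (Filter.Eventually.of_forall fun y => by simp only [Pi.zero_apply]; positivity)).2 h

lemma kap_le {n : ℕ} {β δ : ℝ} (hδ : 0 < δ) (hβ : β < n) {x : EuclideanSpace ℝ (Fin n)} (hx : δ ≤ ‖x‖) :
    kap β x ≤ ENNReal.ofReal (δ ^ (β - (n : ℝ))) :=
  ENNReal.ofReal_le_ofReal (Real.rpow_le_rpow_of_nonpos hδ hx (by linarith))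

lemma Vp_le {n : ℕ} {β δ : ℝ} (hδ : 0 < δ) (hβ : β < n) {F : Set (EuclideanSpace ℝ (Fin n))}
    (hF : MeasurableSet F) (x : EuclideanSpace ℝ (Fin n)) :
    Vp β F x ≤ (∫⁻ y in ball (0 : EuclideanSpace ℝ (Fin n)) δ, kap β y)
      + ENNReal.ofReal (δ ^ (β - (n : ℝ))) * volume F := by
  unfold Vp
  rw [← lintegral_inter_add_sdiff _ F (measurableSet_ball (x := x) (ε := δ))]
  refine add_le_add ?_ ?_
  · refine (lintegral_mono_set inter_subset_right).trans ?_
    rw [← lintegral_indicator measurableSet_ball, ← lintegral_indicator measurableSet_ball,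
      ← lintegral_sub_left_eq_self _ x]
    refine lintegral_mono fun ξ => ?_
    simp [indicator, mem_ball, dist_eq_norm]
  · calc ∫⁻ ξ in F \ ball x δ, kap β (x - ξ) ≤ ∫⁻ ξ in F \ ball x δ, ENNReal.ofReal (δ ^ (β - (n : ℝ))) := by
          refine setLIntegral_mono measurable_const fun ξ hξ => kap_le hδ hβ ?_
          have := hξ.2
          rw [mem_ball, not_lt, dist_eq_norm, norm_sub_rev] at this
          exact this
      _ = ENNReal.ofReal (δ ^ (β - (n : ℝ))) * volume (F \ ball x δ) := by simp
      _ ≤ _ := by gcongr; exact sdiff_subset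

lemma Vp_decay {n : ℕ} {β δ R : ℝ} (hδ : 0 < δ) (hR : 0 < R) (hβ : β < n) {F : Set (EuclideanSpace ℝ (Fin n))}
    (hF : MeasurableSet F) (x : EuclideanSpace ℝ (Fin n)) (hx : ‖x‖ = R) :
    Vp β F x ≤ ENNReal.ofReal ((R / 2) ^ (β - (n : ℝ))) * volume F +
      ((∫⁻ y in ball (0 : EuclideanSpace ℝ (Fin n)) δ, kap β y)
      + ENNReal.ofReal (δ ^ (β - (n : ℝ))) * volume (F \ ball 0 (R / 2))) := by
  have h0 : Vp β F x = Vp β (F ∩ ball 0 (R / 2)) x + Vp β (F \ ball 0 (R / 2)) x := by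
    unfold Vp
    rw [← lintegral_inter_add_sdiff _ F (measurableSet_ball (x := 0) (ε := R / 2))]
  rw [h0]
  refine add_le_add ?_ (Vp_le hδ hβ (hF.diff measurableSet_ball) x)
  unfold Vp
  calc _ ≤ ∫⁻ ξ in F ∩ ball 0 (R / 2), ENNReal.ofReal ((R / 2) ^ (β - (n : ℝ))) := by
        refine setLIntegral_mono measurable_const fun ξ hξ => kap_le (by positivity) hβ ?_
        have h1 := hξ.2
        rw [mem_ball, dist_zero_right] at h1
        have := norm_sub_norm_le x ξ
        linarith
    _ = ENNReal.ofReal ((R / 2) ^ (β - (n : ℝ))) * volume (F ∩ ball 0 (R / 2)) := by simp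
    _ ≤ _ := by gcongr; exact inter_subset_left

lemma measurable_Vp {n : ℕ} (β : ℝ) (F : Set (EuclideanSpace ℝ (Fin n))) : Measurable (Vp β F) := by
  unfold Vp
  refine Measurable.lintegral_prod_right' (f := fun x : EuclideanSpace ℝ (Fin n) × EuclideanSpace ℝ (Fin n) =>
    kap β (x.1 - x.2)) ?_
  exact (measurable_kap β).comp (by fun_prop)

/-- spherical mean of the potential -/
noncomputable def Tp {n : ℕ} (ν : Measure (EuclideanSpace ℝ (Fin n))) (β : ℝ)
    (F : Set (EuclideanSpace ℝ (Fin n))) (r : ℝ) : ENNReal := ∫⁻ ω, Vp β F (r • ω) ∂ν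

/-- uniform bound of the potential -/
noncomputable def Mb {n : ℕ} (β : ℝ) (F : Set (EuclideanSpace ℝ (Fin n))) : ENNReal :=
  (∫⁻ y in ball (0 : EuclideanSpace ℝ (Fin n)) 1, kap β y) + ENNReal.ofReal (1 ^ (β - (n : ℝ))) * volume F

lemma Mb_ne_top {n : ℕ} (hn : 5 ≤ n) {β : ℝ} (hβ0 : 0 < β) {F : Set (EuclideanSpace ℝ (Fin n))}
    (hFv : volume F ≠ ⊤) : Mb β F ≠ ⊤ :=
  ENNReal.add_ne_top.2 ⟨kap_ball_ne_top hn hβ0 1 one_pos, ENNReal.mul_ne_top ENNReal.ofReal_ne_top hFv⟩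

lemma Vp_le_Mb {n : ℕ} {β : ℝ} (hβ : β < n) {F : Set (EuclideanSpace ℝ (Fin n))}
    (hF : MeasurableSet F) (x : EuclideanSpace ℝ (Fin n)) : Vp β F x ≤ Mb β F :=
  Vp_le one_pos hβ hF x

lemma Tp_le_Mb {n : ℕ} {ν : Measure (EuclideanSpace ℝ (Fin n))} (hν : SphProb ν) {β : ℝ} (hβ : β < n)
    {F : Set (EuclideanSpace ℝ (Fin n))} (hF : MeasurableSet F) (r : ℝ) : Tp ν β F r ≤ Mb β F := by
  have := hν.prob
  calc Tp ν β F r ≤ ∫⁻ ω, Mb β F ∂ν := lintegral_mono fun ω => Vp_le_Mb hβ hF _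
    _ = Mb β F := by simp

lemma measurable_Tp {n : ℕ} {ν : Measure (EuclideanSpace ℝ (Fin n))} (hν : SphProb ν) (β : ℝ)
    (F : Set (EuclideanSpace ℝ (Fin n))) : Measurable (Tp ν β F) := by
  have := hν.prob
  unfold Tp
  refine Measurable.lintegral_prod_right' (f := fun x : ℝ × EuclideanSpace ℝ (Fin n) =>
    Vp β F (x.1 • x.2)) ?_
  exact (measurable_Vp β F).comp (by fun_prop)

open Filter Topology in
lemma Tp_tendsto {n : ℕ} (hn : 5 ≤ n) {ν : Measure (EuclideanSpace ℝ (Fin n))} (hν : SphProb ν) {β : ℝ}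
    (hβ0 : 0 < β) (hβ : β < n)
    {F : Set (EuclideanSpace ℝ (Fin n))} (hF : MeasurableSet F) (hFv : volume F ≠ ⊤) :
    Tendsto (Tp ν β F) atTop (𝓝 0) := by
  have := hν.prob
  have : Nonempty (Fin n) := ⟨⟨0, by omega⟩⟩
  rw [ENNReal.tendsto_nhds_zero]
  intro ε hε
  -- choice of the small radius
  obtain ⟨δ, hδ, hδε⟩ : ∃ δ : ℝ, 0 < δ ∧ ∫⁻ y in ball (0 : EuclideanSpace ℝ (Fin n)) δ, kap β y < ε / 2 := by
    obtain ⟨c, hc, hcs⟩ := exists_pos_setLIntegral_lt_of_measure_lt (kap_ball_ne_top hn hβ0 1 one_pos)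
      (ε := ε / 2) (by simpa using hε.ne')
    have h2 : Tendsto (fun δ : ℝ => volume (ball (0 : EuclideanSpace ℝ (Fin n)) δ)) (𝓝[>] 0) (𝓝 0) := by
      have h3 : Tendsto (fun δ : ℝ => ENNReal.ofReal (δ ^ n) * volume (ball (0 : EuclideanSpace ℝ (Fin n)) 1))
          (𝓝[>] 0) (𝓝 0) := by
        have h4 : Tendsto (fun δ : ℝ => ENNReal.ofReal (δ ^ n)) (𝓝[>] 0) (𝓝 0) := by
          have : Continuous fun δ : ℝ => ENNReal.ofReal (δ ^ n) :=
            ENNReal.continuous_ofReal.comp (continuous_pow n)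
          have h5 := (this.tendsto 0).mono_left (nhdsWithin_le_nhds (s := Ioi 0))
          simpa [show n ≠ 0 by omega] using h5
        simpa using ENNReal.Tendsto.mul_const h4 (b := volume (ball (0 : EuclideanSpace ℝ (Fin n)) 1))
          (Or.inr measure_ball_lt_top.ne)
      refine h3.congr' ?_
      filter_upwards [self_mem_nhdsWithin] with δ hδ
      rw [Measure.addHaar_ball _ _ (le_of_lt hδ)]
      simp
    have h3 := (h2.eventually (gt_mem_nhds hc)).and (Ioo_mem_nhdsGT (zero_lt_one' ℝ))
    obtain ⟨δ, hδ1, hδ2⟩ := h3.exists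
    refine ⟨δ, hδ2.1, ?_⟩
    have := hcs (ball 0 δ) (lt_of_le_of_lt (Measure.restrict_apply_le _ _) hδ1)
    rwa [Measure.restrict_restrict measurableSet_ball,
      inter_eq_left.2 (ball_subset_ball hδ2.2.le)] at this
  have hR2 : Tendsto (fun R : ℝ => R / 2) atTop atTop := tendsto_id.atTop_div_const two_pos
  have l1 : Tendsto (fun R : ℝ => ENNReal.ofReal ((R / 2) ^ (β - (n : ℝ))) * volume F) atTop (𝓝 0) := by
    have h1 : Tendsto (fun R : ℝ => (R / 2) ^ (β - (n : ℝ))) atTop (𝓝 0) := by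
      have := (tendsto_rpow_neg_atTop (y := n - β) (by linarith)).comp hR2
      simpa [Function.comp_def] using this
    have h2 := ENNReal.Tendsto.mul_const (ENNReal.tendsto_ofReal h1) (b := volume F) (Or.inr hFv)
    simpa using h2
  have l2 : Tendsto (fun R : ℝ => ENNReal.ofReal (δ ^ (β - (n : ℝ))) * volume (F \ ball 0 (R / 2))) atTop (𝓝 0) := by
    have h1 : Tendsto (fun R : ℝ => volume (F \ ball 0 (R / 2))) atTop (𝓝 0) := by
      have h := tendsto_measure_iInter_atTop (μ := volume) (s := fun R : ℝ => F \ ball 0 (R / 2))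
        (fun R => (hF.diff measurableSet_ball).nullMeasurableSet)
        (fun a b hab => sdiff_subset_sdiff_right (ball_subset_ball (by linarith)))
        ⟨0, by simpa using hFv⟩
      have h0 : ⋂ R : ℝ, F \ ball 0 (R / 2) = ∅ := by
        ext x
        simp only [mem_iInter, mem_empty_iff_false, iff_false, not_forall]
        refine ⟨2 * (‖x‖ + 1), fun hx => hx.2 ?_⟩
        rw [mem_ball, dist_zero_right]; linarith
      rw [h0, measure_empty] at h
      exact h
    simpa using ENNReal.Tendsto.const_mul h1 (a := ENNReal.ofReal (δ ^ (β - (n : ℝ)))) (Or.inr ENNReal.ofReal_ne_top)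
  have l3 := l1.add l2
  rw [add_zero] at l3
  have l4 := (ENNReal.tendsto_nhds_zero.1 l3) (ε / 2) (ENNReal.half_pos hε.ne')
  filter_upwards [l4, eventually_gt_atTop 0] with R hR hR0
  calc Tp ν β F R ≤ ∫⁻ ω, (ENNReal.ofReal ((R / 2) ^ (β - (n : ℝ))) * volume F +
      ((∫⁻ y in ball (0 : EuclideanSpace ℝ (Fin n)) δ, kap β y)
      + ENNReal.ofReal (δ ^ (β - (n : ℝ))) * volume (F \ ball 0 (R / 2)))) ∂ν := by
        refine lintegral_mono_ae ?_
        filter_upwards [hν.ae_norm] with ω hω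
        exact Vp_decay hδ hR0 hβ hF _ (by rw [norm_smul, hω, mul_one, Real.norm_of_nonneg hR0.le])
    _ = ENNReal.ofReal ((R / 2) ^ (β - (n : ℝ))) * volume F +
      ((∫⁻ y in ball (0 : EuclideanSpace ℝ (Fin n)) δ, kap β y)
      + ENNReal.ofReal (δ ^ (β - (n : ℝ))) * volume (F \ ball 0 (R / 2))) := by simp
    _ = (∫⁻ y in ball (0 : EuclideanSpace ℝ (Fin n)) δ, kap β y) + (ENNReal.ofReal ((R / 2) ^ (β - (n : ℝ))) * volume F +
      ENNReal.ofReal (δ ^ (β - (n : ℝ))) * volume (F \ ball 0 (R / 2))) := by ring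
    _ ≤ ε / 2 + ε / 2 := add_le_add hδε.le hR
    _ = ε := ENNReal.add_halves ε


lemma bdd_ii {g : ℝ → ℝ} (hm : Measurable g) {M : ℝ} (hb : ∀ τ, |g τ| ≤ M) (k : ℕ) (a b : ℝ) :
    IntervalIntegrable (fun τ => τ ^ k * g τ) volume a b := by
  have h1 : IntervalIntegrable (fun _ : ℝ => M) volume a b := intervalIntegrable_const
  have h2 : IntervalIntegrable g volume a b :=
    h1.mono_fun hm.aestronglyMeasurable (Filter.Eventually.of_forall fun τ => by
      have := hb τ
      change |g τ| ≤ |M|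
      exact this.trans (le_abs_self M))
  exact h2.continuousOn_mul (continuous_pow k).continuousOn

lemma outer_ii {g : ℝ → ℝ} (hm : Measurable g) {M : ℝ} (hb : ∀ τ, |g τ| ≤ M) (k : ℕ) (a b : ℝ)
    (ha : 0 < a) (hab : a ≤ b) :
    IntervalIntegrable (fun s => (s ^ k)⁻¹ * ∫ τ in 0..s, τ ^ k * g τ) volume a b := by
  refine ContinuousOn.intervalIntegrable ?_
  rw [uIcc_of_le hab]
  refine ContinuousOn.mul ?_ (Continuous.continuousOn ?_)
  · refine ContinuousOn.inv₀ (by fun_prop) fun s hs => ?_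
    have := lt_of_lt_of_le ha hs.1
    positivity
  · exact intervalIntegral.continuous_primitive (fun a b => bdd_ii hm hb k a b) 0

open Filter Topology in
lemma final_real {n : ℕ} (hn : 5 ≤ n) {φ ψ : ℝ → ℝ} {M : ℝ} (hm : Measurable φ) (hb : ∀ τ, |φ τ| ≤ M)
    (ha : AntitoneOn φ (Ioi 0)) (hφ : Tendsto φ atTop (𝓝 0)) (hψ : Tendsto ψ atTop (𝓝 0))
    (hid : ∀ r R : ℝ, 0 < r → r ≤ R →
      ψ r = ψ R + ∫ s in r..R, (s ^ (n - 1))⁻¹ * ∫ τ in 0..s, τ ^ (n - 1) * φ τ)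
    (r : ℝ) (hr : r ∈ Ioo (0 : ℝ) 1) :
    ψ r ≥ (n * ∫ τ in 0..1, τ ^ (n - 1) * φ τ) * (1 - r ^ 2) / (2 * (n : ℝ)) := by
  have hφ0 : ∀ τ, 0 < τ → 0 ≤ φ τ := by
    intro τ hτ
    refine le_of_tendsto hφ ?_
    filter_upwards [eventually_ge_atTop τ] with t ht
    exact ha hτ (lt_of_lt_of_le hτ ht) ht
  have hψ1 : 0 ≤ ψ 1 := by
    refine le_of_tendsto hψ ?_
    filter_upwards [eventually_ge_atTop 1] with R hR
    rw [hid 1 R one_pos hR]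
    have : 0 ≤ ∫ s in 1..R, (s ^ (n - 1))⁻¹ * ∫ τ in 0..s, τ ^ (n - 1) * φ τ := by
      refine intervalIntegral.integral_nonneg hR fun s hs => ?_
      have hs0 : 0 < s := lt_of_lt_of_le one_pos hs.1
      refine mul_nonneg (by positivity) ?_
      rw [intervalIntegral.integral_of_le hs0.le]
      exact setIntegral_nonneg measurableSet_Ioc fun τ hτ => mul_nonneg (pow_nonneg hτ.1.le _) (hφ0 τ hτ.1)
    linarith
  set J := ∫ τ in 0..1, τ ^ (n - 1) * φ τ with hJ
  have hs : ∀ s ∈ Icc r 1, s * J ≤ (s ^ (n - 1))⁻¹ * ∫ τ in 0..s, τ ^ (n - 1) * φ τ := by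
    intro s hs
    have hs0 : 0 < s := hr.1.trans_le hs.1
    have h1 := intervalIntegral.mul_integral_comp_mul_left (a := 0) (b := 1) (f := fun τ => τ ^ (n - 1) * φ τ) (c := s)
    rw [mul_zero, mul_one] at h1
    rw [← h1]
    have h2 : ∫ x in 0..1, (s * x) ^ (n - 1) * φ (s * x) = s ^ (n - 1) * ∫ x in 0..1, x ^ (n - 1) * φ (s * x) := by
      rw [← intervalIntegral.integral_const_mul]
      congr 1; ext x; ring
    rw [h2]
    have h3 : J ≤ ∫ x in 0..1, x ^ (n - 1) * φ (s * x) := by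
      refine intervalIntegral.integral_mono_on zero_le_one (bdd_ii hm hb _ _ _)
        (bdd_ii (g := fun x => φ (s * x)) (hm.comp (measurable_const_mul s)) (fun τ => hb _) _ _ _) fun x hx => ?_
      rcases hx.1.eq_or_lt with h | h
      · rw [← h, zero_pow (by omega)]; simp
      · exact mul_le_mul_of_nonneg_left (ha (mul_pos hs0 h) h (by nlinarith [hs.2])) (pow_nonneg hx.1 _)
    calc s * J ≤ s * ∫ x in 0..1, x ^ (n - 1) * φ (s * x) := mul_le_mul_of_nonneg_left h3 hs0.le
      _ = _ := by field_simp
  have hI : ∫ s in r..1, s * J ≤ ∫ s in r..1, (s ^ (n - 1))⁻¹ * ∫ τ in 0..s, τ ^ (n - 1) * φ τ :=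
    intervalIntegral.integral_mono_on hr.2.le (Continuous.intervalIntegrable (by fun_prop) _ _)
      (outer_ii hm hb _ _ _ hr.1 hr.2.le) hs
  rw [intervalIntegral.integral_mul_const, integral_id] at hI
  have hn0 : (n : ℝ) ≠ 0 := by positivity
  have e : (n * J) * (1 - r ^ 2) / (2 * (n : ℝ)) = (1 ^ 2 - r ^ 2) / 2 * J := by
    field_simp
  rw [e, hid r 1 hr.1 hr.2.le]
  linarith


lemma measurable_pair {n : ℕ} (β : ℝ) : Measurable fun x : (ℝ × EuclideanSpace ℝ (Fin n)) × EuclideanSpace ℝ (Fin n) =>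
    kap β (x.1.1 • x.2 - x.1.2) := (measurable_kap β).comp (by fun_prop)

lemma Tp_swap {n : ℕ} {ν : Measure (EuclideanSpace ℝ (Fin n))} (hν : SphProb ν) (β : ℝ)
    (F : Set (EuclideanSpace ℝ (Fin n))) (r : ℝ) :
    Tp ν β F r = ∫⁻ ξ in F, ∫⁻ ω, kap β (r • ω - ξ) ∂ν := by
  have := hν.prob
  unfold Tp Vp
  refine lintegral_lintegral_swap (Measurable.aemeasurable ?_)
  exact (measurable_kap β).comp (by fun_prop)

lemma swapS {n : ℕ} (F : Set (EuclideanSpace ℝ (Fin n))) (c : ℝ → ENNReal) (hc : Measurable c)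
    (h : ℝ → EuclideanSpace ℝ (Fin n) → ENNReal) (hh : Measurable (Function.uncurry h)) (r R : ℝ) :
    ∫⁻ ξ in F, ∫⁻ s in Ioc r R, c s * ∫⁻ τ in Ioc 0 s, h τ ξ
      = ∫⁻ s in Ioc r R, c s * ∫⁻ τ in Ioc 0 s, ∫⁻ ξ in F, h τ ξ := by
  have hG : ∀ s ξ, ∫⁻ τ in Ioc 0 s, h τ ξ = ∫⁻ τ in Ioi 0, if τ ≤ s then h τ ξ else 0 := by
    intro s ξ
    rw [← lintegral_indicator measurableSet_Ioc, ← lintegral_indicator measurableSet_Ioi]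
    refine lintegral_congr fun τ => ?_
    by_cases h1 : 0 < τ <;> by_cases h2 : τ ≤ s <;> simp [indicator, h1, h2]
  have hGm : Measurable fun x : EuclideanSpace ℝ (Fin n) × ℝ => ∫⁻ τ in Ioc 0 x.2, h τ x.1 := by
    simp only [hG]
    refine Measurable.lintegral_prod_right' (f := fun y : (EuclideanSpace ℝ (Fin n) × ℝ) × ℝ =>
      if y.2 ≤ y.1.2 then h y.2 y.1.1 else 0) ?_
    refine Measurable.ite (measurableSet_le (by fun_prop) (by fun_prop)) ?_ measurable_const
    exact hh.comp (g := Function.uncurry h) (f := fun y : (EuclideanSpace ℝ (Fin n) × ℝ) × ℝ => (y.2, y.1.1))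
      (by fun_prop)
  rw [lintegral_lintegral_swap]
  · refine lintegral_congr fun s => ?_
    rw [lintegral_const_mul]
    · congr 1
      refine lintegral_lintegral_swap (Measurable.aemeasurable ?_)
      exact hh.comp (g := Function.uncurry h) measurable_swap
    · exact hGm.comp (by fun_prop : Measurable fun ξ : EuclideanSpace ℝ (Fin n) => (ξ, s))
  · exact (Measurable.mul (hc.comp measurable_snd) hGm).aemeasurable

lemma Tp_identity {n : ℕ} (hn : 5 ≤ n) {ν : Measure (EuclideanSpace ℝ (Fin n))} (hν : SphProb ν)
    (F : Set (EuclideanSpace ℝ (Fin n))) (α : ℝ) (hα : α ∈ Set.Icc 2 ((n : ℝ) - 3))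
    (r R : ℝ) (hr : 0 < r) (hR : r ≤ R) :
    Tp ν (α + 2) F r = Tp ν (α + 2) F R
      + ∫⁻ s in Ioc r R, ENNReal.ofReal ((s ^ (n - 1))⁻¹) * ∫⁻ τ in Ioc 0 s, ENNReal.ofReal (τ ^ (n - 1)) *
        (ENNReal.ofReal (α * (n - α - 2)) * Tp ν α F τ) := by
  have := hν.prob
  have hm : ∀ β : ℝ, Measurable fun x : ℝ × EuclideanSpace ℝ (Fin n) => ∫⁻ ω, kap β (x.1 • ω - x.2) ∂ν :=
    fun β => Measurable.lintegral_prod_right'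
      (f := fun x : (ℝ × EuclideanSpace ℝ (Fin n)) × EuclideanSpace ℝ (Fin n) => kap β (x.1.1 • x.2 - x.1.2))
      (measurable_pair β)
  have hm1 : ∀ (β r : ℝ), Measurable fun x : EuclideanSpace ℝ (Fin n) => ∫⁻ ω, kap β (r • ω - x) ∂ν :=
    fun β r => (hm β).comp (g := fun x : ℝ × EuclideanSpace ℝ (Fin n) => ∫⁻ ω, kap β (x.1 • ω - x.2) ∂ν)
      (f := fun x : EuclideanSpace ℝ (Fin n) => (r, x)) (by fun_prop)
  rw [Tp_swap hν, Tp_swap hν]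
  simp only [Tp_swap hν α]
  rw [lintegral_congr fun ξ => kernel_identity hn hν ξ α hα r R hr hR]
  rw [lintegral_add_left (hm1 _ _)]
  congr 1
  have hh : Measurable (Function.uncurry fun (τ : ℝ) (ξ : EuclideanSpace ℝ (Fin n)) => ENNReal.ofReal (τ ^ (n - 1)) *
        (ENNReal.ofReal (α * (n - α - 2)) * ∫⁻ ω, kap α (τ • ω - ξ) ∂ν)) := by
    have h1 : Measurable fun x : ℝ × EuclideanSpace ℝ (Fin n) => ENNReal.ofReal (x.1 ^ (n - 1)) := by fun_prop
    exact h1.mul ((hm α).const_mul _)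
  have hc : Measurable fun s : ℝ => ENNReal.ofReal ((s ^ (n - 1))⁻¹) := by fun_prop
  have key := swapS F _ hc _ hh r R
  refine key.trans ?_
  refine lintegral_congr fun s => ?_
  congr 1
  refine lintegral_congr fun τ => ?_
  rw [lintegral_const_mul _ ((hm1 _ _).const_mul _), lintegral_const_mul _ (hm1 _ _)]

lemma Tp_real {n : ℕ} (hn : 5 ≤ n) {ν : Measure (EuclideanSpace ℝ (Fin n))} (hν : SphProb ν)
    {F : Set (EuclideanSpace ℝ (Fin n))} (hF : MeasurableSet F) (hFv : volume F ≠ ⊤)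
    (α : ℝ) (hα : α ∈ Set.Icc 2 ((n : ℝ) - 3))
    (r R : ℝ) (hr : 0 < r) (hR : r ≤ R) :
    (Tp ν (α + 2) F r).toReal = (Tp ν (α + 2) F R).toReal
      + (α * (n - α - 2)) * ∫ s in r..R, (s ^ (n - 1))⁻¹ * ∫ τ in 0..s, τ ^ (n - 1) * (Tp ν α F τ).toReal := by
  have hA : 0 ≤ α * (n - α - 2) := mul_nonneg (by linarith [hα.1]) (by linarith [hα.2])
  have hfin : ∀ τ, Tp ν α F τ ≠ ⊤ := fun τ =>
    ((Tp_le_Mb hν (by linarith [hα.2]) hF τ).trans_lt (Mb_ne_top hn (by linarith [hα.1]) hFv).lt_top).ne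
  have hfin2 : ∀ τ, Tp ν (α + 2) F τ ≠ ⊤ := fun τ =>
    ((Tp_le_Mb hν (by linarith [hα.2]) hF τ).trans_lt (Mb_ne_top hn (by linarith [hα.1]) hFv).lt_top).ne
  have hm : Measurable fun τ => (Tp ν α F τ).toReal := (measurable_Tp hν α F).ennreal_toReal
  have hb : ∀ τ, |(Tp ν α F τ).toReal| ≤ (Mb α F).toReal := fun τ => by
    rw [abs_of_nonneg ENNReal.toReal_nonneg]
    exact ENNReal.toReal_mono (Mb_ne_top hn (by linarith [hα.1]) hFv) (Tp_le_Mb hν (by linarith [hα.2]) hF τ)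
  have hI : ∀ s : ℝ, 0 < s → ∫⁻ τ in Ioc 0 s, ENNReal.ofReal (τ ^ (n - 1)) *
        (ENNReal.ofReal (α * (n - α - 2)) * Tp ν α F τ) = ENNReal.ofReal (α * (n - α - 2)) * ENNReal.ofReal
        (∫ τ in 0..s, τ ^ (n - 1) * (Tp ν α F τ).toReal) := by
    intro s hs
    rw [intervalIntegral.integral_of_le hs.le, ofReal_integral_eq_lintegral_ofReal, ← lintegral_const_mul']
    · refine setLIntegral_congr_fun measurableSet_Ioc fun τ hτ => ?_
      rw [ENNReal.ofReal_mul (pow_nonneg hτ.1.le _), ENNReal.ofReal_toReal (hfin τ)]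
      ring
    · exact ENNReal.ofReal_ne_top
    · exact (bdd_ii hm hb _ 0 s).1
    · filter_upwards [ae_restrict_mem measurableSet_Ioc] with τ hτ
      exact mul_nonneg (pow_nonneg hτ.1.le _) ENNReal.toReal_nonneg
  have hI0 : ∀ s : ℝ, 0 < s → 0 ≤ ∫ τ in 0..s, τ ^ (n - 1) * (Tp ν α F τ).toReal := by
    intro s hs
    exact intervalIntegral.integral_nonneg hs.le fun τ hτ => mul_nonneg (pow_nonneg hτ.1 _) ENNReal.toReal_nonneg
  have hO0 : ∀ s ∈ Ioc r R, 0 ≤ (s ^ (n - 1))⁻¹ * ∫ τ in 0..s, τ ^ (n - 1) * (Tp ν α F τ).toReal := by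
    intro s hs
    have hs0 := hr.trans hs.1
    have := hI0 s hs0
    positivity
  have hO : ∫⁻ s in Ioc r R, ENNReal.ofReal ((s ^ (n - 1))⁻¹) * ∫⁻ τ in Ioc 0 s, ENNReal.ofReal (τ ^ (n - 1)) *
        (ENNReal.ofReal (α * (n - α - 2)) * Tp ν α F τ) = ENNReal.ofReal (α * (n - α - 2)) * ENNReal.ofReal
        (∫ s in r..R, (s ^ (n - 1))⁻¹ * ∫ τ in 0..s, τ ^ (n - 1) * (Tp ν α F τ).toReal) := by
    rw [intervalIntegral.integral_of_le hR, ofReal_integral_eq_lintegral_ofReal, ← lintegral_const_mul']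
    · refine setLIntegral_congr_fun measurableSet_Ioc fun s hs => ?_
      have hs0 := hr.trans hs.1
      rw [hI s hs0, ENNReal.ofReal_mul (p := (s ^ (n - 1))⁻¹) (by positivity)]
      ring
    · exact ENNReal.ofReal_ne_top
    · exact (outer_ii hm hb _ _ _ hr hR).1
    · filter_upwards [ae_restrict_mem measurableSet_Ioc] with s hs
      exact hO0 s hs
  rw [Tp_identity hn hν F α hα r R hr hR, hO, ENNReal.toReal_add (hfin2 R)
    (ENNReal.mul_ne_top ENNReal.ofReal_ne_top ENNReal.ofReal_ne_top), ENNReal.toReal_mul,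
    ENNReal.toReal_ofReal hA, ENNReal.toReal_ofReal]
  rw [intervalIntegral.integral_of_le hR]
  exact setIntegral_nonneg measurableSet_Ioc hO0


lemma rieszConst_rec {n : ℕ} {α : ℝ} (hα : α ∈ Set.Icc 2 ((n : ℝ) - 3)) :
    rieszConst n (α + 2) * (α * (n - α - 2)) = rieszConst n α := by
  obtain ⟨h1, h2⟩ := hα
  unfold rieszConst
  have g1 : Real.Gamma ((α + 2) / 2) = α / 2 * Real.Gamma (α / 2) := by
    rw [← Real.Gamma_add_one (by linarith)]; congr 1; ring
  have g2 : Real.Gamma (((n : ℝ) - α) / 2) = ((n : ℝ) - α - 2) / 2 * Real.Gamma (((n : ℝ) - (α + 2)) / 2) := by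
    have : ((n : ℝ) - α - 2) / 2 = ((n : ℝ) - (α + 2)) / 2 := by ring
    rw [this, ← Real.Gamma_add_one (by linarith)]; congr 1; ring
  have g3 : (2 : ℝ) ^ (α + 2) = 2 ^ α * 4 := by
    rw [Real.rpow_add two_pos]; norm_num
  have p1 : 0 < Real.Gamma (α / 2) := Real.Gamma_pos_of_pos (by linarith)
  have p2 : 0 < Real.Gamma (((n : ℝ) - (α + 2)) / 2) := Real.Gamma_pos_of_pos (by linarith)
  have p3 : 0 < (2 : ℝ) ^ α := by positivity
  have p4 : 0 < (n : ℝ) - α - 2 := by linarith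
  have p5 : 0 < α := by linarith
  have p6 : 0 < Real.pi ^ ((n : ℝ) / 2) := by positivity
  rw [g1, g2, g3]
  field_simp
  norm_num

section
variable {n : ℕ}

lemma Vp_real (hn : 5 ≤ n) {β : ℝ} (hβ0 : 0 < β) (hβ : β < n) {F : Set (EuclideanSpace ℝ (Fin n))}
    (hF : MeasurableSet F) (hFv : volume F ≠ ⊤) (x : EuclideanSpace ℝ (Fin n)) :
    Integrable (fun ξ => F.indicator 1 ξ * ‖x - ξ‖ ^ (β - (n : ℝ))) ∧
    ∫ ξ, F.indicator 1 ξ * ‖x - ξ‖ ^ (β - (n : ℝ)) = (Vp β F x).toReal := by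
  have hV : Vp β F x ≠ ⊤ := ((Vp_le_Mb hβ hF x).trans_lt (Mb_ne_top hn hβ0 hFv).lt_top).ne
  have he : (fun ξ => F.indicator 1 ξ * ‖x - ξ‖ ^ (β - (n : ℝ)))
      = F.indicator (fun ξ => ‖x - ξ‖ ^ (β - (n : ℝ))) := by
    ext ξ; by_cases h : ξ ∈ F <;> simp [h]
  have hms : AEStronglyMeasurable (fun ξ : EuclideanSpace ℝ (Fin n) => ‖x - ξ‖ ^ (β - (n : ℝ))) (volume.restrict F) :=
    Measurable.aestronglyMeasurable (by fun_prop)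
  have h0 : 0 ≤ᵐ[volume.restrict F] (fun ξ : EuclideanSpace ℝ (Fin n) => ‖x - ξ‖ ^ (β - (n : ℝ))) :=
    Filter.Eventually.of_forall fun y => by simp only [Pi.zero_apply]; positivity
  rw [he]
  refine ⟨?_, ?_⟩
  · rw [integrable_indicator_iff hF]
    exact (lintegral_ofReal_ne_top_iff_integrable hms h0).1 hV
  · rw [integral_indicator hF, integral_eq_lintegral_of_nonneg_ae h0 hms]
    rfl

lemma rieszPot_eq (hn : 5 ≤ n) {β : ℝ} (hβ0 : 0 < β) (hβ : β < n) {E : Set (EuclideanSpace ℝ (Fin n))}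
    (hE : MeasurableSet E) (hEv : volume E ≠ ⊤) (x : EuclideanSpace ℝ (Fin n)) :
    rieszPot β (fE E) x = rieszConst n β * ((Vp β (ball 0 1) x).toReal - (Vp β E x).toReal) := by
  obtain ⟨i1, e1⟩ := Vp_real hn hβ0 hβ (F := ball 0 1) measurableSet_ball measure_ball_lt_top.ne x
  obtain ⟨i2, e2⟩ := Vp_real hn hβ0 hβ hE hEv x
  unfold rieszPot fE
  simp only [sub_mul]
  rw [integral_sub i1 i2, e1, e2]

/-- spherical mean of the Riesz potential -/
noncomputable def phi (ν : Measure (EuclideanSpace ℝ (Fin n))) (β : ℝ) (E : Set (EuclideanSpace ℝ (Fin n))) (r : ℝ) : ℝ :=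
  rieszConst n β * ((Tp ν β (ball 0 1) r).toReal - (Tp ν β E r).toReal)

lemma Vp_toReal_int (hn : 5 ≤ n) {β : ℝ} (hβ0 : 0 < β) (hβ : β < n) {F : Set (EuclideanSpace ℝ (Fin n))}
    (hF : MeasurableSet F) (hFv : volume F ≠ ⊤) {X : Type*} [MeasurableSpace X] (μ : Measure X) [IsFiniteMeasure μ]
    (f : X → EuclideanSpace ℝ (Fin n)) (hf : Measurable f) :
    Integrable (fun x => (Vp β F (f x)).toReal) μ ∧
      ∫ x, (Vp β F (f x)).toReal ∂μ = (∫⁻ x, Vp β F (f x) ∂μ).toReal := by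
  have hV : ∀ x, Vp β F x < ⊤ := fun x => (Vp_le_Mb hβ hF x).trans_lt (Mb_ne_top hn hβ0 hFv).lt_top
  have hm : Measurable fun x => Vp β F (f x) := (measurable_Vp β F).comp hf
  refine ⟨?_, integral_toReal hm.aemeasurable (Filter.Eventually.of_forall fun x => hV _)⟩
  refine integrable_toReal_of_lintegral_ne_top hm.aemeasurable ?_
  refine ((lintegral_mono fun x => Vp_le_Mb hβ hF (f x)).trans_lt ?_).ne
  rw [lintegral_const]
  exact ENNReal.mul_lt_top (Mb_ne_top hn hβ0 hFv).lt_top (measure_lt_top _ _)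

lemma sphAvg_eq (hn : 5 ≤ n) {ν : Measure (EuclideanSpace ℝ (Fin n))} (hν : SphProb ν)
    (hs : ∀ (g : EuclideanSpace ℝ (Fin n) → ℝ) (r : ℝ), 0 < r → sphAvg g r = ∫ ω, g (r • ω) ∂ν)
    {β : ℝ} (hβ0 : 0 < β) (hβ : β < n) {E : Set (EuclideanSpace ℝ (Fin n))}
    (hE : MeasurableSet E) (hEv : volume E ≠ ⊤) {r : ℝ} (hr : 0 < r) :
    sphAvg (rieszPot β (fE E)) r = phi ν β E r := by
  have := hν.prob
  rw [hs _ r hr]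
  simp only [rieszPot_eq hn hβ0 hβ hE hEv]
  obtain ⟨i1, e1⟩ := Vp_toReal_int hn hβ0 hβ (F := ball 0 1) measurableSet_ball measure_ball_lt_top.ne ν
    (fun ω => r • ω) (by fun_prop)
  obtain ⟨i2, e2⟩ := Vp_toReal_int hn hβ0 hβ hE hEv ν (fun ω => r • ω) (by fun_prop)
  rw [integral_const_mul, integral_sub i1 i2, e1, e2]
  rfl

lemma exists_iso (x y : EuclideanSpace ℝ (Fin n)) (h : ‖x‖ = ‖y‖) :
    ∃ g : EuclideanSpace ℝ (Fin n) ≃ₗᵢ[ℝ] EuclideanSpace ℝ (Fin n), g x = y :=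
  ⟨(ℝ ∙ (x - y))ᗮ.reflection, Submodule.reflection_sub h⟩

lemma exists_unit (hn : 5 ≤ n) (x : EuclideanSpace ℝ (Fin n)) :
    ∃ η : EuclideanSpace ℝ (Fin n), ‖η‖ = 1 ∧ x = ‖x‖ • η := by
  by_cases hx : x = 0
  · exact ⟨EuclideanSpace.single ⟨0, by omega⟩ 1, by simp, by simp [hx]⟩
  · have : ‖x‖ ≠ 0 := norm_ne_zero_iff.2 hx
    refine ⟨‖x‖⁻¹ • x, ?_, ?_⟩
    · rw [norm_smul, norm_inv, norm_norm, inv_mul_cancel₀ this]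
    · rw [smul_smul, mul_inv_cancel₀ this, one_smul]

lemma SphProb.lintegral_comp {ν : Measure (EuclideanSpace ℝ (Fin n))} (hν : SphProb ν)
    (g : EuclideanSpace ℝ (Fin n) ≃ₗᵢ[ℝ] EuclideanSpace ℝ (Fin n))
    (f : EuclideanSpace ℝ (Fin n) → ENNReal) : ∫⁻ ω, f (g ω) ∂ν = ∫⁻ ω, f ω ∂ν := by
  conv_rhs => rw [← hν.inv g]
  exact (g.toHomeomorph.measurableEmbedding.lintegral_map f).symm

lemma kap_sph_symm (hn : 5 ≤ n) {ν : Measure (EuclideanSpace ℝ (Fin n))} (hν : SphProb ν) (β : ℝ)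
    (x ξ : EuclideanSpace ℝ (Fin n)) :
    ∫⁻ ω, kap β (x - ‖ξ‖ • ω) ∂ν = ∫⁻ ω, kap β (‖x‖ • ω - ξ) ∂ν := by
  obtain ⟨η, hη, hx⟩ := exists_unit hn x
  obtain ⟨ζ, hζ, hξ⟩ := exists_unit hn ξ
  obtain ⟨g, hg⟩ := exists_iso η ζ (hη.trans hζ.symm)
  have h1 : ∀ ω, kap β (x - ‖ξ‖ • ω) = kap β (‖x‖ • ζ - ‖ξ‖ • g ω) := by
    intro ω
    unfold kap
    rw [← hg, ← map_smul, ← map_smul, ← map_sub, g.norm_map, ← hx]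
  rw [lintegral_congr h1, hν.lintegral_comp g fun ω => kap β (‖x‖ • ζ - ‖ξ‖ • ω)]
  refine lintegral_congr_ae ?_
  filter_upwards [hν.ae_norm] with ω hω
  unfold kap
  have : ‖‖x‖ • ζ - ‖ξ‖ • ω‖ = ‖‖x‖ • ω - ξ‖ := by
    rw [← sq_eq_sq₀ (norm_nonneg _) (norm_nonneg _)]
    conv_rhs => rw [hξ]
    rw [norm_sub_sq_real, norm_sub_sq_real, norm_smul, norm_smul, norm_smul, norm_smul, hω, hζ,
      real_inner_smul_left, real_inner_smul_right, real_inner_smul_left, real_inner_smul_right, real_inner_comm]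
  rw [this]

lemma ball_kap (hn : 5 ≤ n) {ν : Measure (EuclideanSpace ℝ (Fin n))} (hν : SphProb ν) (β : ℝ)
    (ξ : EuclideanSpace ℝ (Fin n)) :
    ∫⁻ x in ball 0 1, kap β (x - ξ) = ∫⁻ x in ball (0 : EuclideanSpace ℝ (Fin n)) 1, ∫⁻ ω, kap β (‖x‖ • ω - ξ) ∂ν := by
  have := hν.prob
  have hK : ∀ ξ' : EuclideanSpace ℝ (Fin n), ‖ξ‖ = ‖ξ'‖ →
      ∫⁻ x in ball 0 1, kap β (x - ξ) = ∫⁻ x in ball 0 1, kap β (x - ξ') := by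
    intro ξ' h
    obtain ⟨g, hg⟩ := exists_iso ξ' ξ h.symm
    rw [← lintegral_indicator measurableSet_ball, ← lintegral_indicator measurableSet_ball,
      ← g.measurePreserving.lintegral_comp_emb g.toHomeomorph.measurableEmbedding]
    refine lintegral_congr fun x => ?_
    simp only [indicator, mem_ball, dist_zero_right, g.norm_map]
    unfold kap
    rw [← hg, ← map_sub, g.norm_map]
  have h1 : ∫⁻ x in ball 0 1, kap β (x - ξ) = ∫⁻ ω, (∫⁻ x in ball 0 1, kap β (x - ‖ξ‖ • ω)) ∂ν := by
    have : ∀ᵐ ω ∂ν, ∫⁻ x in ball 0 1, kap β (x - ‖ξ‖ • ω) = ∫⁻ x in ball 0 1, kap β (x - ξ) := by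
      filter_upwards [hν.ae_norm] with ω hω
      refine (hK _ ?_).symm
      rw [norm_smul, hω, mul_one, norm_norm]
    rw [lintegral_congr_ae this]
    simp
  rw [h1, lintegral_lintegral_swap]
  · exact lintegral_congr fun x => kap_sph_symm hn hν β x ξ
  · exact ((measurable_kap β).comp (by fun_prop)).aemeasurable

lemma ball_Vp (hn : 5 ≤ n) {ν : Measure (EuclideanSpace ℝ (Fin n))} (hν : SphProb ν) (β : ℝ)
    (F : Set (EuclideanSpace ℝ (Fin n))) :
    ∫⁻ x in ball 0 1, Vp β F x = ∫⁻ x in ball (0 : EuclideanSpace ℝ (Fin n)) 1, Tp ν β F ‖x‖ := by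
  have := hν.prob
  have hm : ∀ β : ℝ, Measurable fun x : ℝ × EuclideanSpace ℝ (Fin n) => ∫⁻ ω, kap β (x.1 • ω - x.2) ∂ν :=
    fun β => Measurable.lintegral_prod_right'
      (f := fun x : (ℝ × EuclideanSpace ℝ (Fin n)) × EuclideanSpace ℝ (Fin n) => kap β (x.1.1 • x.2 - x.1.2))
      (measurable_pair β)
  unfold Vp
  rw [lintegral_lintegral_swap (f := fun x ξ : EuclideanSpace ℝ (Fin n) => kap β (x - ξ))
    ((measurable_kap β).comp (by fun_prop)).aemeasurable]
  simp only [ball_kap hn hν, Tp_swap hν]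
  refine lintegral_lintegral_swap (Measurable.aemeasurable ?_)
  exact (hm β).comp (g := fun x : ℝ × EuclideanSpace ℝ (Fin n) => ∫⁻ ω, kap β (x.1 • ω - x.2) ∂ν)
    (f := fun x : EuclideanSpace ℝ (Fin n) × EuclideanSpace ℝ (Fin n) => (‖x.2‖, x.1)) (by fun_prop)

lemma ballAvg_eq (hn : 5 ≤ n) {ν : Measure (EuclideanSpace ℝ (Fin n))} (hν : SphProb ν)
    {β : ℝ} (hβ0 : 0 < β) (hβ : β < n) {E : Set (EuclideanSpace ℝ (Fin n))}
    (hE : MeasurableSet E) (hEv : volume E ≠ ⊤) :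
    ballAvg (rieszPot β (fE E)) 1 = n * ∫ τ in 0..1, τ ^ (n - 1) * phi ν β E τ := by
  have : Nonempty (Fin n) := ⟨⟨0, by omega⟩⟩
  have : IsFiniteMeasure (volume.restrict (ball (0 : EuclideanSpace ℝ (Fin n)) 1)) :=
    ⟨by rw [Measure.restrict_apply_univ]; exact measure_ball_lt_top⟩
  have hT : ∀ F : Set (EuclideanSpace ℝ (Fin n)), MeasurableSet F → volume F ≠ ⊤ →
      Integrable (fun x => (Tp ν β F ‖x‖).toReal) (volume.restrict (ball (0 : EuclideanSpace ℝ (Fin n)) 1)) ∧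
      ∫ x in ball (0 : EuclideanSpace ℝ (Fin n)) 1, (Vp β F x).toReal =
        ∫ x in ball (0 : EuclideanSpace ℝ (Fin n)) 1, (Tp ν β F ‖x‖).toReal := by
    intro F hF hFv
    have hm : Measurable fun x : EuclideanSpace ℝ (Fin n) => Tp ν β F ‖x‖ := (measurable_Tp hν β F).comp measurable_norm
    refine ⟨?_, ?_⟩
    · refine integrable_toReal_of_lintegral_ne_top hm.aemeasurable ?_
      refine ((lintegral_mono fun x : EuclideanSpace ℝ (Fin n) => Tp_le_Mb hν hβ hF ‖x‖).trans_lt ?_).ne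
      rw [lintegral_const]
      exact ENNReal.mul_lt_top (Mb_ne_top hn hβ0 hFv).lt_top (measure_lt_top _ _)
    · rw [(Vp_toReal_int hn hβ0 hβ hF hFv _ (fun x => x) measurable_id).2, ball_Vp hn hν,
        integral_toReal hm.aemeasurable (Filter.Eventually.of_forall fun x =>
          (Tp_le_Mb hν hβ hF ‖x‖).trans_lt (Mb_ne_top hn hβ0 hFv).lt_top)]
  have hB := hT (ball 0 1) measurableSet_ball measure_ball_lt_top.ne
  have hEE := hT E hE hEv
  have h1 : ∫ x in ball (0 : EuclideanSpace ℝ (Fin n)) 1, rieszPot β (fE E) x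
      = ∫ x in ball (0 : EuclideanSpace ℝ (Fin n)) 1, phi ν β E ‖x‖ := by
    unfold phi
    simp only [rieszPot_eq hn hβ0 hβ hE hEv]
    rw [integral_const_mul, integral_const_mul, integral_sub hB.1 hEE.1, integral_sub
      (Vp_toReal_int hn hβ0 hβ measurableSet_ball measure_ball_lt_top.ne _ (fun x => x) measurable_id).1
      (Vp_toReal_int hn hβ0 hβ hE hEv _ (fun x => x) measurable_id).1, hB.2, hEE.2]
  have h2 : ∫ x in ball (0 : EuclideanSpace ℝ (Fin n)) 1, phi ν β E ‖x‖
      = ∫ x : EuclideanSpace ℝ (Fin n), (Iio 1).indicator (phi ν β E) ‖x‖ := by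
    rw [← integral_indicator measurableSet_ball]
    congr 1
    ext x
    simp [indicator]
  have h3 : ∫ y in Ioi (0 : ℝ), y ^ (n - 1) • (Iio 1).indicator (phi ν β E) y
      = ∫ τ in 0..1, τ ^ (n - 1) * phi ν β E τ := by
    rw [intervalIntegral.integral_of_le zero_le_one, integral_Ioc_eq_integral_Ioo,
      ← integral_indicator measurableSet_Ioo, ← integral_indicator measurableSet_Ioi]
    congr 1
    ext x
    by_cases h1 : 0 < x <;> by_cases h2 : x < 1 <;> simp [indicator, h1, h2]
  unfold ballAvg
  rw [h1, h2, integral_fun_norm_addHaar]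
  simp only [finrank_euclideanSpace, Fintype.card_fin]
  rw [h3, nsmul_eq_mul, smul_eq_mul]
  have hv : volume.real (ball (0 : EuclideanSpace ℝ (Fin n)) 1) ≠ 0 :=
    (ENNReal.toReal_pos (measure_ball_pos volume _ one_pos).ne' measure_ball_lt_top.ne).ne'
  change (volume.real (ball (0 : EuclideanSpace ℝ (Fin n)) 1))⁻¹ * _ = _
  field_simp

open Filter Topology in
lemma phi_tendsto (hn : 5 ≤ n) {ν : Measure (EuclideanSpace ℝ (Fin n))} (hν : SphProb ν)
    {β : ℝ} (hβ0 : 0 < β) (hβ : β < n) {E : Set (EuclideanSpace ℝ (Fin n))}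
    (hE : MeasurableSet E) (hEv : volume E ≠ ⊤) : Tendsto (phi ν β E) atTop (𝓝 0) := by
  have h1 := (ENNReal.tendsto_toReal ENNReal.zero_ne_top).comp
    (Tp_tendsto hn hν hβ0 hβ (F := ball 0 1) measurableSet_ball measure_ball_lt_top.ne)
  have h2 := (ENNReal.tendsto_toReal ENNReal.zero_ne_top).comp (Tp_tendsto hn hν hβ0 hβ hE hEv)
  have h3 := (h1.sub h2).const_mul (rieszConst n β)
  rw [sub_self, mul_zero] at h3
  exact h3

lemma phi_identity (hn : 5 ≤ n) {ν : Measure (EuclideanSpace ℝ (Fin n))} (hν : SphProb ν)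
    {E : Set (EuclideanSpace ℝ (Fin n))} (hE : MeasurableSet E) (hEv : volume E ≠ ⊤)
    (α : ℝ) (hα : α ∈ Set.Icc 2 ((n : ℝ) - 3)) (r R : ℝ) (hr : 0 < r) (hR : r ≤ R) :
    phi ν (α + 2) E r = phi ν (α + 2) E R
      + ∫ s in r..R, (s ^ (n - 1))⁻¹ * ∫ τ in 0..s, τ ^ (n - 1) * phi ν α E τ := by
  have h1 := Tp_real hn hν (F := ball 0 1) measurableSet_ball measure_ball_lt_top.ne α hα r R hr hR
  have h2 := Tp_real hn hν hE hEv α hα r R hr hR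
  have hm : ∀ F : Set (EuclideanSpace ℝ (Fin n)), Measurable fun τ => (Tp ν α F τ).toReal :=
    fun F => (measurable_Tp hν α F).ennreal_toReal
  have hb : ∀ F : Set (EuclideanSpace ℝ (Fin n)), MeasurableSet F → volume F ≠ ⊤ →
      ∀ τ, |(Tp ν α F τ).toReal| ≤ (Mb α F).toReal := fun F hF hFv τ => by
    rw [abs_of_nonneg ENNReal.toReal_nonneg]
    exact ENNReal.toReal_mono (Mb_ne_top hn (by linarith [hα.1]) hFv) (Tp_le_Mb hν (by linarith [hα.2]) hF τ)
  have hbB := hb (ball 0 1) measurableSet_ball measure_ball_lt_top.ne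
  have hbE := hb E hE hEv
  have h3 : ∀ s : ℝ, ∫ τ in 0..s, τ ^ (n - 1) * phi ν α E τ = rieszConst n α *
      ((∫ τ in 0..s, τ ^ (n - 1) * (Tp ν α (ball 0 1) τ).toReal) - ∫ τ in 0..s, τ ^ (n - 1) * (Tp ν α E τ).toReal) := by
    intro s
    rw [← intervalIntegral.integral_sub (bdd_ii (hm _) hbB _ _ _) (bdd_ii (hm _) hbE _ _ _),
      ← intervalIntegral.integral_const_mul]
    congr 1
    ext τ
    unfold phi
    ring
  have h4 : ∫ s in r..R, (s ^ (n - 1))⁻¹ * ∫ τ in 0..s, τ ^ (n - 1) * phi ν α E τ = rieszConst n α *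
      ((∫ s in r..R, (s ^ (n - 1))⁻¹ * ∫ τ in 0..s, τ ^ (n - 1) * (Tp ν α (ball 0 1) τ).toReal) -
        ∫ s in r..R, (s ^ (n - 1))⁻¹ * ∫ τ in 0..s, τ ^ (n - 1) * (Tp ν α E τ).toReal) := by
    rw [← intervalIntegral.integral_sub (outer_ii (hm _) hbB _ _ _ hr hR) (outer_ii (hm _) hbE _ _ _ hr hR),
      ← intervalIntegral.integral_const_mul]
    congr 1
    ext s
    rw [h3]
    ring
  rw [h4, ← rieszConst_rec hα]
  unfold phi
  rw [h1, h2]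
  ring

lemma main_aux (hn : 5 ≤ n) (α : ℝ) (hα : α ∈ Set.Icc 2 ((n : ℝ) - 3))
    (E : Set (EuclideanSpace ℝ (Fin n))) (hE : MeasurableSet E) (hEv : volume E ≠ ⊤)
    (hmono : AntitoneOn (sphAvg (rieszPot α (fE E))) (Set.Ioi 0)) (r : ℝ) (hr : r ∈ Set.Ioo (0 : ℝ) 1) :
      sphAvg (rieszPot (α + 2) (fE E)) r ≥
        ballAvg (rieszPot α (fE E)) 1 * (1 - r ^ 2) / (2 * (n : ℝ)) := by
  obtain ⟨ν, hν, hs⟩ := exists_sphProb hn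
  have a0 : 0 < α := by linarith [hα.1]
  have a1 : α < n := by linarith [hα.2]
  have b0 : 0 < α + 2 := by linarith
  have b1 : α + 2 < n := by linarith [hα.2]
  rw [sphAvg_eq hn hν hs b0 b1 hE hEv hr.1, ballAvg_eq hn hν a0 a1 hE hEv]
  have hanti : AntitoneOn (phi ν α E) (Ioi 0) := fun x hx y hy hxy => by
    have := hmono hx hy hxy
    rwa [sphAvg_eq hn hν hs a0 a1 hE hEv hx, sphAvg_eq hn hν hs a0 a1 hE hEv hy] at this
  have hm : Measurable (phi ν α E) :=
    ((measurable_Tp hν α _).ennreal_toReal.sub (measurable_Tp hν α _).ennreal_toReal).const_mul _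
  refine final_real hn (M := |rieszConst n α| * ((Mb α (ball (0 : EuclideanSpace ℝ (Fin n)) 1)).toReal + (Mb α E).toReal))
    hm (fun τ => ?_) hanti (phi_tendsto hn hν a0 a1 hE hEv)
    (phi_tendsto hn hν b0 b1 hE hEv) (fun r R h1 h2 => phi_identity hn hν hE hEv α hα r R h1 h2) r hr
  have h1 := ENNReal.toReal_mono (Mb_ne_top hn a0 (measure_ball_lt_top (x := 0) (r := 1)).ne)
    (Tp_le_Mb hν a1 (F := ball 0 1) measurableSet_ball τ)
  have h2 := ENNReal.toReal_mono (Mb_ne_top hn a0 hEv) (Tp_le_Mb hν a1 hE τ)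
  have h3 : 0 ≤ (Tp ν α (ball 0 1) τ).toReal := ENNReal.toReal_nonneg
  have h4 : 0 ≤ (Tp ν α E τ).toReal := ENNReal.toReal_nonneg
  unfold phi
  rw [abs_mul]
  refine mul_le_mul_of_nonneg_left ?_ (abs_nonneg _)
  rw [abs_le]
  constructor <;> linarith

end

/-- Quantitative lower bound for the spherical averages of `I_{α+2} f_E`:
`φ_{α+2}(r) ≥ Φ_α(1)(1-r²)/(2n)` for `r ∈ (0,1)`. -/
theorem statement12 (n : ℕ) (hn : 5 ≤ n) (α : ℝ) (hα : α ∈ Set.Icc 2 ((n : ℝ) - 3))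
    (E : Set (EuclideanSpace ℝ (Fin n))) (hE : HasFinitePerimeter E)
    (hvol : volume E = volume (ball (0 : EuclideanSpace ℝ (Fin n)) 1))
    (hmono : AntitoneOn (sphAvg (rieszPot α (fE E))) (Set.Ioi 0)) :
    ∀ r ∈ Set.Ioo (0 : ℝ) 1,
      sphAvg (rieszPot (α + 2) (fE E)) r ≥
        ballAvg (rieszPot α (fE E)) 1 * (1 - r ^ 2) / (2 * (n : ℝ)) := by
  intro r hr
  refine main_aux hn α hα E hE.1 ?_ hmono r hr
  rw [hvol]
  exact measure_ball_lt_top.ne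
end

section
/- Let n ≥ 5 be odd and let E ⊂ ℝⁿ be a set of finite perimeter with |E| = |B_1|. Then there is a constant C = C(n) > 0, depending only on n, such that ∫_{B_1} ∫_{ℝⁿ} (χ_{B_1} − χ_E)(x) |x−y|^{2−n} dx dy ≤ C ∫_{B_1} ∫_{ℝⁿ} (χ_{B_1} − χ_E)(x) |x−y|^{−3} dx dy. -/
open MeasureTheory Metric Set

theorem aux_locInt (n m : ℕ) (hm : m < n) :
    LocallyIntegrable (fun z : EuclideanSpace ℝ (Fin n) => (‖z‖ ^ m)⁻¹) volume := by
  refine locallyIntegrable_of_norm_le_rpow (C := 1) (α := (m : ℝ)) ?_ ?_ ?_ ?_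
  · simp; omega
  · simpa using hm
  · refine Filter.Eventually.of_forall fun z => ?_
    rw [Real.rpow_neg (norm_nonneg _), Real.rpow_natCast]
    simp
  · exact (by fun_prop : Measurable (fun z : EuclideanSpace ℝ (Fin n) => (‖z‖ ^ m)⁻¹)).aestronglyMeasurable

theorem aux_int_ball (n m : ℕ) (hm : m < n) (x c : EuclideanSpace ℝ (Fin n)) (r : ℝ) :
    IntegrableOn (fun y : EuclideanSpace ℝ (Fin n) => (‖x - y‖ ^ m)⁻¹) (ball c r) volume := by
  have h1 : IntegrableOn (fun z : EuclideanSpace ℝ (Fin n) => (‖z‖ ^ m)⁻¹) (ball (x - c) r) volume :=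
    ((aux_locInt n m hm).integrableOn_isCompact
      (isCompact_closedBall (x - c) r)).mono_set ball_subset_closedBall
  have h2 : Integrable ((ball (x - c) r).indicator (fun z : EuclideanSpace ℝ (Fin n) => (‖z‖ ^ m)⁻¹)) volume :=
    (integrable_indicator_iff measurableSet_ball).2 h1
  have h3 := h2.comp_sub_left x
  rw [← integrable_indicator_iff measurableSet_ball]
  refine h3.congr (Filter.Eventually.of_forall fun y => ?_)
  have : y ∈ ball c r ↔ x - y ∈ ball (x - c) r := by
    rw [mem_ball, mem_ball, dist_eq_norm, dist_eq_norm, sub_sub_sub_cancel_left, norm_sub_rev]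
  by_cases h : y ∈ ball c r
  · simp [indicator, h, this.1 h]
  · simp [indicator, h, mt this.2 h]

theorem aux_bound (n m : ℕ) (hm : m < n) : ∃ M : ℝ, 0 ≤ M ∧ ∀ x : EuclideanSpace ℝ (Fin n),
    ∫ y in ball (0 : EuclideanSpace ℝ (Fin n)) 1, (‖x - y‖ ^ m)⁻¹ ≤ M := by
  refine ⟨(∫ z, (ball (0 : EuclideanSpace ℝ (Fin n)) 1).indicator (fun z : EuclideanSpace ℝ (Fin n) => (‖z‖ ^ m)⁻¹) z)
    + ∫ y in ball (0 : EuclideanSpace ℝ (Fin n)) 1, (1 : ℝ), ?_, fun x => ?_⟩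
  · refine add_nonneg (integral_nonneg fun z => indicator_nonneg (fun _ _ => by positivity) _)
      (integral_nonneg fun z => zero_le_one)
  have hI : Integrable ((ball (0 : EuclideanSpace ℝ (Fin n)) 1).indicator (fun z : EuclideanSpace ℝ (Fin n) => (‖z‖ ^ m)⁻¹)) volume := by
    rw [integrable_indicator_iff measurableSet_ball]
    simpa using aux_int_ball n m hm 0 0 1
  have hc := hI.comp_sub_left x
  rw [← integral_sub_left_eq_self _ volume x]
  have h1 : ∫ y in ball (0 : EuclideanSpace ℝ (Fin n)) 1,
      ((ball (0 : EuclideanSpace ℝ (Fin n)) 1).indicator (fun z : EuclideanSpace ℝ (Fin n) => (‖z‖ ^ m)⁻¹) (x - y)) ≤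
      ∫ y, ((ball (0 : EuclideanSpace ℝ (Fin n)) 1).indicator (fun z : EuclideanSpace ℝ (Fin n) => (‖z‖ ^ m)⁻¹) (x - y)) :=
    setIntegral_le_integral hc (Filter.Eventually.of_forall fun z =>
      indicator_nonneg (fun _ _ => by positivity) _)
  have hone : IntegrableOn (fun _ : EuclideanSpace ℝ (Fin n) => (1 : ℝ)) (ball (0 : EuclideanSpace ℝ (Fin n)) 1) volume :=
    integrableOn_const measure_ball_lt_top.ne
  refine le_trans ?_ (add_le_add_left h1 _)
  rw [← integral_add hc.integrableOn hone]
  refine integral_mono (aux_int_ball n m hm x 0 1) (hc.integrableOn.add hone) fun y => ?_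
  by_cases h : x - y ∈ ball (0 : EuclideanSpace ℝ (Fin n)) 1
  · simp [indicator, h]
  · simp only [indicator, h, if_false, zero_add]
    have : 1 ≤ ‖x - y‖ := by simpa using h
    exact inv_le_one_of_one_le₀ (one_le_pow₀ this)

theorem aux_pq_one (m : ℕ) {p q : ℝ} (hp : 0 < p) (hpq : p ≤ q) :
    (p ^ m)⁻¹ - (q ^ m)⁻¹ ≤ m * (q - p) * (p ^ (m + 1))⁻¹ := by
  have hq : 0 < q := hp.trans_le hpq
  have hb := one_add_mul_le_pow (a := p / q - 1)
    (by have : 0 ≤ p / q := by positivity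
        linarith) m
  rw [add_sub_cancel] at hb
  have e1 : (q ^ m)⁻¹ = (p ^ m)⁻¹ * (p / q) ^ m := by
    rw [div_pow]; field_simp
  have e2 : 1 - p / q ≤ (q - p) / p := by
    rw [one_sub_div hq.ne']
    exact div_le_div_of_nonneg_left (by linarith) hp hpq
  calc (p ^ m)⁻¹ - (q ^ m)⁻¹ = (p ^ m)⁻¹ * (1 - (p / q) ^ m) := by rw [e1]; ring
    _ ≤ (p ^ m)⁻¹ * (m * ((q - p) / p)) := by
        gcongr
        nlinarith [mul_le_mul_of_nonneg_left e2 (Nat.cast_nonneg (α := ℝ) m)]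
    _ = _ := by rw [pow_succ]; field_simp

theorem aux_pq (m : ℕ) {p q : ℝ} (hp : 0 < p) (hq : 0 < q) :
    |(p ^ m)⁻¹ - (q ^ m)⁻¹| ≤ m * |p - q| * ((p ^ (m + 1))⁻¹ + (q ^ (m + 1))⁻¹) := by
  wlog h : p ≤ q generalizing p q
  · have := this hq hp (le_of_not_ge h)
    rw [abs_sub_comm, abs_sub_comm p q, add_comm ((p ^ (m + 1))⁻¹)]
    exact this
  have h1 := aux_pq_one m hp h
  have h2 : (q ^ m)⁻¹ ≤ (p ^ m)⁻¹ := by gcongr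
  rw [abs_of_nonneg (by linarith), abs_sub_comm, abs_of_nonneg (by linarith : 0 ≤ q - p)]
  refine h1.trans ?_
  have : 0 ≤ (q ^ (m + 1))⁻¹ := by positivity
  exact mul_le_mul_of_nonneg_left (by linarith)
    (mul_nonneg (Nat.cast_nonneg _) (by linarith))

theorem aux_lip (n m : ℕ) (hm : m + 1 < n) : ∃ L : ℝ, 0 ≤ L ∧ ∀ x z : EuclideanSpace ℝ (Fin n),
    |(∫ y in ball (0 : EuclideanSpace ℝ (Fin n)) 1, (‖x - y‖ ^ m)⁻¹) - ∫ y in ball (0 : EuclideanSpace ℝ (Fin n)) 1, (‖z - y‖ ^ m)⁻¹|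
      ≤ L * ‖x - z‖ := by
  obtain ⟨M, hM, hb⟩ := aux_bound n (m + 1) hm
  have : Nontrivial (EuclideanSpace ℝ (Fin n)) := by
    have : Nonempty (Fin n) := ⟨⟨0, by omega⟩⟩
    infer_instance
  refine ⟨m * (M + M), by positivity, fun x z => ?_⟩
  have hx := aux_int_ball n m (by omega) x 0 1
  have hz := aux_int_ball n m (by omega) z 0 1
  have hx' := aux_int_ball n (m + 1) (by omega) x 0 1
  have hz' := aux_int_ball n (m + 1) (by omega) z 0 1
  rw [← integral_sub hx hz]
  have key : ∫ y in ball (0 : EuclideanSpace ℝ (Fin n)) 1, |(‖x - y‖ ^ m)⁻¹ - (‖z - y‖ ^ m)⁻¹| ≤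
      ∫ y in ball (0 : EuclideanSpace ℝ (Fin n)) 1, (m * ‖x - z‖) *
        ((‖x - y‖ ^ (m + 1))⁻¹ + (‖z - y‖ ^ (m + 1))⁻¹) := by
    refine integral_mono_ae (hx.sub hz).abs ((hx'.add hz').const_mul _) ?_
    have a1 : ∀ᵐ y ∂(volume.restrict (ball (0 : EuclideanSpace ℝ (Fin n)) 1)), y ≠ x :=
      ae_restrict_of_ae (Measure.ae_ne volume x)
    have a2 : ∀ᵐ y ∂(volume.restrict (ball (0 : EuclideanSpace ℝ (Fin n)) 1)), y ≠ z :=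
      ae_restrict_of_ae (Measure.ae_ne volume z)
    filter_upwards [a1, a2] with y h1 h2
    have p1 : 0 < ‖x - y‖ := norm_pos_iff.2 (sub_ne_zero.2 h1.symm)
    have p2 : 0 < ‖z - y‖ := norm_pos_iff.2 (sub_ne_zero.2 h2.symm)
    refine (aux_pq m p1 p2).trans ?_
    have : |‖x - y‖ - ‖z - y‖| ≤ ‖x - z‖ := by
      simpa using abs_norm_sub_norm_le (x - y) (z - y)
    gcongr
  refine (abs_integral_le_integral_abs).trans (key.trans ?_)
  rw [integral_const_mul, integral_add hx' hz']
  have := hb x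
  have := hb z
  calc _ ≤ (m * ‖x - z‖) * (M + M) := by gcongr
    _ = _ := by ring

theorem aux_radial (n m : ℕ) (x z : EuclideanSpace ℝ (Fin n)) (h : ‖x‖ = ‖z‖) :
    ∫ y in ball (0 : EuclideanSpace ℝ (Fin n)) 1, (‖x - y‖ ^ m)⁻¹ = ∫ y in ball (0 : EuclideanSpace ℝ (Fin n)) 1, (‖z - y‖ ^ m)⁻¹ := by
  set R := Submodule.reflection (Submodule.span ℝ {x - z})ᗮ with hR
  have hRx : R x = z := Submodule.reflection_sub h
  have hmp : MeasurePreserving R volume volume := R.measurePreserving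
  have := hmp.setIntegral_preimage_emb R.toHomeomorph.measurableEmbedding
    (fun y => (‖z - y‖ ^ m)⁻¹) (ball 0 1)
  rw [← this]
  have hpre : R ⁻¹' ball 0 1 = ball 0 1 := by
    ext y; simp
  rw [hpre]
  congr 1
  ext y
  rw [← hRx, ← map_sub, R.norm_map]

theorem aux_cube {p q δ : ℝ} (hp : 0 < p) (hp2 : p ≤ 2) (hδ : 0 ≤ δ) (hδ1 : δ ≤ 1) (hq : 0 < q)
    (h : p ^ 2 + δ ≤ q ^ 2) : δ / 100 ≤ (p ^ 3)⁻¹ - (q ^ 3)⁻¹ := by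
  have h1 : p + δ / 5 ≤ q := by
    apply le_of_sq_le_sq _ hq.le
    nlinarith
  have h2 : (q ^ 3)⁻¹ ≤ ((p + δ / 5) ^ 3)⁻¹ := by gcongr
  refine le_trans ?_ (sub_le_sub_left h2 _)
  set r := p + δ / 5 with hr
  have hr0 : 0 < r := by positivity
  have hrp : p ≤ r := by linarith
  have : (p ^ 3)⁻¹ - (r ^ 3)⁻¹ = (r ^ 3 - p ^ 3) / (p ^ 3 * r ^ 3) := by field_simp
  rw [this, le_div_iff₀ (by positivity)]
  have hd : r ^ 3 - p ^ 3 = (δ / 5) * (r ^ 2 + r * p + p ^ 2) := by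
    rw [hr]; ring
  rw [hd]
  have hp3 : p ^ 3 ≤ 2 ^ 3 := by gcongr
  have hr2 : r ≤ 2.2 := by linarith
  have : p ^ 3 * r ^ 3 ≤ 17.6 * r ^ 2 := by
    calc p ^ 3 * r ^ 3 = (p ^ 3 * r) * r ^ 2 := by ring
      _ ≤ (2 ^ 3 * 2.2) * r ^ 2 := by gcongr
      _ = _ := by norm_num
  nlinarith [mul_le_mul_of_nonneg_left this hδ, mul_nonneg hδ (mul_pos hr0 hp).le,
    mul_nonneg hδ (sq_nonneg p), mul_nonneg hδ (sq_nonneg r)]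

theorem aux_lower (n : ℕ) (hn : 5 ≤ n) : ∃ c : ℝ, 0 < c ∧ ∀ e : EuclideanSpace ℝ (Fin n), ‖e‖ = 1 →
    ∀ s t : ℝ, 0 ≤ s → s ≤ 1 → 1 ≤ t →
    c * min 1 (t - s) ≤ (∫ y in ball (0 : EuclideanSpace ℝ (Fin n)) 1, (‖s • e - y‖ ^ 3)⁻¹)
      - ∫ y in ball (0 : EuclideanSpace ℝ (Fin n)) 1, (‖t • e - y‖ ^ 3)⁻¹ := by
  have : Nontrivial (EuclideanSpace ℝ (Fin n)) := by
    have : Nonempty (Fin n) := ⟨⟨0, by omega⟩⟩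
    infer_instance
  have hvpos : 0 < volume.real (ball (0 : EuclideanSpace ℝ (Fin n)) (1 / 4)) := by
    rw [measureReal_def]
    exact ENNReal.toReal_pos (measure_ball_pos _ _ (by norm_num)).ne' measure_ball_lt_top.ne
  refine ⟨volume.real (ball (0 : EuclideanSpace ℝ (Fin n)) (1 / 4)) / 100, by positivity, ?_⟩
  intro e he s t hs hs1 ht
  set R := Submodule.reflection (Submodule.span ℝ {e})ᗮ with hR
  have hRe : R e = -e := Submodule.reflection_orthogonalComplement_singleton_eq_neg e
  have hRR : ∀ y, R (R y) = y := fun y => Submodule.reflection_reflection _ y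
  set σ : (EuclideanSpace ℝ (Fin n)) → EuclideanSpace ℝ (Fin n) := fun y => R y + (s + t) • e with hσ
  have hσσ : ∀ y, σ (σ y) = y := fun y => by
    simp only [hσ, map_add, map_smul, hRe, hRR]; module
  have hmp : MeasurePreserving σ volume volume :=
    (measurePreserving_add_right volume ((s + t) • e)).comp R.measurePreserving
  have hemb : MeasurableEmbedding σ :=
    (R.toHomeomorph.trans (Homeomorph.addRight ((s + t) • e))).measurableEmbedding
  have hn1 : ∀ y, ‖s • e - σ y‖ = ‖t • e - y‖ := fun y => by
    rw [← R.norm_map (t • e - y)]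
    congr 1
    simp only [hσ, map_sub, map_smul, hRe]; module
  have hn2 : ∀ y, ‖t • e - σ y‖ = ‖s • e - y‖ := fun y => by
    rw [← R.norm_map (s • e - y)]
    congr 1
    simp only [hσ, map_sub, map_smul, hRe]; module
  have hee : inner ℝ e e = (1 : ℝ) := by rw [real_inner_self_eq_norm_sq, he]; norm_num
  have hnr : ∀ (r : ℝ) (y : EuclideanSpace ℝ (Fin n)), ‖r • e - y‖ ^ 2 = r ^ 2 - 2 * r * inner ℝ e y + ‖y‖ ^ 2 := by
    intro r y
    rw [norm_sub_sq_real, norm_smul, he, inner_smul_left]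
    simp; ring
  -- norm of the reflected point
  have hσn : ∀ y, ‖σ y‖ ^ 2 = ‖y‖ ^ 2 + (s + t - 2 * inner ℝ e y) * (s + t) := by
    intro y
    have h0 : ‖σ y‖ = ‖(s + t) • e - y‖ := by
      rw [← R.norm_map ((s + t) • e - y), ← norm_neg]
      congr 1
      simp only [hσ, map_sub, map_smul, hRe]; module
    rw [h0, hnr]; ring
  set F : (EuclideanSpace ℝ (Fin n)) → ℝ := fun y => (‖s • e - y‖ ^ 3)⁻¹ - (‖t • e - y‖ ^ 3)⁻¹ with hF
  have hi1 := aux_int_ball n 3 (by omega) (s • e) 0 1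
  have hi2 := aux_int_ball n 3 (by omega) (t • e) 0 1
  have hFi : IntegrableOn F (ball 0 1) volume := hi1.sub hi2
  rw [← integral_sub hi1 hi2]
  change _ ≤ ∫ y in ball (0 : EuclideanSpace ℝ (Fin n)) 1, F y
  have hmeas : MeasurableSet (σ ⁻¹' (ball 0 1)) := hemb.measurable measurableSet_ball
  rw [← integral_inter_add_sdiff hmeas hFi]
  have hzero : ∫ y in ball (0 : EuclideanSpace ℝ (Fin n)) 1 ∩ σ ⁻¹' (ball 0 1), F y = 0 := by
    have h1 := hmp.setIntegral_preimage_emb hemb F (ball (0 : EuclideanSpace ℝ (Fin n)) 1 ∩ σ ⁻¹' (ball 0 1))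
    have h2 : σ ⁻¹' (ball (0 : EuclideanSpace ℝ (Fin n)) 1 ∩ σ ⁻¹' (ball 0 1)) =
        ball (0 : EuclideanSpace ℝ (Fin n)) 1 ∩ σ ⁻¹' (ball 0 1) := by
      ext y
      simp only [mem_preimage, mem_inter_iff, hσσ]
      tauto
    have h3 : ∀ y, F (σ y) = - F y := fun y => by
      simp only [hF, hn1, hn2]; ring
    rw [h2] at h1
    simp only [h3, integral_neg] at h1
    linarith
  rw [hzero, zero_add]
  set T := ball (0 : EuclideanSpace ℝ (Fin n)) 1 \ σ ⁻¹' (ball 0 1) with hT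
  have hTm : MeasurableSet T := measurableSet_ball.diff hmeas
  set D := ball (-((1 / 2 : ℝ) • e)) (1 / 4) with hD
  set δ := min 1 (t - s) with hδ
  have hδ0 : 0 ≤ δ := le_min zero_le_one (by linarith)
  have hδ1 : δ ≤ 1 := min_le_left _ _
  have hδ2 : δ ≤ t - s := min_le_right _ _
  have hDf : ∀ y ∈ D, inner ℝ e y ≤ (-1 / 4 : ℝ) ∧ ‖y‖ ≤ 3 / 4 := by
    intro y hy
    have hy' : ‖y + (1 / 2 : ℝ) • e‖ < 1 / 4 := by
      simpa [hD, dist_eq_norm] using hy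
    have h2 : ‖(1 / 2 : ℝ) • e‖ = 1 / 2 := by rw [norm_smul, he]; norm_num
    constructor
    · have h1 := real_inner_le_norm e (y + (1 / 2 : ℝ) • e)
      rw [inner_add_right, inner_smul_right, hee, he] at h1
      linarith
    · have h1 := norm_sub_le (y + (1 / 2 : ℝ) • e) ((1 / 2 : ℝ) • e)
      rw [add_sub_cancel_right, h2] at h1
      linarith
  have hDT : D ⊆ T := by
    intro y hy
    obtain ⟨h1, h2⟩ := hDf y hy
    refine ⟨by simp; linarith, ?_⟩
    intro h3
    have h4 : ‖σ y‖ < 1 := by simpa using h3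
    have h5 := hσn y
    nlinarith [norm_nonneg (σ y), sq_nonneg ‖y‖]
  have hTi : IntegrableOn F T volume := hFi.mono_set sdiff_subset
  have hpos : 0 ≤ᵐ[volume.restrict T] F := by
    have a1 : ∀ᵐ y ∂(volume.restrict T), y ≠ s • e :=
      ae_restrict_of_ae (Measure.ae_ne volume _)
    filter_upwards [a1, ae_restrict_mem hTm] with y hy hyT
    have hp : 0 < ‖s • e - y‖ := norm_pos_iff.2 (sub_ne_zero.2 hy.symm)
    have h1 : ‖y‖ < 1 := by simpa using hyT.1
    have h2 : 1 ≤ ‖σ y‖ := by simpa using hyT.2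
    have h3 := hσn y
    have ha : 0 ≤ s + t - 2 * inner ℝ e y := by
      by_contra hc
      push Not at hc
      nlinarith [norm_nonneg y]
    have hle : ‖s • e - y‖ ≤ ‖t • e - y‖ := by
      apply le_of_sq_le_sq _ (norm_nonneg _)
      rw [hnr, hnr]
      nlinarith [mul_nonneg (by linarith : 0 ≤ t - s) ha]
    simp only [hF, Pi.zero_apply, sub_nonneg]
    gcongr
  refine le_trans ?_ (setIntegral_mono_set hTi hpos hDT.eventuallyLE)
  have hDv : volume.real D = volume.real (ball (0 : EuclideanSpace ℝ (Fin n)) (1 / 4)) := by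
    rw [measureReal_def, measureReal_def, hD, Measure.addHaar_ball_center]
  have hconst : ∫ y in D, δ / 100 = volume.real (ball (0 : EuclideanSpace ℝ (Fin n)) (1 / 4)) / 100 * δ := by
    rw [setIntegral_const, hDv, smul_eq_mul]; ring
  rw [← hconst]
  refine setIntegral_mono_on (integrableOn_const measure_ball_lt_top.ne) (hTi.mono_set hDT)
    measurableSet_ball fun y hy => ?_
  obtain ⟨h1, h2⟩ := hDf y hy
  have e1 := hnr s y
  have e2 := hnr t y
  have hp : 0 < ‖s • e - y‖ := by
    have : s • e - y ≠ 0 := by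
      intro h0
      have : y = s • e := (sub_eq_zero.1 h0).symm
      rw [this, inner_smul_right, hee] at h1
      linarith
    exact norm_pos_iff.2 this
  have hp2 : ‖s • e - y‖ ≤ 2 := by
    have := norm_sub_le (s • e) y
    rw [norm_smul, he, Real.norm_of_nonneg hs] at this
    linarith
  have hq2 : ‖s • e - y‖ ^ 2 + δ ≤ ‖t • e - y‖ ^ 2 := by
    rw [e1, e2]
    nlinarith [mul_nonneg (by linarith : 0 ≤ t - s) (by linarith : 0 ≤ s + t - 2 * inner ℝ e y - 1)]
  have hq : 0 < ‖t • e - y‖ := by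
    rcases (norm_nonneg (t • e - y)).eq_or_lt with h | h
    · rw [← h] at hq2
      nlinarith
    · exact h
  exact aux_cube hp hp2 hδ0 hδ1 hq hq2

theorem aux_fubini (n m : ℕ) (hm : m < n) (f : (EuclideanSpace ℝ (Fin n)) → ℝ) (hf : Integrable f volume) :
    Integrable (fun x => f x * ∫ y in ball (0 : EuclideanSpace ℝ (Fin n)) 1, (‖x - y‖ ^ m)⁻¹) volume ∧
    ∫ y in ball (0 : EuclideanSpace ℝ (Fin n)) 1, ∫ x, f x * (‖x - y‖ ^ m)⁻¹ =
      ∫ x, f x * ∫ y in ball (0 : EuclideanSpace ℝ (Fin n)) 1, (‖x - y‖ ^ m)⁻¹ := by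
  obtain ⟨M, hM, hb⟩ := aux_bound n m hm
  have hms : AEStronglyMeasurable (fun p : (EuclideanSpace ℝ (Fin n)) × (EuclideanSpace ℝ (Fin n)) => f p.1 * (‖p.1 - p.2‖ ^ m)⁻¹)
      ((volume : Measure (EuclideanSpace ℝ (Fin n))).prod (volume.restrict (ball (0 : EuclideanSpace ℝ (Fin n)) 1))) := by
    refine AEStronglyMeasurable.mul hf.aestronglyMeasurable.comp_fst ?_
    exact (by fun_prop : Measurable (fun p : (EuclideanSpace ℝ (Fin n)) × (EuclideanSpace ℝ (Fin n)) => (‖p.1 - p.2‖ ^ m)⁻¹)).aestronglyMeasurable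
  have hint : Integrable (fun p : (EuclideanSpace ℝ (Fin n)) × (EuclideanSpace ℝ (Fin n)) => f p.1 * (‖p.1 - p.2‖ ^ m)⁻¹)
      ((volume : Measure (EuclideanSpace ℝ (Fin n))).prod (volume.restrict (ball (0 : EuclideanSpace ℝ (Fin n)) 1))) := by
    rw [integrable_prod_iff hms]
    refine ⟨Filter.Eventually.of_forall fun x => (aux_int_ball n m hm x 0 1).const_mul (f x), ?_⟩
    refine (hf.norm.mul_const M).mono' hms.norm.integral_prod_right' ?_
    refine Filter.Eventually.of_forall fun x => ?_
    have e : ∀ y : EuclideanSpace ℝ (Fin n), ‖f x * (‖x - y‖ ^ m)⁻¹‖ = ‖f x‖ * (‖x - y‖ ^ m)⁻¹ := fun y => by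
      rw [norm_mul, Real.norm_of_nonneg (by positivity : 0 ≤ (‖x - y‖ ^ m)⁻¹)]
    simp only [e, integral_const_mul]
    rw [Real.norm_of_nonneg]
    · exact mul_le_mul_of_nonneg_left (hb x) (norm_nonneg _)
    · exact mul_nonneg (norm_nonneg _) (integral_nonneg fun y => by positivity)
  constructor
  · have := hint.integral_prod_left
    simpa only [integral_const_mul] using this
  · have := integral_integral_swap (f := fun x y => f x * (‖x - y‖ ^ m)⁻¹) hint
    rw [← this]
    simp only [integral_const_mul]

/-- Odd-dimensional case, `n ≥ 5`: iterated use of the lemma gives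
`∫_{B_1}∫ f_E(x)|x-y|^{2-n} dx dy ≤ C ∫_{B_1}∫ f_E(x)|x-y|^{-3} dx dy`
with `C` depending only on `n`. -/
theorem statement13 (n : ℕ) (hn : 5 ≤ n) (hodd : Odd n) :
    ∃ C : ℝ, 0 < C ∧ ∀ E : Set (EuclideanSpace ℝ (Fin n)), HasFinitePerimeter E →
      volume E = volume (ball (0 : EuclideanSpace ℝ (Fin n)) 1) →
      (∫ y in ball (0 : EuclideanSpace ℝ (Fin n)) 1,
          ∫ x, fE E x * ‖x - y‖ ^ (2 - (n : ℝ))) ≤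
        C * ∫ y in ball (0 : EuclideanSpace ℝ (Fin n)) 1,
          ∫ x, fE E x * ‖x - y‖ ^ (-3 : ℝ) := by
  have hnt : Nontrivial (EuclideanSpace ℝ (Fin n)) := by
    have : Nonempty (Fin n) := ⟨⟨0, by omega⟩⟩
    infer_instance
  obtain ⟨c, hc, hlow⟩ := aux_lower n hn
  obtain ⟨L, hL, hlip⟩ := aux_lip n (n - 2) (by omega)
  obtain ⟨M, hM, hbd⟩ := aux_bound n (n - 2) (by omega)
  obtain ⟨e₀, he₀⟩ := exists_norm_eq (EuclideanSpace ℝ (Fin n)) (zero_le_one (α := ℝ))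
  refine ⟨(L + M + 1) / c, by positivity, ?_⟩
  intro E hE hvol
  have hfin : volume E ≠ ⊤ := by rw [hvol]; exact measure_ball_lt_top.ne
  have r1 : ∀ x y : EuclideanSpace ℝ (Fin n),
      ‖x - y‖ ^ (2 - (n : ℝ)) = (‖x - y‖ ^ (n - 2))⁻¹ := fun x y => by
    rw [← Real.rpow_natCast, ← Real.rpow_neg (norm_nonneg _), Nat.cast_sub (by omega)]
    congr 1; push_cast; ring
  have r2 : ∀ x y : EuclideanSpace ℝ (Fin n),
      ‖x - y‖ ^ (-3 : ℝ) = (‖x - y‖ ^ 3)⁻¹ := fun x y => by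
    rw [← Real.rpow_natCast, ← Real.rpow_neg (norm_nonneg _)]
    norm_num
  simp only [r1, r2]
  have hI1 : Integrable ((ball (0 : EuclideanSpace ℝ (Fin n)) 1).indicator
      (1 : EuclideanSpace ℝ (Fin n) → ℝ)) volume :=
    (integrable_indicator_iff measurableSet_ball).2
      (integrableOn_const (C := (1 : ℝ)) measure_ball_lt_top.ne)
  have hI2 : Integrable (E.indicator (1 : EuclideanSpace ℝ (Fin n) → ℝ)) volume :=
    (integrable_indicator_iff hE.1).2 (integrableOn_const (C := (1 : ℝ)) hfin)
  have hf : Integrable (fE E) volume := hI1.sub hI2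
  have hf0 : ∫ x, fE E x = 0 := by
    change ∫ x, ((ball (0 : EuclideanSpace ℝ (Fin n)) 1).indicator
      (1 : EuclideanSpace ℝ (Fin n) → ℝ) x - E.indicator 1 x) = 0
    rw [integral_sub hI1 hI2, integral_indicator_one measurableSet_ball,
      integral_indicator_one hE.1, measureReal_def, measureReal_def, hvol, sub_self]
  obtain ⟨ia, ea⟩ := aux_fubini n (n - 2) (by omega) (fE E) hf
  obtain ⟨ib, eb⟩ := aux_fubini n 3 (by omega) (fE E) hf
  rw [ea, eb]
  set G : EuclideanSpace ℝ (Fin n) → ℝ := fun x =>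
    ∫ y in ball (0 : EuclideanSpace ℝ (Fin n)) 1, (‖x - y‖ ^ (n - 2))⁻¹ with hG
  set H : EuclideanSpace ℝ (Fin n) → ℝ := fun x =>
    ∫ y in ball (0 : EuclideanSpace ℝ (Fin n)) 1, (‖x - y‖ ^ 3)⁻¹ with hH
  have hG0 : ∀ x, 0 ≤ G x := fun x => integral_nonneg fun y => by positivity
  change ∫ x, fE E x * G x ≤ (L + M + 1) / c * ∫ x, fE E x * H x
  have s1 : ∫ x, fE E x * G x = ∫ x, (fE E x * G x - fE E x * G e₀) := by
    rw [integral_sub ia (hf.mul_const _), integral_mul_const, hf0]; ring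
  have s2 : ∫ x, fE E x * H x = ∫ x, (fE E x * H x - fE E x * H e₀) := by
    rw [integral_sub ib (hf.mul_const _), integral_mul_const, hf0]; ring
  rw [s1, s2, ← integral_const_mul]
  refine integral_mono (ia.sub (hf.mul_const _)) ((ib.sub (hf.mul_const _)).const_mul _) fun x => ?_
  change fE E x * G x - fE E x * G e₀ ≤ (L + M + 1) / c * (fE E x * H x - fE E x * H e₀)
  -- direction of `x`
  obtain ⟨e, he, hxe⟩ : ∃ e : EuclideanSpace ℝ (Fin n), ‖e‖ = 1 ∧ x = ‖x‖ • e := by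
    by_cases hx : x = 0
    · exact ⟨e₀, he₀, by simp [hx]⟩
    · exact ⟨‖x‖⁻¹ • x, by rw [norm_smul, norm_inv, norm_norm, inv_mul_cancel₀ (norm_ne_zero_iff.2 hx)], by
        rw [smul_smul, mul_inv_cancel₀ (norm_ne_zero_iff.2 hx), one_smul]⟩
  have hGe : G e₀ = G e := aux_radial n (n - 2) e₀ e (by rw [he, he₀])
  have hHe : H e₀ = H e := aux_radial n 3 e₀ e (by rw [he, he₀])
  rw [hGe, hHe]
  have hxn : ‖x - e‖ = |‖x‖ - 1| := by
    have : x - e = (‖x‖ - 1) • e := by rw [sub_smul, one_smul, ← hxe]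
    rw [this, norm_smul, he, mul_one, Real.norm_eq_abs]
  have hlx : |G x - G e| ≤ L * |‖x‖ - 1| := by rw [← hxn]; exact hlip x e
  have hbx : |G x - G e| ≤ M := by
    have h1 : G x ≤ M := hbd x
    have h2 : G e ≤ M := hbd e
    rw [abs_le]; constructor <;> linarith [hG0 x, hG0 e]
  have hup : |G x - G e| ≤ (L + M + 1) * min 1 |‖x‖ - 1| := by
    have := abs_nonneg (‖x‖ - 1)
    rcases min_choice 1 |‖x‖ - 1| with h | h <;> rw [h] <;> nlinarith
  have hK : 0 ≤ (L + M + 1) / c := by positivity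
  have hKc : (L + M + 1) / c * c = L + M + 1 := div_mul_cancel₀ _ hc.ne'
  by_cases hx1 : x ∈ ball (0 : EuclideanSpace ℝ (Fin n)) 1
  · have hx1' : ‖x‖ < 1 := by simpa using hx1
    have h1 := hlow e he ‖x‖ 1 (norm_nonneg _) hx1'.le le_rfl
    rw [← hxe, one_smul] at h1
    change c * min 1 (1 - ‖x‖) ≤ H x - H e at h1
    rw [abs_sub_comm ‖x‖ 1, abs_of_pos (by linarith : 0 < 1 - ‖x‖)] at hup
    have h2 : G x - G e ≤ (L + M + 1) / c * (H x - H e) := by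
      have := mul_le_mul_of_nonneg_left h1 hK
      rw [← mul_assoc, hKc] at this
      exact (le_abs_self _).trans (hup.trans this)
    by_cases hxE : x ∈ E
    · simp [fE, hx1, hxE]
    · simp [fE, hx1, hxE]; simpa using h2
  · have hx1' : 1 ≤ ‖x‖ := by simpa using hx1
    have h1 := hlow e he 1 ‖x‖ zero_le_one le_rfl hx1'
    rw [← hxe, one_smul] at h1
    change c * min 1 (‖x‖ - 1) ≤ H e - H x at h1
    rw [abs_of_nonneg (by linarith : 0 ≤ ‖x‖ - 1)] at hup
    have h2 : G e - G x ≤ (L + M + 1) / c * (H e - H x) := by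
      have := mul_le_mul_of_nonneg_left h1 hK
      rw [← mul_assoc, hKc] at this
      rw [abs_sub_comm] at hup
      exact (le_abs_self _).trans (hup.trans this)
    have hfx : fE E x = 0 ∨ fE E x = -1 := by
      by_cases hxE : x ∈ E
      · right; simp [fE, hx1, hxE]
      · left; simp [fE, hx1, hxE]
    rcases hfx with h | h
    · rw [h]; simp
    · rw [h]; linarith
end

section
/- Let n ≥ 4 be even and let E ⊂ ℝⁿ be a set of finite perimeter with |E| = |B_1|. Set f_E = χ_{B_1} − χ_E and suppose that r ↦ (1/H^{n−1}(∂B_r)) ∫_{∂B_r} I_{n−2} f_E dH^{n−1} is nonincreasing and nonnegative on (0,∞). Then there is a constant C = C(n) > 0, depending only on n, such that (1/|B_1|) ∫_{B_1} I_{n−2} f_E(y) dy ≤ C · I_{n−1} f_E(0). -/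
open MeasureTheory Metric Set

lemma aux_sphere_ne_zero (m : ℕ) :
    μH[(m : ℝ)] (sphere (0 : EuclideanSpace ℝ (Fin (m+1))) 1) ≠ 0 := by
  set p : EuclideanSpace ℝ (Fin (m+1)) → (Fin m → ℝ) := fun x j => x j.succ with hp
  have hlip : LipschitzWith 1 p := by
    refine LipschitzWith.of_dist_le_mul fun x y => ?_
    rw [NNReal.coe_one, one_mul, dist_pi_le_iff dist_nonneg]
    intro j
    simp only [hp]
    rw [dist_eq_norm, dist_eq_norm]
    exact PiLp.norm_apply_le (x - y) j.succ
  have h1 := hlip.hausdorffMeasure_image_le (d := (m:ℝ)) (by positivity)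
    (sphere (0 : EuclideanSpace ℝ (Fin (m+1))) 1)
  have hop : IsOpen {w : Fin m → ℝ | ∑ j, w j ^ 2 < 1} :=
    isOpen_lt (by fun_prop) continuous_const
  have hne : {w : Fin m → ℝ | ∑ j, w j ^ 2 < 1}.Nonempty := ⟨0, by simp⟩
  have hpos := hop.measure_pos volume hne
  have hsub : {w : Fin m → ℝ | ∑ j, w j ^ 2 < 1} ⊆
      p '' (sphere (0 : EuclideanSpace ℝ (Fin (m+1))) 1) := by
    intro w hw
    have hw' : ∑ j, w j ^ 2 < 1 := hw
    refine ⟨WithLp.toLp 2 (Fin.cons (Real.sqrt (1 - ∑ j, w j ^ 2)) w), ?_, ?_⟩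
    · rw [mem_sphere_zero_iff_norm, EuclideanSpace.norm_eq]
      simp only [Fin.sum_univ_succ, Real.norm_eq_abs, sq_abs, Fin.cons_zero, Fin.cons_succ]
      rw [Real.sq_sqrt (by linarith)]
      simp
    · ext j; simp [hp]
  have hv : (μH[(m : ℝ)] : Measure (Fin m → ℝ)) = volume := by
    have := hausdorffMeasure_pi_real (ι := Fin m)
    simpa using this
  rw [hv] at h1
  simp at h1
  intro h0
  rw [h0] at h1
  exact absurd (hpos.trans_le ((measure_mono hsub).trans h1)) (by simp)

lemma aux_sphere_ne_top (m : ℕ) :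
    μH[(m : ℝ)] (sphere (0 : EuclideanSpace ℝ (Fin (m+1))) 1) ≠ ⊤ := by
  have hv : (μH[(m : ℝ)] : Measure (Fin m → ℝ)) = volume := by
    have := hausdorffMeasure_pi_real (ι := Fin m)
    simpa using this
  set fc : Fin (m+1) → ℝ → (Fin m → ℝ) → EuclideanSpace ℝ (Fin (m+1)) :=
    fun i s w => WithLp.toLp 2 (i.insertNth s w) with hfc
  set P : Fin (m+1) → ℝ → (Fin m → ℝ) → EuclideanSpace ℝ (Fin (m+1)) :=
    fun i s w => ‖fc i s w‖⁻¹ • fc i s w with hP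
  have hfin : ∀ i s, s ≠ 0 → μH[(m : ℝ)] (P i s '' Icc (-1) 1) < ⊤ := by
    intro i s hs
    have hne : ∀ w, fc i s w ≠ 0 := by
      intro w h
      have := congrArg (fun z => z i) h
      simp [hfc] at this
      exact hs this
    have hcf : ContDiff ℝ 1 (fc i s) := by
      rw [contDiff_euclidean]
      intro j
      rcases Fin.eq_self_or_eq_succAbove i j with h | ⟨k, h⟩
      · subst h; simp only [hfc, Fin.insertNth_apply_same]; exact contDiff_const
      · subst h; simp only [hfc, Fin.insertNth_apply_succAbove]; fun_prop
    have hcP : ContDiff ℝ 1 (P i s) := by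
      refine ContDiff.smul (ContDiff.inv (hcf.norm ℝ hne) ?_) hcf
      intro w; simpa using hne w
    obtain ⟨K, hK⟩ := (hcP.locallyLipschitz.locallyLipschitzOn (s := Icc (-1) 1)).exists_lipschitzOnWith_of_compact isCompact_Icc
    refine (hK.hausdorffMeasure_image_le (d := (m:ℝ)) (by positivity)).trans_lt ?_
    rw [hv]
    refine ENNReal.mul_lt_top ?_ isCompact_Icc.measure_lt_top
    exact ENNReal.rpow_lt_top_of_nonneg (by positivity) (by simp)
  have hsub : sphere (0 : EuclideanSpace ℝ (Fin (m+1))) 1 ⊆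
      ⋃ i, (P i 1 '' Icc (-1) 1 ∪ P i (-1) '' Icc (-1) 1) := by
    intro x hx
    have hx1 : ‖x‖ = 1 := by simpa using hx
    obtain ⟨i, -, hi⟩ := Finset.exists_max_image Finset.univ (fun i => |x i|) ⟨0, Finset.mem_univ _⟩
    have hM : 0 < |x i| := by
      by_contra h
      have : x = 0 := by
        ext j
        have := hi j (Finset.mem_univ _)
        have h2 := abs_nonneg (x j)
        simpa using abs_eq_zero.1 (by linarith : |x j| = 0)
      rw [this] at hx1; simp at hx1
    have hmem : (fun j => |x i|⁻¹ * x (i.succAbove j)) ∈ Icc (-1 : Fin m → ℝ) 1 := by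
      rw [Set.mem_Icc, Pi.le_def, Pi.le_def, ← forall_and]
      intro j
      have := hi (i.succAbove j) (Finset.mem_univ _)
      simp only [Pi.neg_apply, Pi.one_apply]
      rw [← abs_le]
      rw [abs_mul, abs_inv, abs_abs, inv_mul_le_iff₀ hM]; simpa using this
    have key : ∀ s, x i = |x i| * s → P i s (fun j => |x i|⁻¹ * x (i.succAbove j)) = x := by
      intro s hs
      have h1 : fc i s (fun j => |x i|⁻¹ * x (i.succAbove j)) = |x i|⁻¹ • x := by
        ext j
        rcases Fin.eq_self_or_eq_succAbove i j with h | ⟨k, h⟩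
        · subst h; simp only [hfc, Fin.insertNth_apply_same, PiLp.smul_apply, smul_eq_mul]
          rw [eq_inv_mul_iff_mul_eq₀ hM.ne', ← hs]
        · subst h; simp only [hfc, Fin.insertNth_apply_succAbove, PiLp.smul_apply, smul_eq_mul]
      simp only [hP, h1, norm_smul, hx1, smul_smul]
      simp [hM.ne']
    refine mem_iUnion.2 ⟨i, ?_⟩
    rcases le_total 0 (x i) with h | h
    · exact Or.inl ⟨_, hmem, key 1 (by rw [abs_of_nonneg h, mul_one])⟩
    · exact Or.inr ⟨_, hmem, key (-1) (by rw [abs_of_nonpos h]; ring)⟩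
  refine ((measure_mono hsub).trans_lt ?_).ne
  refine (measure_iUnion_le _).trans_lt ?_
  rw [tsum_fintype]
  refine ENNReal.sum_lt_top.2 fun i _ => (measure_union_le _ _).trans_lt ?_
  exact ENNReal.add_lt_top.2 ⟨hfin i 1 (by norm_num), hfin i (-1) (by norm_num)⟩

lemma aux_rot {n : ℕ} (x y : EuclideanSpace ℝ (Fin n)) (h : ‖x‖ = ‖y‖) :
    ∃ R : EuclideanSpace ℝ (Fin n) ≃ₗᵢ[ℝ] EuclideanSpace ℝ (Fin n), R x = y :=
  ⟨_, Submodule.reflection_sub h⟩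

lemma aux_mp {n : ℕ} (d : ℝ) (R : EuclideanSpace ℝ (Fin n) ≃ₗᵢ[ℝ] EuclideanSpace ℝ (Fin n)) :
    MeasurePreserving R (μH[d].restrict (sphere (0 : EuclideanSpace ℝ (Fin n)) 1))
      (μH[d].restrict (sphere (0 : EuclideanSpace ℝ (Fin n)) 1)) := by
  have h := (R.toIsometryEquiv.measurePreserving_hausdorffMeasure d).restrict_preimage
    (s := sphere (0 : EuclideanSpace ℝ (Fin n)) 1) isClosed_sphere.measurableSet
  have h2 : R.toIsometryEquiv ⁻¹' (sphere (0 : EuclideanSpace ℝ (Fin n)) 1) = sphere 0 1 := by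
    ext x; simp
  rw [h2] at h
  exact h

open scoped Pointwise in
lemma aux_scale {n : ℕ} (d : ℝ) (hd : 0 ≤ d) (r : ℝ) (hr : 0 < r) :
    μH[d].restrict (sphere (0 : EuclideanSpace ℝ (Fin n)) r) =
      (ENNReal.ofReal (r ^ d)) • Measure.map (fun x => r • x)
        (μH[d].restrict (sphere (0 : EuclideanSpace ℝ (Fin n)) 1)) := by
  ext s hs
  have hm : Measurable (fun x : EuclideanSpace ℝ (Fin n) => r • x) := by fun_prop
  rw [Measure.smul_apply, Measure.map_apply hm hs, Measure.restrict_apply hs,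
    Measure.restrict_apply (hm hs)]
  have : s ∩ sphere (0 : EuclideanSpace ℝ (Fin n)) r =
      r • ((fun x => r • x) ⁻¹' s ∩ sphere (0 : EuclideanSpace ℝ (Fin n)) 1) := by
    ext x
    rw [Set.mem_smul_set_iff_inv_smul_mem₀ hr.ne']
    simp [norm_smul, smul_smul, hr.ne', abs_of_pos hr, inv_mul_eq_iff_eq_mul₀]
  rw [this, Measure.hausdorffMeasure_smul₀ hd hr.ne']
  rw [ENNReal.smul_def, smul_eq_mul, smul_eq_mul]
  congr 1
  rw [← ENNReal.ofReal_coe_nnreal]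
  simp [abs_of_pos hr]

/-- The kernel. -/
noncomputable def kk {n : ℕ} (y ξ : EuclideanSpace ℝ (Fin n)) : ENNReal :=
  ENNReal.ofReal (‖y - ξ‖ ^ (-2 : ℝ))

/-- The potential of a set. -/
noncomputable def UU {n : ℕ} (A : Set (EuclideanSpace ℝ (Fin n))) (y : EuclideanSpace ℝ (Fin n)) :
    ENNReal := ∫⁻ ξ in A, kk y ξ

/-- The unnormalized surface measure. -/
noncomputable def nn (n : ℕ) : Measure (EuclideanSpace ℝ (Fin n)) :=
  μH[(n : ℝ) - 1].restrict (sphere (0 : EuclideanSpace ℝ (Fin n)) 1)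

lemma kk_meas {n : ℕ} : Measurable (fun p : EuclideanSpace ℝ (Fin n) × EuclideanSpace ℝ (Fin n) =>
    kk p.1 p.2) := by
  unfold kk; fun_prop

lemma kk_meas' {n : ℕ} {α : Type*} [MeasurableSpace α] {f g : α → EuclideanSpace ℝ (Fin n)}
    (hf : Measurable f) (hg : Measurable g) : Measurable (fun a => kk (f a) (g a)) :=
  ((hf.sub hg).norm.pow_const (-2 : ℝ)).ennreal_ofReal

lemma UU_meas {n : ℕ} (A : Set (EuclideanSpace ℝ (Fin n))) : Measurable (UU A) :=
  kk_meas.lintegral_prod_right'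

lemma nn_univ (n : ℕ) : nn n univ = μH[(n : ℝ) - 1] (sphere (0 : EuclideanSpace ℝ (Fin n)) 1) := by
  simp [nn]

lemma nn_ne_zero (n : ℕ) (hn : 1 ≤ n) : nn n univ ≠ 0 := by
  obtain ⟨m, rfl⟩ := Nat.exists_eq_add_of_le' hn
  have := aux_sphere_ne_zero m
  rw [nn_univ]
  simpa using this

lemma nn_ne_top (n : ℕ) (hn : 1 ≤ n) : nn n univ ≠ ⊤ := by
  obtain ⟨m, rfl⟩ := Nat.exists_eq_add_of_le' hn
  have := aux_sphere_ne_top m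
  rw [nn_univ]
  simpa using this

lemma nn_ae (n : ℕ) : ∀ᵐ ω ∂(nn n), ‖ω‖ = 1 := by
  unfold nn
  filter_upwards [ae_restrict_mem isClosed_sphere.measurableSet] with ω hω
  simpa using hω

lemma kern_sym {n : ℕ} (y ξ : EuclideanSpace ℝ (Fin n)) :
    ∫⁻ ω, kk y (‖ξ‖ • ω) ∂(nn n) = ∫⁻ ω, kk (‖y‖ • ω) ξ ∂(nn n) := by
  obtain ⟨R, hR⟩ := aux_rot (‖ξ‖ • y) (‖y‖ • ξ) (by simp [norm_smul, mul_comm])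
  have hmp : MeasurePreserving R (nn n) (nn n) := aux_mp _ R
  rw [← hmp.lintegral_comp (f := fun ω => kk (‖y‖ • ω) ξ)
    (kk_meas' (by fun_prop) (by fun_prop))]
  apply lintegral_congr_ae
  filter_upwards [nn_ae n] with ω hω
  unfold kk
  have hi : ‖y‖ * inner ℝ (R ω) ξ = ‖ξ‖ * inner ℝ ω y := by
    rw [← inner_smul_right, ← hR, R.inner_map_map, inner_smul_right]
  have : ‖y - ‖ξ‖ • ω‖ = ‖‖y‖ • R ω - ξ‖ := by
    rw [← sq_eq_sq₀ (norm_nonneg _) (norm_nonneg _), norm_sub_sq_real, norm_sub_sq_real]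
    rw [inner_smul_right, inner_smul_left, norm_smul, norm_smul, R.norm_map, hω,
      real_inner_comm ω y]
    simp only [norm_norm, mul_one, RCLike.conj_to_real]
    rw [hi]
  rw [this]

lemma phi_radial {n : ℕ} (g : ℝ → ENNReal) (hg : Measurable g) (ξ ξ' : EuclideanSpace ℝ (Fin n))
    (h : ‖ξ‖ = ‖ξ'‖) : ∫⁻ y, kk y ξ * g ‖y‖ = ∫⁻ y, kk y ξ' * g ‖y‖ := by
  obtain ⟨R, hR⟩ := aux_rot ξ ξ' h
  rw [← R.measurePreserving.lintegral_comp (f := fun y => kk y ξ' * g ‖y‖)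
    ((kk_meas' (by fun_prop) (by fun_prop)).mul (hg.comp measurable_norm))]
  congr 1; ext y
  rw [R.norm_map]
  unfold kk
  rw [← hR, ← map_sub, R.norm_map]

lemma main_id {n : ℕ} (hn : 1 ≤ n) (g : ℝ → ENNReal) (hg : Measurable g)
    (ξ : EuclideanSpace ℝ (Fin n)) :
    (∫⁻ y, kk y ξ * g ‖y‖) * nn n univ =
      ∫⁻ y : EuclideanSpace ℝ (Fin n), g ‖y‖ * ∫⁻ ω, kk (‖y‖ • ω) ξ ∂(nn n) := by
  have : IsFiniteMeasure (nn n) := ⟨(nn_ne_top n hn).lt_top⟩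
  rw [← lintegral_const]
  have h1 : ∫⁻ ω, (∫⁻ y, kk y ξ * g ‖y‖) ∂(nn n) =
      ∫⁻ ω, (∫⁻ y, kk y (‖ξ‖ • ω) * g ‖y‖) ∂(nn n) := by
    apply lintegral_congr_ae
    filter_upwards [nn_ae n] with ω hω
    exact phi_radial g hg _ _ (by simp [norm_smul, hω])
  rw [h1, lintegral_lintegral_swap]
  · congr 1; ext y
    rw [lintegral_mul_const _ (kk_meas' (by fun_prop) (by fun_prop)), kern_sym, mul_comm]
  · exact ((kk_meas' (by fun_prop) (by fun_prop)).mul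
      (hg.comp (measurable_norm.comp measurable_snd))).aemeasurable

lemma swap_id {n : ℕ} (A : Set (EuclideanSpace ℝ (Fin n))) (g : ℝ → ENNReal) (hg : Measurable g) :
    ∫⁻ y, UU A y * g ‖y‖ = ∫⁻ ξ in A, ∫⁻ y, kk y ξ * g ‖y‖ := by
  rw [lintegral_lintegral_swap]
  · congr 1; ext y
    rw [lintegral_mul_const _ (kk_meas' (by fun_prop) (by fun_prop))]; rfl
  · exact ((kk_meas' (by fun_prop) (by fun_prop)).mul
      (hg.comp (measurable_norm.comp measurable_snd))).aemeasurable

lemma T_id {n : ℕ} (hn : 1 ≤ n) (A : Set (EuclideanSpace ℝ (Fin n))) (g : ℝ → ENNReal)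
    (hg : Measurable g) :
    (∫⁻ y, UU A y * g ‖y‖) * nn n univ =
      ∫⁻ y : EuclideanSpace ℝ (Fin n), g ‖y‖ * ∫⁻ ω, UU A (‖y‖ • ω) ∂(nn n) := by
  have : IsFiniteMeasure (nn n) := ⟨(nn_ne_top n hn).lt_top⟩
  rw [swap_id A g hg, ← lintegral_mul_const' _ _ (nn_ne_top n hn)]
  simp_rw [main_id hn g hg]
  rw [lintegral_lintegral_swap]
  · congr 1; ext y
    rw [lintegral_const_mul, lintegral_lintegral_swap]
    · rfl
    · exact (kk_meas' (by fun_prop) (by fun_prop)).aemeasurable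
    · exact Measurable.lintegral_prod_right'
        (f := fun p : EuclideanSpace ℝ (Fin n) × EuclideanSpace ℝ (Fin n) => kk (‖y‖ • p.2) p.1)
        (kk_meas' (by fun_prop) (by fun_prop))
  · refine ((hg.comp (measurable_norm.comp measurable_snd)).mul ?_).aemeasurable
    exact Measurable.lintegral_prod_right'
        (f := fun p : (EuclideanSpace ℝ (Fin n) × EuclideanSpace ℝ (Fin n)) ×
          EuclideanSpace ℝ (Fin n) => kk (‖p.1.2‖ • p.2) p.1.1)
        (kk_meas' (by fun_prop) (by fun_prop))

lemma compare {n : ℕ} (hn : 1 ≤ n) (A B : Set (EuclideanSpace ℝ (Fin n))) (g : ℝ → ENNReal)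
    (hg : Measurable g)
    (h : ∀ r : ℝ, 0 < r → ∫⁻ ω, UU A (r • ω) ∂(nn n) ≤ ∫⁻ ω, UU B (r • ω) ∂(nn n)) :
    ∫⁻ y, UU A y * g ‖y‖ ≤ ∫⁻ y, UU B y * g ‖y‖ := by
  have : Nonempty (Fin n) := ⟨⟨0, hn⟩⟩
  rw [← ENNReal.mul_le_mul_iff_left (nn_ne_zero n hn) (nn_ne_top n hn), T_id hn A g hg,
    T_id hn B g hg]
  apply lintegral_mono_ae
  have : ∀ᵐ y : EuclideanSpace ℝ (Fin n), y ≠ 0 := by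
    simp [ae_iff]
  filter_upwards [this] with y hy
  refine mul_le_mul_right ?_ _
  exact h _ (norm_pos_iff.2 hy)

lemma ball_fin {n : ℕ} (hn : 1 ≤ n) (a R : ℝ) (ha : a < n) :
    ∫⁻ z in ball (0 : EuclideanSpace ℝ (Fin n)) R, ENNReal.ofReal (‖z‖ ^ (-a)) < ⊤ := by
  have := integrableOn_ball_of_norm_le_rpow (E := EuclideanSpace ℝ (Fin n)) (μ := volume)
    (f := fun z => ‖z‖ ^ (-a)) (C := 1) (α := a) (r := R) (by simpa using hn) (by simpa using ha)
    (by
      refine Filter.Eventually.of_forall fun x => ?_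
      rw [one_mul, Real.norm_of_nonneg (by positivity)])
    (by
      have : Measurable (fun z : EuclideanSpace ℝ (Fin n) => ‖z‖ ^ (-a)) := by fun_prop
      exact this.aestronglyMeasurable)
  exact this.setLIntegral_lt_top

lemma shift_fin {n : ℕ} (h : EuclideanSpace ℝ (Fin n) → ENNReal) (e : EuclideanSpace ℝ (Fin n)) :
    ∫⁻ y, h (y - e) = ∫⁻ y, h y := lintegral_sub_right_eq_self h e

lemma UU_fin {n : ℕ} (hn : 3 ≤ n) (A : Set (EuclideanSpace ℝ (Fin n)))
    (hA : volume A ≠ ⊤) :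
    ∃ M : ENNReal, M ≠ ⊤ ∧ ∀ y, UU A y ≤ M := by
  have hn' : (3 : ℝ) ≤ n := by exact_mod_cast hn
  refine ⟨(∫⁻ z in ball (0 : EuclideanSpace ℝ (Fin n)) 1, ENNReal.ofReal (‖z‖ ^ (-2 : ℝ))) + volume A,
    ENNReal.add_ne_top.2 ⟨(ball_fin (by omega) 2 1 (by linarith)).ne, hA⟩, fun y => ?_⟩
  set h : EuclideanSpace ℝ (Fin n) → ENNReal :=
    (ball (0 : EuclideanSpace ℝ (Fin n)) 1).indicator (fun z => ENNReal.ofReal (‖z‖ ^ (-2 : ℝ))) with hh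
  have hmeas : Measurable h := by
    refine Measurable.indicator ?_ measurableSet_ball
    fun_prop
  have h1 : ∀ ξ, kk y ξ ≤ h (ξ - y) + 1 := by
    intro ξ
    unfold kk
    rw [norm_sub_rev]
    by_cases hx : ξ - y ∈ ball (0 : EuclideanSpace ℝ (Fin n)) 1
    · rw [hh, indicator_of_mem hx]; exact le_self_add
    · rw [hh, indicator_of_notMem hx, zero_add, ← ENNReal.ofReal_one]
      apply ENNReal.ofReal_le_ofReal
      have : 1 ≤ ‖ξ - y‖ := by simpa using hx
      exact Real.rpow_le_one_of_one_le_of_nonpos this (by norm_num)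
  calc UU A y ≤ ∫⁻ ξ in A, (h (ξ - y) + 1) := lintegral_mono fun ξ => h1 ξ
    _ = (∫⁻ ξ in A, h (ξ - y)) + volume A := by
        rw [lintegral_add_right _ measurable_const]; simp
    _ ≤ (∫⁻ ξ, h (ξ - y)) + volume A := by
        gcongr; exact Measure.restrict_le_self
    _ = _ := by
        rw [shift_fin h y, hh, lintegral_indicator measurableSet_ball]

lemma young_aux (n : ℕ) (a b : ℝ) (ha : 1/2 ≤ a) (hab : a ≤ b) (p q : ℝ)
    (hq : 0 ≤ q) (hpq : p + q = n + 1) :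
    a ^ (-p) * b ^ (-q) ≤ 3 ^ ((n : ℝ) + 1) * (1 + a) ^ (-((n : ℝ) + 1)) := by
  have ha0 : 0 < a := by linarith
  have h1 : b ^ (-q) ≤ a ^ (-q) := Real.rpow_le_rpow_of_nonpos ha0 hab (by linarith)
  calc a ^ (-p) * b ^ (-q) ≤ a ^ (-p) * a ^ (-q) := by gcongr
    _ = a ^ (-((n : ℝ) + 1)) := by rw [← Real.rpow_add ha0, ← hpq]; congr 1; ring
    _ ≤ ((1 + a) / 3) ^ (-((n : ℝ) + 1)) :=
        Real.rpow_le_rpow_of_nonpos (by positivity) (by linarith) (by linarith)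
    _ = _ := by
        rw [Real.div_rpow (by positivity) (by norm_num), Real.rpow_neg (by norm_num : (0:ℝ) ≤ 3)]
        field_simp

lemma J_fin {n : ℕ} (hn : 3 ≤ n) (e : EuclideanSpace ℝ (Fin n)) (he : ‖e‖ = 1) :
    ∫⁻ y, kk y e * ENNReal.ofReal (‖y‖ ^ (1 - (n : ℝ))) ≠ ⊤ := by
  have hn' : (3 : ℝ) ≤ n := by exact_mod_cast hn
  set h1 : EuclideanSpace ℝ (Fin n) → ENNReal :=
    (ball (0 : EuclideanSpace ℝ (Fin n)) (1/2)).indicator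
      (fun z => ENNReal.ofReal (‖z‖ ^ (-2 : ℝ))) with hh1
  set h2 : EuclideanSpace ℝ (Fin n) → ENNReal :=
    (ball (0 : EuclideanSpace ℝ (Fin n)) (1/2)).indicator
      (fun z => ENNReal.ofReal (‖z‖ ^ (-((n : ℝ) - 1)))) with hh2
  set h3 : EuclideanSpace ℝ (Fin n) → ENNReal :=
      (fun z => ENNReal.ofReal ((1 + ‖z‖) ^ (-((n : ℝ) + 1)))) with hh3
  have m1 : Measurable h1 := Measurable.indicator (by fun_prop) measurableSet_ball
  have m2 : Measurable h2 := Measurable.indicator (by fun_prop) measurableSet_ball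
  have m3 : Measurable h3 := by fun_prop
  have f1 : ∫⁻ z, h1 z < ⊤ := by
    rw [hh1, lintegral_indicator measurableSet_ball]
    exact ball_fin (by omega) 2 _ (by linarith)
  have f2 : ∫⁻ z, h2 z < ⊤ := by
    rw [hh2, lintegral_indicator measurableSet_ball]
    exact ball_fin (by omega) _ _ (by linarith)
  have f3 : ∫⁻ z, h3 z < ⊤ := finite_integral_one_add_norm (by simp)
  set c1 : ENNReal := ENNReal.ofReal ((1/2 : ℝ) ^ (1 - (n:ℝ))) with hc1
  set c2 : ENNReal := ENNReal.ofReal ((1/2 : ℝ) ^ (-2 : ℝ)) with hc2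
  set c3 : ENNReal := ENNReal.ofReal (3 ^ ((n : ℝ) + 1)) with hc3
  have key : ∀ y, kk y e * ENNReal.ofReal (‖y‖ ^ (1 - (n : ℝ))) ≤
      (c1 * h1 (y - e) + c2 * h2 y) + (c3 * h3 (y - e) + c3 * h3 y) := by
    intro y
    have htri : 1 ≤ ‖y‖ + ‖y - e‖ := by
      rw [← he]
      calc ‖e‖ = ‖y - (y - e)‖ := by congr 1; abel
        _ ≤ _ := norm_sub_le _ _
    by_cases ha : ‖y - e‖ < 1/2
    · have : kk y e * ENNReal.ofReal (‖y‖ ^ (1 - (n : ℝ))) ≤ c1 * h1 (y - e) := by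
        rw [hh1, indicator_of_mem (by simpa using ha), mul_comm]
        unfold kk
        gcongr
        refine ENNReal.ofReal_le_ofReal ?_
        exact Real.rpow_le_rpow_of_nonpos (by norm_num) (by linarith) (by linarith)
      exact this.trans (le_self_add.trans le_self_add)
    by_cases hb : ‖y‖ < 1/2
    · have : kk y e * ENNReal.ofReal (‖y‖ ^ (1 - (n : ℝ))) ≤ c2 * h2 y := by
        rw [hh2, indicator_of_mem (by simpa using hb), neg_sub]
        unfold kk
        gcongr
        refine ENNReal.ofReal_le_ofReal ?_
        exact Real.rpow_le_rpow_of_nonpos (by norm_num) (by linarith) (by linarith)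
      exact this.trans (le_add_self.trans le_self_add)
    push Not at ha hb
    rcases le_total ‖y - e‖ ‖y‖ with hab | hab
    · have : kk y e * ENNReal.ofReal (‖y‖ ^ (1 - (n : ℝ))) ≤ c3 * h3 (y - e) := by
        unfold kk
        rw [hh3, ← ENNReal.ofReal_mul (by positivity), hc3, ← ENNReal.ofReal_mul (by positivity)]
        refine ENNReal.ofReal_le_ofReal ?_
        have := young_aux n _ _ ha hab 2 (n - 1) (by linarith) (by ring)
        rwa [neg_sub] at this
      exact this.trans (le_self_add.trans le_add_self)
    · have : kk y e * ENNReal.ofReal (‖y‖ ^ (1 - (n : ℝ))) ≤ c3 * h3 y := by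
        unfold kk
        rw [hh3, ← ENNReal.ofReal_mul (by positivity), hc3, ← ENNReal.ofReal_mul (by positivity)]
        refine ENNReal.ofReal_le_ofReal ?_
        have := young_aux n _ _ hb hab (n - 1) 2 (by norm_num) (by ring)
        rw [neg_sub] at this
        rwa [mul_comm]
      exact this.trans (le_add_self.trans le_add_self)
  refine ((lintegral_mono key).trans_lt ?_).ne
  have m1' : Measurable (fun y => c1 * h1 (y - e)) :=
    (m1.comp (measurable_id.sub_const e)).const_mul _
  have m3' : Measurable (fun y => c3 * h3 (y - e)) :=
    (m3.comp (measurable_id.sub_const e)).const_mul _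
  have m12 : Measurable (fun y => c1 * h1 (y - e) + c2 * h2 y) := m1'.add (m2.const_mul _)
  have n1 : Measurable (fun y => h1 (y - e)) := m1.comp (measurable_id.sub_const e)
  have n3 : Measurable (fun y => h3 (y - e)) := m3.comp (measurable_id.sub_const e)
  rw [lintegral_add_left m12, lintegral_add_left m1',
    lintegral_add_left m3', lintegral_const_mul _ n1,
    lintegral_const_mul _ m2, lintegral_const_mul _ n3,
    lintegral_const_mul _ m3, shift_fin h1, shift_fin h3]
  simp only [ENNReal.add_lt_top]
  exact ⟨⟨ENNReal.mul_lt_top ENNReal.ofReal_lt_top f1, ENNReal.mul_lt_top ENNReal.ofReal_lt_top f2⟩,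
    ENNReal.mul_lt_top ENNReal.ofReal_lt_top f3, ENNReal.mul_lt_top ENNReal.ofReal_lt_top f3⟩

lemma J_meas {n : ℕ} (e : EuclideanSpace ℝ (Fin n)) :
    Measurable (fun y => kk y e * ENNReal.ofReal (‖y‖ ^ (1 - (n : ℝ)))) :=
  (kk_meas' measurable_id measurable_const).mul (by fun_prop)

lemma J_scale {n : ℕ} (e : EuclideanSpace ℝ (Fin n)) (s : ℝ) (hs : 0 < s) :
    ∫⁻ y, kk y (s • e) * ENNReal.ofReal (‖y‖ ^ (1 - (n : ℝ))) =
      (∫⁻ y, kk y e * ENNReal.ofReal (‖y‖ ^ (1 - (n : ℝ)))) * ENNReal.ofReal (s ^ (-1 : ℝ)) := by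
  have hm : Measurable (fun x : EuclideanSpace ℝ (Fin n) => s • x) := by fun_prop
  have hmap := Measure.map_addHaar_smul (volume : Measure (EuclideanSpace ℝ (Fin n))) hs.ne'
  set F : EuclideanSpace ℝ (Fin n) → ENNReal :=
    fun y => kk y (s • e) * ENNReal.ofReal (‖y‖ ^ (1 - (n : ℝ))) with hF
  have hFm : Measurable F := (kk_meas' measurable_id measurable_const).mul (by fun_prop)
  have h1 : ∫⁻ y, F (s • y) = ENNReal.ofReal (s ^ (-(n : ℝ))) * ∫⁻ y, F y := by
    rw [← lintegral_map hFm hm, hmap, lintegral_smul_measure, smul_eq_mul]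
    congr 2
    rw [finrank_euclideanSpace, Fintype.card_fin, abs_of_pos (by positivity), Real.rpow_neg hs.le,
      Real.rpow_natCast]
  have h2 : ∀ y, F (s • y) = ENNReal.ofReal (s ^ (-1 - (n : ℝ))) *
      (kk y e * ENNReal.ofReal (‖y‖ ^ (1 - (n : ℝ)))) := by
    intro y
    simp only [hF, kk]
    rw [← smul_sub, norm_smul, norm_smul, Real.norm_of_nonneg hs.le,
      Real.mul_rpow hs.le (norm_nonneg _), Real.mul_rpow hs.le (norm_nonneg _),
      ← ENNReal.ofReal_mul (by positivity), ← ENNReal.ofReal_mul (by positivity),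
      ← ENNReal.ofReal_mul (by positivity)]
    congr 1
    rw [show (-1 - (n : ℝ)) = -2 + (1 - n) by ring, Real.rpow_add hs]
    ring
  simp_rw [h2] at h1
  rw [lintegral_const_mul _ (J_meas e)] at h1
  have h3 : ∫⁻ y, F y = ENNReal.ofReal (s ^ (n : ℝ)) *
      (ENNReal.ofReal (s ^ (-(n : ℝ))) * ∫⁻ y, F y) := by
    rw [← mul_assoc, ← ENNReal.ofReal_mul (by positivity), ← Real.rpow_add hs]
    simp
  rw [h3, ← h1, ← mul_assoc, ← ENNReal.ofReal_mul (by positivity), ← Real.rpow_add hs, mul_comm]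
  congr 3
  ring

lemma J_pos {n : ℕ} (hn : 3 ≤ n) (e : EuclideanSpace ℝ (Fin n)) :
    ∫⁻ y, kk y e * ENNReal.ofReal (‖y‖ ^ (1 - (n : ℝ))) ≠ 0 := by
  have : Nonempty (Fin n) := ⟨⟨0, by omega⟩⟩
  intro h
  rw [lintegral_eq_zero_iff (J_meas e)] at h
  have h1 : ∀ᵐ y : EuclideanSpace ℝ (Fin n), y ≠ 0 := by simp [ae_iff]
  have h2 : ∀ᵐ y : EuclideanSpace ℝ (Fin n), y ≠ e := by simp [ae_iff]
  have h3 : ∀ᵐ y : EuclideanSpace ℝ (Fin n), False := by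
    filter_upwards [h, h1, h2] with y hy hy1 hy2
    have p1 : 0 < ‖y‖ := norm_pos_iff.2 hy1
    have p2 : 0 < ‖y - e‖ := norm_pos_iff.2 (sub_ne_zero.2 hy2)
    simp only [kk, Pi.zero_apply, mul_eq_zero, ENNReal.ofReal_eq_zero] at hy
    have q1 := Real.rpow_pos_of_pos p1 (1 - (n : ℝ))
    have q2 := Real.rpow_pos_of_pos p2 (-2 : ℝ)
    rcases hy with hy | hy <;> linarith
  simp [ae_iff] at h3

lemma J_lem {n : ℕ} (hn : 3 ≤ n) : ∃ c : ℝ, 0 < c ∧ ∀ ξ : EuclideanSpace ℝ (Fin n), ξ ≠ 0 →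
    ∫⁻ y, kk y ξ * ENNReal.ofReal (‖y‖ ^ (1 - (n : ℝ))) =
      ENNReal.ofReal c * ENNReal.ofReal (‖ξ‖ ^ (-1 : ℝ)) := by
  set e : EuclideanSpace ℝ (Fin n) := EuclideanSpace.single ⟨0, by omega⟩ 1 with he
  have he1 : ‖e‖ = 1 := by simp [he]
  refine ⟨(∫⁻ y, kk y e * ENNReal.ofReal (‖y‖ ^ (1 - (n : ℝ)))).toReal,
    ENNReal.toReal_pos (J_pos hn e) (J_fin hn e he1), fun ξ hξ => ?_⟩
  rw [ENNReal.ofReal_toReal (J_fin hn e he1), ← J_scale e _ (norm_pos_iff.2 hξ)]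
  exact phi_radial (fun t => ENNReal.ofReal (t ^ (1 - (n : ℝ)))) (by fun_prop) _ _
    (by simp [norm_smul, he1])

lemma ind_int {n : ℕ} (A : Set (EuclideanSpace ℝ (Fin n))) (hA : MeasurableSet A)
    (w : EuclideanSpace ℝ (Fin n) → ℝ) (hw : Measurable w) (h0 : ∀ x, 0 ≤ w x)
    (hf : ∫⁻ ξ in A, ENNReal.ofReal (w ξ) ≠ ⊤) :
    Integrable (fun ξ => A.indicator 1 ξ * w ξ) ∧
      ∫ ξ, A.indicator 1 ξ * w ξ = (∫⁻ ξ in A, ENNReal.ofReal (w ξ)).toReal := by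
  have heq : (fun ξ => A.indicator 1 ξ * w ξ) = A.indicator w := by
    ext ξ
    by_cases h : ξ ∈ A <;> simp [h]
  rw [heq, integrable_indicator_iff hA]
  refine ⟨(lintegral_ofReal_ne_top_iff_integrable hw.aestronglyMeasurable
    (Filter.Eventually.of_forall h0)).1 hf, ?_⟩
  rw [integral_indicator hA, integral_eq_lintegral_of_nonneg_ae (Filter.Eventually.of_forall h0)
    hw.aestronglyMeasurable]

lemma fE_int {n : ℕ} (A : Set (EuclideanSpace ℝ (Fin n))) (hA : MeasurableSet A)
    (w : EuclideanSpace ℝ (Fin n) → ℝ) (hw : Measurable w) (h0 : ∀ x, 0 ≤ w x)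
    (hf : ∫⁻ ξ in A, ENNReal.ofReal (w ξ) ≠ ⊤)
    (hf' : ∫⁻ ξ in ball (0 : EuclideanSpace ℝ (Fin n)) 1, ENNReal.ofReal (w ξ) ≠ ⊤) :
    ∫ ξ, fE A ξ * w ξ = (∫⁻ ξ in ball (0 : EuclideanSpace ℝ (Fin n)) 1, ENNReal.ofReal (w ξ)).toReal -
      (∫⁻ ξ in A, ENNReal.ofReal (w ξ)).toReal := by
  obtain ⟨i1, e1⟩ := ind_int A hA w hw h0 hf
  obtain ⟨i2, e2⟩ := ind_int (ball (0 : EuclideanSpace ℝ (Fin n)) 1) measurableSet_ball w hw h0 hf'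
  rw [← e1, ← e2, ← integral_sub i2 i1]
  congr 1; ext ξ
  rw [fE, sub_mul]

lemma rieszConst_pos (n : ℕ) (α : ℝ) (h : 0 < α) (h' : α < n) : 0 < rieszConst n α := by
  unfold rieszConst
  have h1 : 0 < Real.Gamma (α / 2) := Real.Gamma_pos_of_pos (by linarith)
  have h2 : 0 < Real.Gamma (((n : ℝ) - α) / 2) := Real.Gamma_pos_of_pos (by linarith)
  have := Real.pi_pos
  positivity

lemma m_fin {n : ℕ} (hn : 3 ≤ n) (A : Set (EuclideanSpace ℝ (Fin n))) (hA : volume A ≠ ⊤) :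
    ∫⁻ ξ in A, ENNReal.ofReal (‖ξ‖ ^ (-1 : ℝ)) ≠ ⊤ := by
  obtain ⟨M, hM, hU⟩ := UU_fin hn A hA
  have h1 : ∀ ξ : EuclideanSpace ℝ (Fin n), ENNReal.ofReal (‖ξ‖ ^ (-1 : ℝ)) ≤ kk 0 ξ + 1 := by
    intro ξ
    unfold kk
    rw [zero_sub, norm_neg, ← ENNReal.ofReal_one, ← ENNReal.ofReal_add (by positivity) zero_le_one]
    apply ENNReal.ofReal_le_ofReal
    rw [show (-2 : ℝ) = -1 * (2 : ℕ) by norm_num, Real.rpow_mul_natCast (norm_nonneg _)]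
    nlinarith [sq_nonneg (‖ξ‖ ^ (-1 : ℝ) - 1)]
  refine ((lintegral_mono h1).trans_lt ?_).ne
  rw [lintegral_add_right _ measurable_const]
  refine ENNReal.add_lt_top.2 ⟨(hU 0).trans_lt hM.lt_top, ?_⟩
  simpa using hA.lt_top

/-- The weight. -/
noncomputable def gw (n : ℕ) (t : ℝ) : ENNReal :=
  if t < 1 then ENNReal.ofReal (t ^ (1 - (n : ℝ))) - 1 else ENNReal.ofReal (t ^ (1 - (n : ℝ)))

lemma gw_meas (n : ℕ) : Measurable (gw n) := by
  unfold gw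
  refine Measurable.ite measurableSet_Iio ?_ ?_
  · exact Measurable.sub_const (by fun_prop) _
  · fun_prop

lemma split_id {n : ℕ} (hn : 3 ≤ n) (c : ℝ)
    (hc : ∀ ξ : EuclideanSpace ℝ (Fin n), ξ ≠ 0 →
    ∫⁻ y, kk y ξ * ENNReal.ofReal (‖y‖ ^ (1 - (n : ℝ))) =
      ENNReal.ofReal c * ENNReal.ofReal (‖ξ‖ ^ (-1 : ℝ)))
    (A : Set (EuclideanSpace ℝ (Fin n))) :
    (∫⁻ y, UU A y * gw n ‖y‖) + ∫⁻ y in ball (0 : EuclideanSpace ℝ (Fin n)) 1, UU A y =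
      ENNReal.ofReal c * ∫⁻ ξ in A, ENNReal.ofReal (‖ξ‖ ^ (-1 : ℝ)) := by
  have : Nonempty (Fin n) := ⟨⟨0, by omega⟩⟩
  have hn' : (3 : ℝ) ≤ n := by exact_mod_cast hn
  have hne : ∀ᵐ y : EuclideanSpace ℝ (Fin n), y ≠ 0 := by simp [ae_iff]
  rw [← lintegral_indicator measurableSet_ball, ← lintegral_add_right _
    ((UU_meas A).indicator measurableSet_ball), ← lintegral_const_mul _ (by fun_prop)]
  have h1 : ∫⁻ ξ in A, ENNReal.ofReal c * ENNReal.ofReal (‖ξ‖ ^ (-1 : ℝ)) =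
      ∫⁻ ξ in A, ∫⁻ y, kk y ξ * ENNReal.ofReal (‖y‖ ^ (1 - (n : ℝ))) := by
    apply lintegral_congr_ae
    filter_upwards [ae_restrict_of_ae hne] with ξ hξ
    rw [hc ξ hξ]
  rw [h1, ← swap_id A (fun t => ENNReal.ofReal (t ^ (1 - (n : ℝ)))) (by fun_prop)]
  apply lintegral_congr_ae
  filter_upwards [hne] with y hy
  have hy' := norm_pos_iff.2 hy
  by_cases h : ‖y‖ < 1
  · rw [indicator_of_mem (by simpa using h), gw, if_pos h]
    have h2 : 1 ≤ ENNReal.ofReal (‖y‖ ^ (1 - (n : ℝ))) := by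
      rw [← ENNReal.ofReal_one]
      exact ENNReal.ofReal_le_ofReal
        (Real.one_le_rpow_of_pos_of_le_one_of_nonpos hy' h.le (by linarith))
    nth_rewrite 2 [← mul_one (UU A y)]
    rw [← mul_add, tsub_add_cancel_of_le h2]
  · rw [indicator_of_notMem (by simpa using h), gw, if_neg h, add_zero]

lemma riesz_eq {n : ℕ} (hn : 3 ≤ n) (A : Set (EuclideanSpace ℝ (Fin n))) (hA : MeasurableSet A)
    (hf : volume A ≠ ⊤) (y : EuclideanSpace ℝ (Fin n)) :
    rieszPot ((n : ℝ) - 2) (fE A) y = rieszConst n ((n : ℝ) - 2) *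
      ((UU (ball 0 1) y).toReal - (UU A y).toReal) := by
  obtain ⟨M, hM, hU⟩ := UU_fin hn A hf
  obtain ⟨M', hM', hU'⟩ := UU_fin hn (ball 0 1) measure_ball_lt_top.ne
  unfold rieszPot
  rw [show ((n : ℝ) - 2 - n) = -2 by ring]
  rw [fE_int A hA _ (by fun_prop) (fun _ => by positivity)]
  · rfl
  · exact ((hU y).trans_lt hM.lt_top).ne
  · exact ((hU' y).trans_lt hM'.lt_top).ne

lemma sph_cmp {n : ℕ} (hn : 3 ≤ n) (A : Set (EuclideanSpace ℝ (Fin n))) (hA : MeasurableSet A)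
    (hf : volume A ≠ ⊤) (r : ℝ) (hr : 0 < r)
    (h : 0 ≤ sphAvg (rieszPot ((n : ℝ) - 2) (fE A)) r) :
    ∫⁻ ω, UU A (r • ω) ∂(nn n) ≤ ∫⁻ ω, UU (ball 0 1) (r • ω) ∂(nn n) := by
  have hn' : (3 : ℝ) ≤ n := by exact_mod_cast hn
  have : IsFiniteMeasure (nn n) := ⟨(nn_ne_top n (by omega)).lt_top⟩
  have hσ := rieszConst_pos n ((n : ℝ) - 2) (by linarith) (by linarith)
  obtain ⟨M, hM, hU⟩ := UU_fin hn A hf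
  obtain ⟨M', hM', hU'⟩ := UU_fin hn (ball 0 1) measure_ball_lt_top.ne
  have hsc := aux_scale (n := n) ((n : ℝ) - 1) (by linarith) r hr
  have hm : Measurable (fun x : EuclideanSpace ℝ (Fin n) => r • x) := by fun_prop
  have hH : μH[(n : ℝ) - 1] (sphere (0 : EuclideanSpace ℝ (Fin n)) r) =
      ENNReal.ofReal (r ^ ((n : ℝ) - 1)) * nn n univ := by
    have := congrArg (fun μ => μ univ) hsc
    simp only [Measure.smul_apply, Measure.restrict_apply_univ] at this
    rw [this, Measure.map_apply hm MeasurableSet.univ]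
    rfl
  have hpos : 0 < (μH[(n : ℝ) - 1] (sphere (0 : EuclideanSpace ℝ (Fin n)) r)).toReal := by
    rw [hH]
    refine ENNReal.toReal_pos (mul_ne_zero ?_ (nn_ne_zero n (by omega)))
      (ENNReal.mul_ne_top ENNReal.ofReal_ne_top (nn_ne_top n (by omega)))
    exact (ENNReal.ofReal_pos.2 (Real.rpow_pos_of_pos hr _)).ne'
  unfold sphAvg at h
  have h1 := nonneg_of_mul_nonneg_right h (inv_pos.2 hpos)
  simp_rw [riesz_eq hn A hA hf] at h1
  have hmA := UU_meas A
  have hmB := UU_meas (ball (0 : EuclideanSpace ℝ (Fin n)) 1)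
  rw [hsc, integral_smul_measure, integral_map hm.aemeasurable (by
    exact (((hmB.ennreal_toReal.sub hmA.ennreal_toReal).const_mul _).aestronglyMeasurable)),
    integral_const_mul, smul_eq_mul] at h1
  have hrp : 0 < (ENNReal.ofReal (r ^ ((n : ℝ) - 1))).toReal := by
    rw [ENNReal.toReal_ofReal (by positivity)]; positivity
  have h2 := nonneg_of_mul_nonneg_right (nonneg_of_mul_nonneg_right h1 hrp) hσ
  have hmA' : Measurable (fun ω => UU A (r • ω)) := hmA.comp hm
  have hmB' : Measurable (fun ω => UU (ball (0 : EuclideanSpace ℝ (Fin n)) 1) (r • ω)) := hmB.comp hm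
  have fA : ∫⁻ ω, UU A (r • ω) ∂(nn n) ≠ ⊤ :=
    ((lintegral_mono fun ω => hU _).trans_lt (by
      rw [lintegral_const]; exact ENNReal.mul_lt_top hM.lt_top (measure_lt_top _ _))).ne
  have fB : ∫⁻ ω, UU (ball (0 : EuclideanSpace ℝ (Fin n)) 1) (r • ω) ∂(nn n) ≠ ⊤ :=
    ((lintegral_mono fun ω => hU' _).trans_lt (by
      rw [lintegral_const]; exact ENNReal.mul_lt_top hM'.lt_top (measure_lt_top _ _))).ne
  change 0 ≤ ∫ ω, ((UU (ball 0 1) (r • ω)).toReal - (UU A (r • ω)).toReal) ∂(nn n) at h2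
  rw [integral_sub (integrable_toReal_of_lintegral_ne_top hmB'.aemeasurable fB)
    (integrable_toReal_of_lintegral_ne_top hmA'.aemeasurable fA),
    integral_toReal hmA'.aemeasurable (Filter.Eventually.of_forall fun ω => (hU _).trans_lt hM.lt_top),
    integral_toReal hmB'.aemeasurable (Filter.Eventually.of_forall fun ω => (hU' _).trans_lt hM'.lt_top)] at h2
  rw [← ENNReal.toReal_le_toReal fA fB]
  linarith

lemma final {n : ℕ} (hn : 3 ≤ n) (c : ℝ) (hc0 : 0 < c)
    (hc : ∀ ξ : EuclideanSpace ℝ (Fin n), ξ ≠ 0 →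
    ∫⁻ y, kk y ξ * ENNReal.ofReal (‖y‖ ^ (1 - (n : ℝ))) =
      ENNReal.ofReal c * ENNReal.ofReal (‖ξ‖ ^ (-1 : ℝ)))
    (A : Set (EuclideanSpace ℝ (Fin n))) (hA : MeasurableSet A)
    (hf : volume A ≠ ⊤)
    (h : ∀ r ∈ Set.Ioi (0 : ℝ), 0 ≤ sphAvg (rieszPot ((n : ℝ) - 2) (fE A)) r) :
    ∫ y in ball (0 : EuclideanSpace ℝ (Fin n)) 1, rieszPot ((n : ℝ) - 2) (fE A) y ≤
      rieszConst n ((n : ℝ) - 2) * (c * ∫ ξ, fE A ξ * ‖ξ‖ ^ (-1 : ℝ)) := by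
  have hn' : (3 : ℝ) ≤ n := by exact_mod_cast hn
  have hσ := rieszConst_pos n ((n : ℝ) - 2) (by linarith) (by linarith)
  obtain ⟨M, hM, hU⟩ := UU_fin hn A hf
  obtain ⟨M', hM', hU'⟩ := UU_fin hn (ball 0 1) measure_ball_lt_top.ne
  have hcmp := compare (by omega) A (ball 0 1) (gw n) (gw_meas n)
    (fun r hr => sph_cmp hn A hA hf r hr (h r hr))
  have sA := split_id hn c hc A
  have sB := split_id hn c hc (ball 0 1)
  have mA := m_fin hn A hf
  have mB := m_fin hn (ball (0 : EuclideanSpace ℝ (Fin n)) 1) measure_ball_lt_top.ne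
  have hbf : volume (ball (0 : EuclideanSpace ℝ (Fin n)) 1) < ⊤ := measure_ball_lt_top
  simp_rw [riesz_eq hn A hA hf]
  rw [fE_int A hA _ (by fun_prop) (fun _ => by positivity) mA mB, integral_const_mul]
  refine mul_le_mul_of_nonneg_left ?_ hσ.le
  have hmA := UU_meas A
  have hmB := UU_meas (ball (0 : EuclideanSpace ℝ (Fin n)) 1)
  have bA : ∫⁻ y in ball (0 : EuclideanSpace ℝ (Fin n)) 1, UU A y ≠ ⊤ :=
    ((lintegral_mono fun ω => hU _).trans_lt (by
      rw [lintegral_const]; exact ENNReal.mul_lt_top hM.lt_top (by simpa using hbf))).ne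
  have bB : ∫⁻ y in ball (0 : EuclideanSpace ℝ (Fin n)) 1, UU (ball 0 1) y ≠ ⊤ :=
    ((lintegral_mono fun ω => hU' _).trans_lt (by
      rw [lintegral_const]; exact ENNReal.mul_lt_top hM'.lt_top (by simpa using hbf))).ne
  rw [integral_sub (integrable_toReal_of_lintegral_ne_top hmB.aemeasurable bB)
    (integrable_toReal_of_lintegral_ne_top hmA.aemeasurable bA),
    integral_toReal hmA.aemeasurable (Filter.Eventually.of_forall fun ω => (hU _).trans_lt hM.lt_top),
    integral_toReal hmB.aemeasurable (Filter.Eventually.of_forall fun ω => (hU' _).trans_lt hM'.lt_top)]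
  have aA : ∫⁻ y, UU A y * gw n ‖y‖ ≠ ⊤ := by
    refine (le_self_add.trans_lt (sA.le.trans_lt ?_)).ne
    exact ENNReal.mul_lt_top ENNReal.ofReal_lt_top mA.lt_top
  have aB : ∫⁻ y, UU (ball (0 : EuclideanSpace ℝ (Fin n)) 1) y * gw n ‖y‖ ≠ ⊤ := by
    refine (le_self_add.trans_lt (sB.le.trans_lt ?_)).ne
    exact ENNReal.mul_lt_top ENNReal.ofReal_lt_top mB.lt_top
  have tA := congrArg ENNReal.toReal sA
  have tB := congrArg ENNReal.toReal sB
  rw [ENNReal.toReal_add aA bA, ENNReal.toReal_mul, ENNReal.toReal_ofReal hc0.le] at tA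
  rw [ENNReal.toReal_add aB bB, ENNReal.toReal_mul, ENNReal.toReal_ofReal hc0.le] at tB
  rw [← ENNReal.toReal_le_toReal aA aB] at hcmp
  rw [mul_sub]
  linarith

/-- Even-dimensional case, `n ≥ 4`: if the spherical averages of `I_{n-2} f_E` are
nonincreasing and nonnegative, then the mean of `I_{n-2} f_E` over `B_1` is
controlled by `I_{n-1} f_E(0)`, with a constant depending only on `n`. -/
theorem statement14 (n : ℕ) (hn : 4 ≤ n) (heven : Even n) :
    ∃ C : ℝ, 0 < C ∧ ∀ E : Set (EuclideanSpace ℝ (Fin n)), HasFinitePerimeter E →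
      volume E = volume (ball (0 : EuclideanSpace ℝ (Fin n)) 1) →
      AntitoneOn (sphAvg (rieszPot ((n : ℝ) - 2) (fE E))) (Set.Ioi 0) →
      (∀ r ∈ Set.Ioi (0 : ℝ), 0 ≤ sphAvg (rieszPot ((n : ℝ) - 2) (fE E)) r) →
      ballAvg (rieszPot ((n : ℝ) - 2) (fE E)) 1 ≤
        C * rieszPot ((n : ℝ) - 1) (fE E) 0 := by
  have hn3 : 3 ≤ n := by omega
  have hn' : (4 : ℝ) ≤ n := by exact_mod_cast hn
  obtain ⟨c, hc0, hc⟩ := J_lem hn3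
  have hσ := rieszConst_pos n ((n : ℝ) - 2) (by linarith) (by linarith)
  have hσ' := rieszConst_pos n ((n : ℝ) - 1) (by linarith) (by linarith)
  have hv : 0 < (volume (ball (0 : EuclideanSpace ℝ (Fin n)) 1)).toReal :=
    ENNReal.toReal_pos (measure_ball_pos _ _ one_pos).ne' measure_ball_lt_top.ne
  refine ⟨(volume (ball (0 : EuclideanSpace ℝ (Fin n)) 1)).toReal⁻¹ *
    (rieszConst n ((n : ℝ) - 2) * c / rieszConst n ((n : ℝ) - 1)), by positivity, ?_⟩
  intro E hE hvol _ hnn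
  have hfin : volume E ≠ ⊤ := by rw [hvol]; exact measure_ball_lt_top.ne
  have key := final hn3 c hc0 hc E hE.1 hfin hnn
  have h2 : rieszPot ((n : ℝ) - 1) (fE E) 0 =
      rieszConst n ((n : ℝ) - 1) * ∫ ξ, fE E ξ * ‖ξ‖ ^ (-1 : ℝ) := by
    unfold rieszPot
    rw [show ((n : ℝ) - 1 - n) = -1 by ring]
    simp only [zero_sub, norm_neg]
  rw [h2, ballAvg, mul_assoc]
  refine mul_le_mul_of_nonneg_left (key.trans_eq ?_) (by positivity)
  field_simp
end
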